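/- Let (X_i)_{i∈N} be a sequence of countable two-dimensional SFTs given effectively, i.e., there is a computable function sending each i ∈ N to a finite list of forbidden patterns defining X_i. Then there exists a countable two-dimensional SFT X and a poset P' whose longest chain has at most 4 elements, such that the subpattern poset SP(X) is order-isomorphic to the incomparable disjoint union P' ⊠ (⊠_{i∈N} SP(X_i)) (the disjoint union of P' and all the posets SP(X_i), with no order relations between elements belonging to different summands). Moreover, if every X_i is deterministic in the direction (1,1), then X can be chosen deterministic in the direction (1,1) as well. -/

import Mathlib

/-- Translation of a two-dimensional configuration. -/
def shift2 {S : Type*} (n : ℤ × ℤ) (x : ℤ × ℤ → S) : ℤ × ℤ → S := fun m => x (n + m)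

/-- The pattern with domain `D` and content `p` occurs in `x`. -/
def occurs2 {S : Type*} (D : Finset (ℤ × ℤ)) (p : ℤ × ℤ → S) (x : ℤ × ℤ → S) : Prop :=
  ∃ n : ℤ × ℤ, ∀ m ∈ D, x (n + m) = p m

/-- A two-dimensional subshift of finite type: the configurations in which no pattern from a
fixed finite set of forbidden finite patterns occurs. -/
def IsSFT2 {S : Type*} (X : Set (ℤ × ℤ → S)) : Prop :=
  ∃ F : Set (Finset (ℤ × ℤ) × (ℤ × ℤ → S)), F.Finite ∧
    X = {x | ∀ P ∈ F, ¬ occurs2 P.1 P.2 x}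

/-- `x ≤ y` in the subpattern preorder: every finite pattern occurring in `x` occurs in `y`. -/
def patLE2 {S : Type*} (x y : ℤ × ℤ → S) : Prop :=
  ∀ (D : Finset (ℤ × ℤ)) (n : ℤ × ℤ), ∃ n' : ℤ × ℤ, ∀ m ∈ D, y (n' + m) = x (n + m)

/-- `x < y` in the subpattern preorder. -/
def patLT2 {S : Type*} (x y : ℤ × ℤ → S) : Prop := patLE2 x y ∧ ¬ patLE2 y x

/-- `X` is southward deterministic: two configurations of `X` agreeing on the upper half-plane
`{(a,b) : b ≥ 1}` are equal. -/
def SouthDet {S : Type*} (X : Set (ℤ × ℤ → S)) : Prop :=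
  ∀ x ∈ X, ∀ y ∈ X, (∀ a b : ℤ, 1 ≤ b → x (a, b) = y (a, b)) → x = y

/-- Counterclockwise rotation by 90 degrees. -/
def rot90 (v : ℤ × ℤ) : ℤ × ℤ := (-v.2, v.1)

/-- The action of an element of `SL₂(ℤ)` on integer vectors. -/
def sl2Vec (A : Matrix.SpecialLinearGroup (Fin 2) ℤ) (v : ℤ × ℤ) : ℤ × ℤ :=
  ((A : Matrix (Fin 2) (Fin 2) ℤ) 0 0 * v.1 + (A : Matrix (Fin 2) (Fin 2) ℤ) 0 1 * v.2,
   (A : Matrix (Fin 2) (Fin 2) ℤ) 1 0 * v.1 + (A : Matrix (Fin 2) (Fin 2) ℤ) 1 1 * v.2)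

/-- The action of `SL₂(ℤ)` on configurations: `A(x)_n = x_{A⁻¹ n}`. -/
def confAct {S : Type*} (A : Matrix.SpecialLinearGroup (Fin 2) ℤ) (x : ℤ × ℤ → S) :
    ℤ × ℤ → S := fun n => x (sl2Vec A⁻¹ n)

/-- `X` is deterministic in the direction `d`: the image of `X` under the element of `SL₂(ℤ)`
taking the 90°-counterclockwise rotation of `d` to `(1,0)` is southward deterministic. -/
def DetInDir {S : Type*} (d : ℤ × ℤ) (X : Set (ℤ × ℤ → S)) : Prop :=
  ∃ A : Matrix.SpecialLinearGroup (Fin 2) ℤ,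
    sl2Vec A (rot90 d) = (1, 0) ∧ SouthDet ((confAct A) '' X)

/-- `X` is deterministic in some direction. -/
def DetSomeDir {S : Type*} (X : Set (ℤ × ℤ → S)) : Prop :=
  ∃ d : ℤ × ℤ, IsCoprime d.1 d.2 ∧ DetInDir d X

/-- Occurrence of a pattern given as a list of (position, symbol) pairs. -/
def occursL {A : Type*} (p : List ((ℤ × ℤ) × A)) (x : ℤ × ℤ → A) : Prop :=
  ∃ t : ℤ × ℤ, ∀ q ∈ p, x (t + q.1) = q.2

/-- The points of the subshift `X`, as a carrier for the subpattern preorder. -/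
def SubPt {A : Type*} (X : Set (ℤ × ℤ → A)) : Type _ := {x : ℤ × ℤ → A // x ∈ X}

instance SubPt.instPreorder {A : Type*} (X : Set (ℤ × ℤ → A)) : Preorder (SubPt X) where
  le a b := patLE2 a.1 b.1
  le_refl a D n := ⟨n, fun _ _ => rfl⟩
  le_trans a b c hab hbc D n := by
    obtain ⟨n', h'⟩ := hab D n
    obtain ⟨n'', h''⟩ := hbc D n'
    exact ⟨n'', fun m hm => (h'' m hm).trans (h' m hm)⟩

/-- The subpattern poset of a two-dimensional subshift: the partial order of equivalence
classes of its points under the subpattern preorder. -/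
abbrev SP {A : Type*} (X : Set (ℤ × ℤ → A)) :=
  Antisymmetrization (SubPt X) (· ≤ ·)

namespace UnionSFT

/-! ### The subpattern preorder -/

section Basic

variable {S T : Type*}

theorem ple_trans {x y z : ℤ × ℤ → S} (h : patLE2 x y) (h' : patLE2 y z) : patLE2 x z := by
  intro D n
  obtain ⟨n', h1⟩ := h D n
  obtain ⟨n'', h2⟩ := h' D n'
  exact ⟨n'', fun m hm => (h2 m hm).trans (h1 m hm)⟩

theorem patLE2_shift_left {x : ℤ × ℤ → S} (n : ℤ × ℤ) : patLE2 (shift2 n x) x := by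
  intro D k
  exact ⟨n + k, fun m _ => by simp [shift2, add_assoc]⟩

theorem patLE2_shift_right {x : ℤ × ℤ → S} (n : ℤ × ℤ) : patLE2 x (shift2 n x) := by
  intro D k
  exact ⟨k - n, fun m _ => by simp only [shift2]; congr 1; abel⟩

theorem shift2_shift2 (a b : ℤ × ℤ) (x : ℤ × ℤ → S) :
    shift2 a (shift2 b x) = shift2 (b + a) x := by
  funext m; simp [shift2, add_assoc]

@[simp] theorem shift2_zero (x : ℤ × ℤ → S) : shift2 0 x = x := by
  funext m; simp [shift2]

/-- The points with coordinates bounded by `r` in absolute value. -/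
noncomputable def boxR (r : ℕ) : Finset (ℤ × ℤ) := Finset.Icc (-(r : ℤ)) r ×ˢ Finset.Icc (-(r : ℤ)) r

theorem mem_boxR {r : ℕ} {m : ℤ × ℤ} :
    m ∈ boxR r ↔ (-(r : ℤ) ≤ m.1 ∧ m.1 ≤ r) ∧ (-(r : ℤ) ≤ m.2 ∧ m.2 ≤ r) := by
  simp [boxR]

theorem exists_boxR (D : Finset (ℤ × ℤ)) : ∃ r, D ⊆ boxR r := by
  refine ⟨D.sup fun m => m.1.natAbs + m.2.natAbs, fun m hm => ?_⟩
  have := Finset.le_sup (f := fun m : ℤ × ℤ => m.1.natAbs + m.2.natAbs) hm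
  rw [mem_boxR]
  omega

theorem patLE2_iff_box {x y : ℤ × ℤ → S} :
    patLE2 x y ↔ ∀ r : ℕ, ∃ n : ℤ × ℤ, ∀ m ∈ boxR r, y (n + m) = x m := by
  constructor
  · intro h r
    obtain ⟨n, hn⟩ := h (boxR r) 0
    exact ⟨n, fun m hm => by simpa using hn m hm⟩
  · intro h D k
    obtain ⟨r, hr⟩ := exists_boxR (D.image fun m => k + m)
    obtain ⟨n, hn⟩ := h r
    refine ⟨n + k, fun m hm => ?_⟩
    rw [add_assoc]
    exact hn _ (hr (Finset.mem_image_of_mem _ hm))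

theorem boxR_mono {r s : ℕ} (h : r ≤ s) : boxR r ⊆ boxR s := by
  intro m; rw [mem_boxR, mem_boxR]; omega

/-- A sliding-block map is monotone for the subpattern preorder. -/
theorem ple_map_of_local {x y : ℤ × ℤ → S} {x' y' : ℤ × ℤ → T}
    (loc : ∀ r : ℕ, ∃ R : ℕ, ∀ n : ℤ × ℤ, (∀ m ∈ boxR R, y (n + m) = x m) →
      ∃ n' : ℤ × ℤ, ∀ m ∈ boxR r, y' (n' + m) = x' m)
    (h : patLE2 x y) : patLE2 x' y' := by
  rw [patLE2_iff_box] at h ⊢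
  intro r
  obtain ⟨R, hR⟩ := loc r
  obtain ⟨n, hn⟩ := h R
  exact hR n hn

end Basic

/-! ### Subpattern posets of disjoint unions -/

theorem sp_iso_of_decomposition {S : Type} {A : ℕ → Type} {X Z : Set (ℤ × ℤ → S)}
    {Xs : ∀ i, Set (ℤ × ℤ → A i)}
    (e : ∀ i, SubPt (Xs i) → (ℤ × ℤ → S)) (he : ∀ i x, e i x ∈ X) (hZ : Z ⊆ X)
    (hord : ∀ i j x y, patLE2 (e i x) (e j y) ↔ ∃ h : i = j, patLE2 (h ▸ x).1 y.1)
    (hZe : ∀ z ∈ Z, ∀ i x, ¬ patLE2 z (e i x) ∧ ¬ patLE2 (e i x) z)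
    (hcov : ∀ y ∈ X, y ∈ Z ∨ ∃ i x n, y = shift2 n (e i x)) :
    Nonempty (SP X ≃o (SP Z ⊕ (Σ i : ℕ, SP (Xs i)))) := by
  let g : SP Z ⊕ (Σ i : ℕ, SP (Xs i)) → SubPt X := fun a => match a with
    | Sum.inl z => ⟨(ofAntisymmetrization (· ≤ ·) z).1, hZ (ofAntisymmetrization (· ≤ ·) z).2⟩
    | Sum.inr s => ⟨e s.1 (ofAntisymmetrization (· ≤ ·) s.2), he _ _⟩
  let F : SP Z ⊕ (Σ i : ℕ, SP (Xs i)) → SP X := fun a => toAntisymmetrization (· ≤ ·) (g a)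
  have hF : ∀ a b, F a ≤ F b ↔ a ≤ b := by
    intro a b
    simp only [F, toAntisymmetrization_le_toAntisymmetrization_iff]
    rcases a with z | ⟨i, x⟩ <;> rcases b with w | ⟨j, y⟩
    · rw [Sum.inl_le_inl_iff, ← ofAntisymmetrization_le_ofAntisymmetrization_iff]
      exact Iff.rfl
    · simp only [Sum.not_inl_le_inr, iff_false]
      exact (hZe _ (ofAntisymmetrization (· ≤ ·) z).2 _ _).1
    · simp only [Sum.not_inr_le_inl, iff_false]
      exact (hZe _ (ofAntisymmetrization (· ≤ ·) w).2 _ _).2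
    · rw [Sum.inr_le_inr_iff, Sigma.le_def]
      refine (hord _ _ _ _).trans ?_
      constructor
      · rintro ⟨h, h'⟩
        dsimp only at h
        subst h
        exact ⟨rfl, ofAntisymmetrization_le_ofAntisymmetrization_iff.1 h'⟩
      · rintro ⟨h, h'⟩
        dsimp only at h
        subst h
        exact ⟨rfl, ofAntisymmetrization_le_ofAntisymmetrization_iff.2 h'⟩
  have hs : Function.Surjective F := by
    intro y
    induction y using Antisymmetrization.ind with
    | _ y =>
      have key : ∀ a : SubPt X, (∃ b, patLE2 (g b).1 a.1 ∧ patLE2 a.1 (g b).1) →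
          ∃ b, F b = toAntisymmetrization (· ≤ ·) a := by
        rintro a ⟨b, h1, h2⟩
        exact ⟨b, Quotient.sound (s := AntisymmRel.setoid (SubPt X) (· ≤ ·)) ⟨h1, h2⟩⟩
      apply key
      rcases hcov y.1 y.2 with h | ⟨i, x, n, h⟩
      · refine ⟨Sum.inl (toAntisymmetrization (· ≤ ·) ⟨y.1, h⟩), ?_⟩
        exact Quotient.mk_out (s := AntisymmRel.setoid (SubPt Z) (· ≤ ·)) (⟨y.1, h⟩ : SubPt Z)
      · refine ⟨Sum.inr ⟨i, toAntisymmetrization (· ≤ ·) x⟩, ?_⟩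
        have hx := Quotient.mk_out (s := AntisymmRel.setoid (SubPt (Xs i)) (· ≤ ·)) x
        have h1 : patLE2 (e i (ofAntisymmetrization (· ≤ ·)
            (toAntisymmetrization (α := SubPt (Xs i)) (· ≤ ·) x))) (e i x) :=
          (hord _ _ _ _).2 ⟨rfl, hx.1⟩
        have h2 : patLE2 (e i x) (e i (ofAntisymmetrization (· ≤ ·)
            (toAntisymmetrization (α := SubPt (Xs i)) (· ≤ ·) x))) :=
          (hord _ _ _ _).2 ⟨rfl, hx.2⟩
        rw [h]
        exact ⟨ple_trans h1 (patLE2_shift_right n), ple_trans (patLE2_shift_left n) h2⟩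
  exact ⟨((RelIso.ofSurjective (OrderEmbedding.ofMapLEIff F hF) hs) : _ ≃o SP X).symm⟩

/-! ### Tame configurations -/

section Tame

variable {S T U : Type*}

/-- Truncation of an integer to `[-B, B]`. -/
def clipZ (B : ℕ) (z : ℤ) : ℤ := max (-(B : ℤ)) (min z B)

/-- The three linear forms governing tame configurations. -/
def lform (k : Fin 3) (m : ℤ × ℤ) : ℤ :=
  match k with
  | 0 => m.1
  | 1 => m.2
  | 2 => m.2 - m.1

theorem lform_add (k : Fin 3) (m m' : ℤ × ℤ) : lform k (m + m') = lform k m + lform k m' := by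
  fin_cases k <;> simp [lform]; ring

theorem eq_of_lform {k l : Fin 3} (h : k ≠ l) {m m' : ℤ × ℤ} (h1 : lform k m = lform k m')
    (h2 : lform l m = lform l m') : m = m' := by
  fin_cases k <;> fin_cases l <;> simp [lform] at h h1 h2 <;> ext <;> omega

/-- `y m` depends only on the truncations of the linear forms at `m`. -/
def TameB (B : ℕ) (y : ℤ × ℤ → S) : Prop :=
  ∀ m₁ m₂, (∀ k, clipZ B (lform k m₁) = clipZ B (lform k m₂)) → y m₁ = y m₂

/-- Tame configurations: the symbols depend on truncations of linear forms. -/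
def Tame (y : ℤ × ℤ → S) : Prop := ∃ B, TameB B y

/-- Configurations depending on the truncation of a single linear form. -/
def TameOne (y : ℤ × ℤ → S) : Prop :=
  ∃ k B, ∀ m m', clipZ B (lform k m) = clipZ B (lform k m') → y m = y m'

theorem clipZ_mono {B C : ℕ} (h : B ≤ C) {z w : ℤ} (e : clipZ C z = clipZ C w) :
    clipZ B z = clipZ B w := by
  simp only [clipZ] at *; omega

theorem clipZ_add {B : ℕ} (c : ℤ) {z w : ℤ} (e : clipZ (B + c.natAbs) z = clipZ (B + c.natAbs) w) :
    clipZ B (c + z) = clipZ B (c + w) := by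
  simp only [clipZ, Nat.cast_add] at *; omega

theorem TameB.mono {B C : ℕ} (h : B ≤ C) {y : ℤ × ℤ → S} (hy : TameB B y) : TameB C y :=
  fun m m' e => hy m m' fun k => clipZ_mono h (e k)

theorem Tame.comp₂ {f : ℤ × ℤ → S} {g : ℤ × ℤ → T} (hf : Tame f) (hg : Tame g) (h : S → T → U) :
    Tame fun m => h (f m) (g m) := by
  obtain ⟨B, hB⟩ := hf
  obtain ⟨C, hC⟩ := hg
  refine ⟨max B C, fun m m' e => ?_⟩
  dsimp only
  rw [hB.mono (le_max_left B C) m m' e, hC.mono (le_max_right B C) m m' e]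

theorem Tame.comp {f : ℤ × ℤ → S} (hf : Tame f) (h : S → T) : Tame fun m => h (f m) :=
  hf.comp₂ hf fun a _ => h a

theorem Tame.const (a : S) : Tame fun _ : ℤ × ℤ => a := ⟨0, fun _ _ _ => rfl⟩

theorem Tame.ite {p : ℤ × ℤ → Prop} [DecidablePred p] {f g : ℤ × ℤ → S} (hp : Tame p)
    (hf : Tame f) (hg : Tame g) : Tame fun m => if p m then f m else g m := by
  have := (hp.comp₂ (hf.comp₂ hg fun a b => (a, b)) fun (q : Prop) (ab : S × S) =>
    haveI := Classical.propDecidable q; if q then ab.1 else ab.2)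
  convert this

theorem Tame.of_form (k : Fin 3) (B : ℕ) (h : ℤ → S)
    (hB : ∀ z w, clipZ B z = clipZ B w → h z = h w) : Tame fun m => h (lform k m) :=
  ⟨B, fun _ _ e => hB _ _ (e k)⟩

/-- A function on the integers which is constant near `+∞` and near `-∞`. -/
theorem clip_of_eventually {h : ℤ → S} {K L : ℤ} (hK : ∀ z ≥ K, h z = h K)
    (hL : ∀ z ≤ L, h z = h L) : ∃ B : ℕ, ∀ z w, clipZ B z = clipZ B w → h z = h w := by
  refine ⟨K.natAbs + L.natAbs + 1, fun z w e => ?_⟩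
  by_cases hz : z = w
  · rw [hz]
  simp only [clipZ, Nat.cast_add, Nat.cast_one] at e
  have : (K ≤ z ∧ K ≤ w) ∨ (z ≤ L ∧ w ≤ L) := by omega
  rcases this with ⟨h1, h2⟩ | ⟨h1, h2⟩
  · rw [hK z h1, hK w h2]
  · rw [hL z h1, hL w h2]

theorem countable_tame [Finite S] : {y : ℤ × ℤ → S | Tame y}.Countable := by
  have : {y : ℤ × ℤ → S | Tame y} = ⋃ B, {y | TameB B y} := by ext; simp [Tame]
  rw [this]
  refine Set.countable_iUnion fun B => Set.Finite.countable ?_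
  let I : Type := Fin 3 → Set.Icc (-(B : ℤ)) B
  have hc : ∀ z, clipZ B z ∈ Set.Icc (-(B : ℤ)) B := by
    intro z; simp only [clipZ, Set.mem_Icc]; omega
  let F : (I → S) → (ℤ × ℤ → S) := fun φ m => φ fun k => ⟨clipZ B (lform k m), hc _⟩
  refine (Set.finite_range F).subset fun y hy => ?_
  classical
  refine ⟨fun i => if h : ∃ m : ℤ × ℤ, ∀ k, clipZ B (lform k m) = i k then y h.choose else y 0, ?_⟩
  funext m
  have h : ∃ m' : ℤ × ℤ, ∀ k, clipZ B (lform k m') = clipZ B (lform k m) := ⟨m, fun _ => rfl⟩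
  simp only [F]
  rw [dif_pos h]
  exact hy _ _ h.choose_spec

theorem ultra_trichotomy (u : Ultrafilter ℕ) (z : ℕ → ℤ) :
    (∃ c, ∀ᶠ r in (u : Filter ℕ), z r = c) ∨ (∀ K, ∀ᶠ r in (u : Filter ℕ), K ≤ z r) ∨
      (∀ K, ∀ᶠ r in (u : Filter ℕ), z r ≤ K) := by
  by_contra! hcon
  obtain ⟨h1, ⟨K, hK⟩, ⟨L, hL⟩⟩ := hcon
  have h3 : ∀ᶠ r in (u : Filter ℕ), ∃ c ∈ Set.Ioo L K, z r = c := by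
    filter_upwards [hK, hL] with r h4 h5
    exact ⟨z r, ⟨h5, h4⟩, rfl⟩
  rw [Ultrafilter.eventually_exists_mem_iff (Set.finite_Ioo L K)] at h3
  obtain ⟨c, -, hc⟩ := h3
  obtain ⟨r, h4, h5⟩ := (hc.and (h1 c)).exists
  exact h5 h4

/-- Along an ultrafilter, a translation parameter either stabilises with respect to a linear
form or becomes invisible after truncation. -/
theorem ultra_dichotomy (u : Ultrafilter ℕ) (B : ℕ) (z : ℕ → ℤ) :
    (∃ c, ∀ᶠ r in (u : Filter ℕ), z r = c) ∨
      (∀ a b, ∀ᶠ r in (u : Filter ℕ), clipZ B (z r + a) = clipZ B (z r + b)) := by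
  rcases ultra_trichotomy u z with h | h | h
  · exact Or.inl h
  · refine Or.inr fun a b => (h (B + a.natAbs + b.natAbs)).mono fun r hr => ?_
    simp only [clipZ]; omega
  · refine Or.inr fun a b => (h (-(B + a.natAbs + b.natAbs))).mono fun r hr => ?_
    simp only [clipZ]; omega

theorem ple_limit {x y : ℤ × ℤ → S} (h : patLE2 x y) :
    ∃ (u : Ultrafilter ℕ) (n : ℕ → ℤ × ℤ),
      ∀ m, ∀ᶠ r in (u : Filter ℕ), y (n r + m) = x m := by
  rw [patLE2_iff_box] at h
  choose n hn using h
  refine ⟨Filter.hyperfilter ℕ, n, fun m => ?_⟩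
  obtain ⟨r₀, h₀⟩ := exists_boxR {m}
  have := Nat.hyperfilter_le_atTop (Filter.eventually_ge_atTop r₀)
  refine Filter.mem_of_superset this fun r hr => ?_
  exact hn r m (boxR_mono hr (h₀ (Finset.mem_singleton_self m)))

theorem shift_of_eventually {x y : ℤ × ℤ → S} {u : Ultrafilter ℕ} {n : ℕ → ℤ × ℤ}
    (h : ∀ m, ∀ᶠ r in (u : Filter ℕ), y (n r + m) = x m) {k l : Fin 3} (hkl : k ≠ l)
    (hk : ∃ c, ∀ᶠ r in (u : Filter ℕ), lform k (n r) = c)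
    (hl : ∃ c, ∀ᶠ r in (u : Filter ℕ), lform l (n r) = c) : ∃ n, x = shift2 n y := by
  obtain ⟨c, hc⟩ := hk
  obtain ⟨d, hd⟩ := hl
  obtain ⟨r₀, h1, h2⟩ := (hc.and hd).exists
  refine ⟨n r₀, funext fun m => ?_⟩
  obtain ⟨r, hr, h3, h4⟩ := ((h m).and (hc.and hd)).exists
  rw [← hr, shift2, eq_of_lform hkl (h3.trans h1.symm) (h4.trans h2.symm)]

theorem Tame.below {x y : ℤ × ℤ → S} (hy : Tame y) (h : patLE2 x y) :
    (∃ n, x = shift2 n y) ∨ TameOne x := by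
  obtain ⟨B, hB⟩ := hy
  obtain ⟨u, n, hn⟩ := ple_limit h
  have key : ∀ k, (∀ l ≠ k, ∀ a b, ∀ᶠ r in (u : Filter ℕ),
      clipZ B (lform l (n r) + a) = clipZ B (lform l (n r) + b)) → TameOne x := by
    intro k hk
    have fin : ∀ C, (∀ m m', clipZ C (lform k m) = clipZ C (lform k m') →
        ∀ᶠ r in (u : Filter ℕ), clipZ B (lform k (n r) + lform k m) =
          clipZ B (lform k (n r) + lform k m')) → TameOne x := by
      intro C hC
      refine ⟨k, C, fun m m' e => ?_⟩
      have h1 : ∀ᶠ r in (u : Filter ℕ), ∀ l, clipZ B (lform l (n r + m)) =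
          clipZ B (lform l (n r + m')) := by
        rw [Filter.eventually_all]
        intro l
        simp only [lform_add]
        by_cases hl : l = k
        · subst hl; exact hC m m' e
        · exact hk l hl _ _
      obtain ⟨r, h2, h3, h4⟩ := (h1.and ((hn m).and (hn m'))).exists
      rw [← h3, ← h4]
      exact hB _ _ h2
    rcases ultra_dichotomy u B fun r => lform k (n r) with ⟨c, hc⟩ | hc
    · refine fin (B + c.natAbs) fun m m' e => hc.mono fun r hr => ?_
      rw [hr]
      exact clipZ_add c e
    · exact fin 0 fun m m' _ => hc _ _
  have dich := fun k => ultra_dichotomy u B fun r => lform k (n r)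
  by_cases h0 : ∃ k l, k ≠ l ∧ (∃ c, ∀ᶠ r in (u : Filter ℕ), lform k (n r) = c) ∧
      (∃ c, ∀ᶠ r in (u : Filter ℕ), lform l (n r) = c)
  · obtain ⟨k, l, hkl, hk, hl⟩ := h0
    exact Or.inl (shift_of_eventually hn hkl hk hl)
  · right
    by_cases h1 : ∃ k, ∃ c, ∀ᶠ r in (u : Filter ℕ), lform k (n r) = c
    · obtain ⟨k, hk⟩ := h1
      exact key k fun l hl => (dich l).resolve_left fun hl' => h0 ⟨k, l, hl.symm, hk, hl'⟩
    · exact key 0 fun l _ => (dich l).resolve_left fun hl' => h1 ⟨l, hl'⟩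

theorem TameOne.below {x y : ℤ × ℤ → S} (hy : TameOne y) (h : patLE2 x y) :
    (∃ n, x = shift2 n y) ∨ ∃ a, x = fun _ => a := by
  obtain ⟨k, B, hB⟩ := hy
  obtain ⟨u, n, hn⟩ := ple_limit h
  rcases ultra_dichotomy u B fun r => lform k (n r) with ⟨c, hc⟩ | hc
  · obtain ⟨r₀, h1⟩ := hc.exists
    refine Or.inl ⟨n r₀, funext fun m => ?_⟩
    obtain ⟨r, hr, h3⟩ := ((hn m).and hc).exists
    rw [← hr, shift2]
    refine hB _ _ ?_
    rw [lform_add, lform_add, h3, h1]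
  · refine Or.inr ⟨x 0, funext fun m => ?_⟩
    obtain ⟨r, h1, h2, h3⟩ := ((hn m).and ((hn 0).and (hc (lform k m) (lform k 0)))).exists
    rw [← h1, ← h2]
    refine hB _ _ ?_
    rw [lform_add, lform_add, h3]

theorem const_below {x y : ℤ × ℤ → S} (hy : ∃ a, y = fun _ => a) (h : patLE2 x y) : x = y := by
  obtain ⟨a, rfl⟩ := hy
  funext m
  obtain ⟨n, hn⟩ := h {m} 0
  have := hn m (Finset.mem_singleton_self m)
  simpa using this.symm

/-- In a subshift consisting of tame configurations, chains have at most four elements. -/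
theorem no_chain_of_tame {S : Type} {Z : Set (ℤ × ℤ → S)} (hZ : ∀ y ∈ Z, Tame y)
    (c : Fin 5 → SP Z) : ¬ StrictMono c := by
  intro hc
  let d : Fin 5 → SubPt Z := fun i => ofAntisymmetrization (· ≤ ·) (c i)
  have hd : ∀ i j, i < j → patLE2 (d i).1 (d j).1 ∧ ¬ patLE2 (d j).1 (d i).1 := by
    intro i j hij
    have := ofAntisymmetrization_lt_ofAntisymmetrization_iff.2 (hc hij)
    exact lt_iff_le_not_ge.1 this
  have hns : ∀ i j, i < j → ¬ ∃ n, (d i).1 = shift2 n (d j).1 := by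
    rintro i j hij ⟨n, hn⟩
    apply (hd i j hij).2
    rw [hn]
    exact patLE2_shift_right n
  have cst : ∀ j, (∃ a, (d j).1 = fun _ => a) → ∀ i, ¬ i < j := by
    intro j hj i hij
    exact hns i j hij ⟨0, by rw [shift2_zero]; exact const_below hj (hd i j hij).1⟩
  have h3 := ((hZ _ (d 4).2).below (hd 3 4 (by decide)).1).resolve_left (hns 3 4 (by decide))
  have h2 := (h3.below (hd 2 3 (by decide)).1).resolve_left (hns 2 3 (by decide))
  exact cst 2 h2 1 (by decide)

end Tame
/-! ### Rigid grids from diagonal signals -/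

/-- Integer sign with values in `SignType`. -/
def sgn (z : ℤ) : SignType := if 0 < z then 1 else if z = 0 then 0 else -1

theorem sgn_eq_one {z : ℤ} : sgn z = 1 ↔ 0 < z := by
  unfold sgn; split_ifs <;> simp_all

theorem sgn_eq_zero {z : ℤ} : sgn z = 0 ↔ z = 0 := by
  unfold sgn; split_ifs <;> simp_all; omega

theorem sgn_eq_neg_one {z : ℤ} : sgn z = -1 ↔ z < 0 := by
  unfold sgn; split_ifs <;> simp_all <;> omega

theorem const_of_succ {α : Type*} {f : ℤ → α} (h : ∀ n, f (n + 1) = f n) (n m : ℤ) :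
    f n = f m := by
  have key : ∀ n, f n = f 0 := by
    intro n
    induction n using Int.induction_on with
    | zero => rfl
    | succ i ih => rw [h, ih]
    | pred i ih => rw [← ih, ← h]; congr 1; ring
  rw [key n, key m]

theorem succ_emod {N : ℤ} (hN : 0 < N) (x : ℤ) :
    (x % N = N - 1 ∧ (x + 1) % N = 0 ∧ (x + 1) / N = x / N + 1) ∨
      (x % N + 1 < N ∧ (x + 1) % N = x % N + 1 ∧ (x + 1) / N = x / N) := by
  have h0 := Int.emod_nonneg x hN.ne'
  have h1 := Int.emod_lt_of_pos x hN
  have h2 := Int.emod_add_mul_ediv x N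
  rcases eq_or_lt_of_le (Int.add_one_le_iff.2 h1) with h | h
  · left
    have := (Int.ediv_emod_unique hN (a := x + 1) (r := 0) (q := x / N + 1)).2
      ⟨by rw [mul_add]; omega, le_refl _, hN⟩
    omega
  · right
    have := (Int.ediv_emod_unique hN (a := x + 1) (r := x % N + 1) (q := x / N)).2
      ⟨by omega, by omega, h⟩
    omega

/-- Vertical lines `C`, horizontal lines `R` and diagonal signals `s` in each block. -/
structure DiagGrid (C R : ℤ → Prop) (s : ℤ → ℤ → SignType) : Prop where
  cr : ∀ x y, C x → R y → s x y = 0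
  cn : ∀ x y, C x → ¬ R y → s x y = 1
  nr : ∀ x y, ¬ C x → R y → s x y = -1
  diag : ∀ x y, ¬ C (x + 1) → ¬ R (y + 1) → s (x + 1) (y + 1) = s x y
  lcr : ∀ x y, C (x + 1) → R (y + 1) → s x y = 0
  lcn : ∀ x y, C (x + 1) → ¬ R (y + 1) → s x y = -1
  lnr : ∀ x y, ¬ C (x + 1) → R (y + 1) → s x y = 1

namespace DiagGrid

variable {C R : ℤ → Prop} {s : ℤ → ℤ → SignType}

theorem swap (h : DiagGrid C R s) : DiagGrid R C fun y x => -s x y where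
  cr x y h1 h2 := by simp [h.cr y x h2 h1]
  cn x y h1 h2 := by simp [h.nr y x h2 h1]
  nr x y h1 h2 := by simp [h.cn y x h2 h1]
  diag x y h1 h2 := by simp [h.diag y x h2 h1]
  lcr x y h1 h2 := by simp [h.lcr y x h2 h1]
  lcn x y h1 h2 := by simp [h.lnr y x h2 h1]
  lnr x y h1 h2 := by simp [h.lcn y x h2 h1]

theorem run (h : DiagGrid C R s) {x y : ℤ} (k : ℕ) (hC : ∀ i : ℤ, 0 < i → i ≤ k → ¬ C (x + i))
    (hR : ∀ i : ℤ, 0 < i → i ≤ k → ¬ R (y + i)) : s (x + k) (y + k) = s x y := by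
  induction k with
  | zero => simp
  | succ k ih =>
    rw [← ih (fun i h1 h2 => hC i h1 (by push_cast; omega))
      (fun i h1 h2 => hR i h1 (by push_cast; omega))]
    have h1 := hC (k + 1) (by omega) (by push_cast; omega)
    have h2 := hR (k + 1) (by omega) (by push_cast; omega)
    push_cast
    rw [← add_assoc] at h1 h2
    rw [← add_assoc, ← add_assoc]
    exact h.diag _ _ h1 h2

theorem exists_row (h : DiagGrid C R s) {x0 g : ℤ} (hg : 0 < g) (h0 : C x0) (h1 : C (x0 + g))
    (hno : ∀ i, 0 < i → i < g → ¬ C (x0 + i)) (y : ℤ) :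
    ∃ i, 0 < i ∧ i ≤ g ∧ R (y + i) := by
  by_contra! hcon
  have hr := h.run (x := x0) (y := y) (g - 1).toNat (fun i h1 h2 => hno i h1 (by omega))
    (fun i h1 h2 => hcon i h1 (by omega))
  have e : ((g - 1).toNat : ℤ) = g - 1 := Int.toNat_of_nonneg (by omega)
  rw [e] at hr
  have hl := h.lcn (x0 + (g - 1)) (y + (g - 1)) (by rwa [add_assoc, sub_add_cancel])
    (by rw [add_assoc, sub_add_cancel]; exact hcon g hg le_rfl)
  rw [hr] at hl
  by_cases hy : R y
  · rw [h.cr _ _ h0 hy] at hl; exact absurd hl (by decide)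
  · rw [h.cn _ _ h0 hy] at hl; exact absurd hl (by decide)

theorem next_row (h : DiagGrid C R s) {x0 g : ℤ} (hg : 0 < g) (h0 : C x0) (h1 : C (x0 + g))
    (hno : ∀ i, 0 < i → i < g → ¬ C (x0 + i)) {y : ℤ} (hy : R y) :
    R (y + g) ∧ ∀ i, 0 < i → i < g → ¬ R (y + i) := by
  have key : ∀ k : ℕ, (k : ℤ) < g → ∀ i : ℤ, 0 < i → i ≤ k → ¬ R (y + i) := by
    intro k
    induction k with
    | zero => intro _ i h1 h2; push_cast at h2; omega
    | succ k ih =>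
      intro hk i hi hik
      push_cast at hk hik
      rcases lt_or_eq_of_le hik with h2 | rfl
      · exact ih (by omega) i hi (by omega)
      · intro hR
        have hr := h.run (x := x0) (y := y) k (fun i h1 h2 => hno i h1 (by omega))
          (ih (by omega))
        have hl := h.lnr (x0 + k) (y + k) (by rw [add_assoc]; exact hno _ (by omega) hk)
          (by rwa [add_assoc])
        rw [hr, h.cr _ _ h0 hy] at hl
        exact absurd hl (by decide)
  have h3 : ∀ i, 0 < i → i < g → ¬ R (y + i) := by
    intro i hi hig
    exact key i.toNat (by omega) i hi (by omega)
  refine ⟨?_, h3⟩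
  obtain ⟨i, hi, hig, hR⟩ := h.exists_row hg h0 h1 hno y
  rcases lt_or_eq_of_le hig with h2 | rfl
  · exact absurd hR (h3 i hi h2)
  · exact hR

theorem rows_of_gap (h : DiagGrid C R s) {x0 g : ℤ} (hg : 0 < g) (h0 : C x0) (h1 : C (x0 + g))
    (hno : ∀ i, 0 < i → i < g → ¬ C (x0 + i)) : ∃ y0, ∀ y, R y ↔ g ∣ y - y0 := by
  obtain ⟨i, -, -, hi⟩ := h.exists_row hg h0 h1 hno 0
  have up : ∀ y, R y → ∀ k : ℕ, R (y + g * k) := by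
    intro y hy k
    induction k with
    | zero => simpa using hy
    | succ k ih =>
      have := (h.next_row hg h0 h1 hno ih).1
      push_cast
      rwa [mul_add, mul_one, ← add_assoc]
  have dv : ∀ y y', R y → R y' → y ≤ y' → g ∣ y' - y := by
    intro y y' hy hy' hle
    have e1 := Int.emod_add_mul_ediv (y' - y) g
    have e2 := Int.emod_nonneg (y' - y) hg.ne'
    have e3 := Int.emod_lt_of_pos (y' - y) hg
    have e4 : 0 ≤ (y' - y) / g := Int.ediv_nonneg (by omega) hg.le
    have h2 := up y hy ((y' - y) / g).toNat
    rw [Int.toNat_of_nonneg e4] at h2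
    by_contra hd
    have hpos : 0 < (y' - y) % g :=
      lt_of_le_of_ne e2 fun h => hd (Int.dvd_of_emod_eq_zero h.symm)
    refine (h.next_row hg h0 h1 hno h2).2 _ hpos e3 ?_
    convert hy' using 1
    omega
  have dv' : ∀ y y', R y → R y' → g ∣ y' - y := by
    intro y y' hy hy'
    rcases le_total y y' with h2 | h2
    · exact dv y y' hy hy' h2
    · rw [← dvd_neg, neg_sub]; exact dv y' y hy' hy h2
  refine ⟨0 + i, fun y => ⟨fun hy => dv' _ _ hi hy, fun hy => ?_⟩⟩
  obtain ⟨j, hj1, hj2, hj⟩ := h.exists_row hg h0 h1 hno (y - g)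
  have h3 := dvd_sub (dv' _ _ hi hj) hy
  have h4 : g ∣ j - g := by
    rwa [show y - g + j - (0 + i) - (y - (0 + i)) = j - g by ring] at h3
  have h5 : j - g = 0 := Int.eq_zero_of_abs_lt_dvd h4 (by rw [abs_lt]; omega)
  have h6 : y - g + j = y := by omega
  rwa [h6] at hj

theorem exists_gap {C : ℤ → Prop} (h : ∃ x x', x ≠ x' ∧ C x ∧ C x') :
    ∃ x0 g, 0 < g ∧ C x0 ∧ C (x0 + g) ∧ ∀ i, 0 < i → i < g → ¬ C (x0 + i) := by
  classical
  have h2 : ∃ x, ∃ k : ℕ, C x ∧ C (x + (k + 1 : ℕ)) := by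
    obtain ⟨x, x', hne, hx, hx'⟩ := h
    rcases lt_or_gt_of_ne hne with h | h
    · exact ⟨x, (x' - x - 1).toNat, hx, by convert hx' using 1; omega⟩
    · exact ⟨x', (x - x' - 1).toNat, hx', by convert hx using 1; omega⟩
  obtain ⟨x, hk⟩ := h2
  refine ⟨x, (Nat.find hk + 1 : ℕ), by omega, (Nat.find_spec hk).1, (Nat.find_spec hk).2, ?_⟩
  intro i hi hig hC
  refine Nat.find_min hk (m := (i - 1).toNat) (by omega) ⟨(Nat.find_spec hk).1, ?_⟩
  convert hC using 2; omega

theorem rigid_aux (h : DiagGrid C R s) (h2 : ∃ x x', x ≠ x' ∧ C x ∧ C x') :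
    ∃ N x0 y0 : ℤ, 0 < N ∧ (∀ x, C x ↔ N ∣ x - x0) ∧ ∀ y, R y ↔ N ∣ y - y0 := by
  obtain ⟨x0, g, hg, h0, h1, hno⟩ := exists_gap h2
  obtain ⟨y0, hy⟩ := h.rows_of_gap hg h0 h1 hno
  obtain ⟨x1, hx⟩ := h.swap.rows_of_gap (x0 := y0) hg ((hy _).2 (by simp)) ((hy _).2 (by simp))
    (fun i h1 h2 h3 => by
      have := (hy _).1 h3
      rw [add_sub_cancel_left] at this
      exact absurd (Int.le_of_dvd h1 this) (by omega))
  exact ⟨g, x1, y0, hg, hx, hy⟩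

theorem rigid (h : DiagGrid C R s)
    (h2 : (∃ x x', x ≠ x' ∧ C x ∧ C x') ∨ ∃ y y', y ≠ y' ∧ R y ∧ R y') :
    ∃ N x0 y0 : ℤ, 0 < N ∧ (∀ x, C x ↔ N ∣ x - x0) ∧ ∀ y, R y ↔ N ∣ y - y0 := by
  rcases h2 with h2 | h2
  · exact h.rigid_aux h2
  · obtain ⟨N, y0, x0, hN, h3, h4⟩ := h.swap.rigid_aux h2
    exact ⟨N, x0, y0, hN, h4, h3⟩

theorem sign_eq {N : ℤ} (hN : 0 < N) (h : DiagGrid (fun x => N ∣ x) (fun y => N ∣ y) s) (x y : ℤ) :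
    s x y = sgn (y % N - x % N) := by
  have key : ∀ k : ℕ, ∀ x y, x % N = k → s x y = sgn (y % N - x % N) := by
    intro k
    induction k with
    | zero =>
      intro x y hx
      have hx' : N ∣ x := Int.dvd_of_emod_eq_zero (by simpa using hx)
      have h0 := Int.emod_nonneg y hN.ne'
      by_cases hy : N ∣ y
      · rw [h.cr _ _ hx' hy, eq_comm, sgn_eq_zero]
        rw [Int.dvd_iff_emod_eq_zero] at hx' hy
        omega
      · rw [h.cn _ _ hx' hy, eq_comm, sgn_eq_one]
        rw [Int.dvd_iff_emod_eq_zero] at hx' hy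
        omega
    | succ k ih =>
      intro x y hx
      have h0 := Int.emod_nonneg y hN.ne'
      have hx' : ¬ N ∣ x := by rw [Int.dvd_iff_emod_eq_zero]; push_cast at hx; omega
      by_cases hy : N ∣ y
      · rw [h.nr _ _ hx' hy, eq_comm, sgn_eq_neg_one]
        rw [Int.dvd_iff_emod_eq_zero] at hx' hy
        push_cast at hx
        omega
      · have h1 := h.diag (x - 1) (y - 1) (by simpa using hx') (by simpa using hy)
        have h2 := succ_emod hN (x - 1)
        have h3 := succ_emod hN (y - 1)
        rw [Int.dvd_iff_emod_eq_zero] at hx' hy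
        simp only [sub_add_cancel] at h1 h2 h3
        push_cast at hx
        rw [h1, ih (x - 1) (y - 1) (by omega)]
        congr 1
        omega
  exact key (x % N).toNat x y (Int.toNat_of_nonneg (Int.emod_nonneg x hN.ne')).symm

end DiagGrid

/-! ### Two-dimensional rules -/

/-- The configurations all of whose `2 × 2` windows satisfy `W`
(south-west, south-east, north-west, north-east). -/
def winSet {S : Type*} (W : S → S → S → S → Prop) : Set (ℤ × ℤ → S) :=
  {x | ∀ m, W (x m) (x (m + (1, 0))) (x (m + (0, 1))) (x (m + (1, 1)))}

theorem isSFT2_winSet {S : Type*} [Finite S] (W : S → S → S → S → Prop) : IsSFT2 (winSet W) := by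
  classical
  let D : Finset (ℤ × ℤ) := {(0, 0), (1, 0), (0, 1), (1, 1)}
  let pat : S × S × S × S → (ℤ × ℤ → S) := fun q m =>
    if m = (0, 0) then q.1 else if m = (1, 0) then q.2.1 else if m = (0, 1) then q.2.2.1 else q.2.2.2
  refine ⟨(fun q => (D, pat q)) '' {q | ¬ W q.1 q.2.1 q.2.2.1 q.2.2.2},
    (Set.toFinite _).image _, ?_⟩
  ext x
  simp only [winSet, Set.mem_ofPred_eq, Set.forall_mem_image]
  constructor
  · rintro h q hq ⟨n, hn⟩
    apply hq
    have e1 := hn (0, 0) (by simp [D])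
    have e2 := hn (1, 0) (by simp [D])
    have e3 := hn (0, 1) (by simp [D])
    have e4 := hn (1, 1) (by simp [D])
    simp only [pat] at e1 e2 e3 e4
    simp at e1 e2 e3 e4
    rw [← e1, ← e2, ← e3, ← e4]
    have e0 : n + ((0, 0) : ℤ × ℤ) = n := add_zero n
    simpa [e0] using h n
  · intro h m
    by_contra hW
    refine h (x := (x m, x (m + (1, 0)), x (m + (0, 1)), x (m + (1, 1)))) hW ⟨m, ?_⟩
    intro k hk
    simp only [D, Finset.mem_insert, Finset.mem_singleton] at hk
    rcases hk with rfl | rfl | rfl | rfl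
    · have e0 : m + ((0, 0) : ℤ × ℤ) = m := add_zero m
      simp [pat, e0]
    · simp [pat]
    · simp [pat]
    · simp [pat]

theorem winSet_shift {S : Type*} {W : S → S → S → S → Prop} {x : ℤ × ℤ → S} (h : x ∈ winSet W)
    (n : ℤ × ℤ) : shift2 n x ∈ winSet W := by
  intro m
  have := h (n + m)
  simpa only [shift2, add_assoc] using this

theorem sl2Vec_inv (A : Matrix.SpecialLinearGroup (Fin 2) ℤ) (m : ℤ × ℤ) :
    sl2Vec A⁻¹ m = (A.1 1 1 * m.1 - A.1 0 1 * m.2, A.1 0 0 * m.2 - A.1 1 0 * m.1) := by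
  simp only [sl2Vec, Matrix.SpecialLinearGroup.coe_inv, Matrix.adjugate_fin_two]
  ext <;> simp <;> ring

theorem sl2Vec_sl2Vec_inv (A : Matrix.SpecialLinearGroup (Fin 2) ℤ) (m : ℤ × ℤ) :
    sl2Vec A (sl2Vec A⁻¹ m) = m := by
  have hd := A.2
  rw [Matrix.det_fin_two] at hd
  rw [sl2Vec_inv]
  ext
  · simp only [sl2Vec]; linear_combination m.1 * hd
  · simp only [sl2Vec]; linear_combination m.2 * hd

theorem sl2Vec_inv_sl2Vec (A : Matrix.SpecialLinearGroup (Fin 2) ℤ) (m : ℤ × ℤ) :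
    sl2Vec A⁻¹ (sl2Vec A m) = m := by
  have hd := A.2
  rw [Matrix.det_fin_two] at hd
  rw [sl2Vec_inv]
  ext
  · simp only [sl2Vec]; linear_combination m.1 * hd
  · simp only [sl2Vec]; linear_combination m.2 * hd

/-- If the north-east symbol of a window is determined by the others, the subshift is
deterministic in the direction `(1, 1)`. -/
theorem detInDir_winSet {S : Type*} {W : S → S → S → S → Prop}
    (hW : ∀ a b c d d', W a b c d → W a b c d' → d = d') : DetInDir (1, 1) (winSet W) := by
  refine ⟨⟨!![0, 1; -1, -1], by simp [Matrix.det_fin_two]⟩, by simp [sl2Vec, rot90], ?_⟩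
  rintro _ ⟨x, hx, rfl⟩ _ ⟨y, hy, rfl⟩ hxy
  have hinv : ∀ m : ℤ × ℤ, sl2Vec (⟨!![0, 1; -1, -1], by simp [Matrix.det_fin_two]⟩ :
      Matrix.SpecialLinearGroup (Fin 2) ℤ)⁻¹ m = (-m.1 - m.2, m.1) := by
    intro m
    refine (sl2Vec_inv _ m).trans ?_
    ext <;> simp
  have low : ∀ m : ℤ × ℤ, m.1 + m.2 ≤ -1 → x m = y m := by
    rintro ⟨a, b⟩ hab
    have := hxy b (-a - b) (by dsimp at hab; omega)
    simp only [confAct, hinv] at this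
    rwa [show -b - (-a - b) = a by ring] at this
  suffices x = y by rw [this]
  have key : ∀ k : ℕ, ∀ m : ℤ × ℤ, m.1 + m.2 ≤ (k : ℤ) - 1 → x m = y m := by
    intro k
    induction k with
    | zero => intro m hm; exact low m (by simpa using hm)
    | succ k ih =>
      rintro ⟨a, b⟩ hab
      push_cast at hab
      have h1 := hx (a - 1, b - 1)
      have h2 := hy (a - 1, b - 1)
      simp only [Prod.mk_add_mk, sub_add_cancel, add_zero] at h1 h2
      rw [ih (a - 1, b - 1) (by dsimp; omega), ih (a, b - 1) (by dsimp; omega),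
        ih (a - 1, b) (by dsimp; omega)] at h1
      exact hW _ _ _ _ _ h1 h2
  funext m
  exact key (m.1 + m.2 + 1).toNat m (by omega)

theorem low_eq_of_detInDir {S : Type*} {X : Set (ℤ × ℤ → S)} (h : DetInDir (1, 1) X)
    {x y : ℤ × ℤ → S} (hx : x ∈ X) (hy : y ∈ X)
    (hxy : ∀ m : ℤ × ℤ, m.1 + m.2 ≤ -1 → x m = y m) : x = y := by
  obtain ⟨A, hA, hdet⟩ := h
  have e : confAct A x = confAct A y := by
    refine hdet _ ⟨x, hx, rfl⟩ _ ⟨y, hy, rfl⟩ fun a b hb => hxy _ ?_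
    have h1 := congrArg Prod.snd (sl2Vec_sl2Vec_inv A (a, b))
    simp only [sl2Vec, rot90, Prod.mk.injEq] at hA
    have hd := A.2
    rw [Matrix.det_fin_two] at hd
    obtain ⟨hA1, hA2⟩ := hA
    set p := sl2Vec A⁻¹ (a, b)
    simp only [sl2Vec] at h1
    set a10 := (A : Matrix (Fin 2) (Fin 2) ℤ) 1 0
    set a11 := (A : Matrix (Fin 2) (Fin 2) ℤ) 1 1
    have h2 : a11 = a10 := by linarith
    rw [h2] at hd h1
    have h3 : a10 = -1 := by
      have : ((A : Matrix (Fin 2) (Fin 2) ℤ) 0 0 - (A : Matrix (Fin 2) (Fin 2) ℤ) 0 1) = -1 := by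
        linarith
      nlinarith
    rw [h3] at h1
    linarith
  funext m
  have := congrFun e (sl2Vec A m)
  simpa only [confAct, sl2Vec_inv_sl2Vec] using this

/-! ### Inflating tilings to blocks of unbounded size -/

/-- A symbol of the inflated configuration: block boundaries, two diagonal signals, a letter. -/
structure Raw (Q : Type) where
  cF : Bool
  rF : Bool
  s1 : SignType
  s2 : SignType
  l : Q

instance {Q : Type} [Finite Q] : Finite (Raw Q) :=
  Finite.of_injective (fun r : Raw Q => (r.cF, r.rF, r.s1, r.s2, r.l)) fun a b h => by
    cases a; cases b; simpa using h

section Raw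

variable {Q : Type} (vF vL : Q → Bool) (W : Q → Q → Q → Q → Prop)

/-- The window rule of inflated configurations. -/
structure RawOK (a b c d : Raw Q) : Prop where
  cF_l : c.cF = a.cF
  cF_r : d.cF = b.cF
  rF_b : b.rF = a.rF
  rF_t : d.rF = c.rF
  s1_cr : d.cF → d.rF → d.s1 = 0
  s1_cn : d.cF → ¬ d.rF → d.s1 = 1
  s1_nr : ¬ d.cF → d.rF → d.s1 = -1
  s1_diag : ¬ d.cF → ¬ d.rF → d.s1 = a.s1
  s1_lcr : d.cF → d.rF → a.s1 = 0
  s1_lcn : d.cF → ¬ d.rF → a.s1 = -1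
  s1_lnr : ¬ d.cF → d.rF → a.s1 = 1
  s1_pair : ¬ b.cF → (a.s1 = 1 ∧ (b.s1 = 1 ∨ b.s1 = 0)) ∨ (a.s1 ≠ 1 ∧ b.s1 = -1)
  s2_pair : ¬ b.cF → (a.s2 = -1 ∧ (b.s2 = -1 ∨ b.s2 = 0)) ∨ (a.s2 ≠ -1 ∧ b.s2 = 1)
  s2_first : d.cF → d.s2 = if vF d.l then 0 else -1
  s2_not_first : ¬ d.cF → vF d.l → d.s2 = 1
  s2_last : b.cF → a.s2 = if vL a.l then 0 else 1
  s2_not_last : ¬ b.cF → vL a.l → a.s2 = -1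
  s2_vert_l : ¬ c.rF → c.s2 = a.s2
  s2_vert_r : ¬ d.rF → d.s2 = b.s2
  s2_diag : d.rF → ¬ d.cF → d.s2 = if vL a.l then 1 else a.s2
  v_l : c.rF → vF c.l = vL a.l
  v_r : d.rF → vF d.l = vL b.l
  l_b : ¬ b.cF → b.l = a.l
  l_t : ¬ d.cF → d.l = c.l
  l_l : ¬ c.rF → c.l = a.l
  l_r : ¬ d.rF → d.l = b.l
  l_win : d.cF → d.rF → W a.l b.l c.l d.l

/-- The inflation of the tiling `t` by the factor `N`. -/
def raw (t : ℤ × ℤ → Q) (N : ℤ) : ℤ × ℤ → Raw Q := fun m =>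
  ⟨decide (m.1 % N = 0), decide (m.2 % N = 0), sgn (m.2 % N - m.1 % N),
    sgn (m.1 % N - (m.2 / N) % N), t (m.1 / N, m.2 / N)⟩

/-- Tilings whose flags `vF`, `vL` mark the first and last rows of strips of height `N`. -/
def tilings (N : ℤ) : Set (ℤ × ℤ → Q) :=
  {t | t ∈ winSet W ∧ ∀ m : ℤ × ℤ, (vF (t m) ↔ m.2 % N = 0) ∧ (vL (t m) ↔ (m.2 + 1) % N = 0)}

/-- At most one vertical and at most one horizontal line. -/
def Degen (x : ℤ × ℤ → Raw Q) : Prop :=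
  (∀ m m', (x m).cF → (x m').cF → m.1 = m'.1) ∧ ∀ m m', (x m).rF → (x m').rF → m.2 = m'.2

variable {vF vL W}

theorem RawOK.det (hW : ∀ a b c d d', W a b c d → W a b c d' → d = d') (a b c d d' : Raw Q)
    (h : RawOK vF vL W a b c d) (h' : RawOK vF vL W a b c d') : d = d' := by
  have e1 : d.cF = d'.cF := h.cF_r.trans h'.cF_r.symm
  have e2 : d.rF = d'.rF := h.rF_t.trans h'.rF_t.symm
  have e3 : d.l = d'.l := by
    by_cases hc : d.cF
    · by_cases hr : d.rF
      · exact hW _ _ _ _ _ (h.l_win hc hr) (h'.l_win (e1 ▸ hc) (e2 ▸ hr))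
      · rw [h.l_r hr, h'.l_r (e2 ▸ hr)]
    · rw [h.l_t hc, h'.l_t (e1 ▸ hc)]
  have e4 : d.s1 = d'.s1 := by
    by_cases hc : d.cF <;> by_cases hr : d.rF
    · rw [h.s1_cr hc hr, h'.s1_cr (e1 ▸ hc) (e2 ▸ hr)]
    · rw [h.s1_cn hc hr, h'.s1_cn (e1 ▸ hc) (e2 ▸ hr)]
    · rw [h.s1_nr hc hr, h'.s1_nr (e1 ▸ hc) (e2 ▸ hr)]
    · rw [h.s1_diag hc hr, h'.s1_diag (e1 ▸ hc) (e2 ▸ hr)]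
  have e5 : d.s2 = d'.s2 := by
    by_cases hr : d.rF
    · by_cases hc : d.cF
      · rw [h.s2_first hc, h'.s2_first (e1 ▸ hc), e3]
      · rw [h.s2_diag hr hc, h'.s2_diag (e2 ▸ hr) (e1 ▸ hc)]
    · rw [h.s2_vert_r hr, h'.s2_vert_r (e2 ▸ hr)]
  cases d; cases d'
  simp_all

theorem raw_mem {N : ℤ} (hN : 0 < N) {t : ℤ × ℤ → Q} (ht : t ∈ tilings vF vL W N) :
    raw t N ∈ winSet (RawOK vF vL W) := by
  rintro ⟨x, y⟩
  obtain ⟨hw, hv⟩ := ht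
  have hx0 := Int.emod_nonneg x hN.ne'
  have hy0 := Int.emod_nonneg y hN.ne'
  have hxN := Int.emod_lt_of_pos x hN
  have hyN := Int.emod_lt_of_pos y hN
  have hr0 := Int.emod_nonneg (y / N) hN.ne'
  have hrN := Int.emod_lt_of_pos (y / N) hN
  have hF : ∀ a b, vF (t (a, b)) = decide (b % N = 0) := fun a b => by
    rw [Bool.eq_iff_iff, (hv (a, b)).1, decide_eq_true_iff]
  have hL : ∀ a b, vL (t (a, b)) = decide ((b + 1) % N = 0) := fun a b => by
    rw [Bool.eq_iff_iff, (hv (a, b)).2, decide_eq_true_iff]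
  have hw' := hw (x / N, y / N)
  have hys := succ_emod hN (y / N)
  simp only [Prod.mk_add_mk, add_zero] at hw' ⊢
  rcases succ_emod hN x with ⟨h1, h2, h3⟩ | ⟨h1, h2, h3⟩ <;>
  rcases succ_emod hN y with ⟨h4, h5, h6⟩ | ⟨h4, h5, h6⟩ <;>
  constructor <;>
  simp only [raw, h2, h3, h5, h6, hF, hL, decide_eq_true_eq, sgn_eq_one, sgn_eq_zero,
    sgn_eq_neg_one, ne_eq, apply_ite (Eq (sgn _)), hw', implies_true, decide_eq_decide, not_true,
    IsEmpty.forall_iff] <;>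
  first
    | trivial
    | omega
    | (intros; split_ifs <;> first | omega | (congr 1; omega))
    | (intros; congr 1; omega)

theorem Degen.not_ple_raw {x : ℤ × ℤ → Raw Q} (hx : Degen x) {N : ℤ} (hN : 0 < N)
    (t : ℤ × ℤ → Q) : ¬ patLE2 x (raw t N) ∧ ¬ patLE2 (raw t N) x := by
  constructor
  · intro h
    obtain ⟨n, hn⟩ := h ((Finset.Icc 0 (2 * N)).image fun i => (i, 0)) 0
    have key : ∀ i, 0 ≤ i → i ≤ 2 * N → (n.1 + i) % N = 0 → (x (i, 0)).cF := by
      intro i h0 h1 h2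
      have := hn (i, 0) (Finset.mem_image_of_mem _ (Finset.mem_Icc.2 ⟨h0, h1⟩))
      rw [zero_add] at this
      rw [← this]
      simpa [raw] using h2
    have e1 := Int.emod_nonneg (-n.1) hN.ne'
    have e2 := Int.emod_lt_of_pos (-n.1) hN
    have e3 : (n.1 + (-n.1) % N) % N = 0 := by
      rw [Int.add_emod_emod]; simp
    have e4 : (n.1 + ((-n.1) % N + N)) % N = 0 := by
      rw [← add_assoc, Int.add_emod_right, e3]
    have := hx.1 _ _ (key _ e1 (by omega) e3) (key _ (by omega) (by omega) e4)
    dsimp only at this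
    omega
  · intro h
    obtain ⟨n, hn⟩ := h {(0, 0), (N, 0)} 0
    have h1 := hn (0, 0) (by simp)
    have h2 := hn (N, 0) (by simp)
    have := hx.1 (n + (0, 0)) (n + (N, 0)) (by rw [h1]; simp [raw]) (by rw [h2]; simp [raw])
    simp at this
    omega

end Raw
section RawTame

/-- A partially defined function with sign values `-1, …, -1, 0, 1, …, 1` extends to a total
function that is constant near `±∞`. -/
theorem exists_sign_extension (P : ℤ → SignType → Prop) (huniq : ∀ z v v', P z v → P z v' → v = v')
    (hmono : ∀ z v z' v', P z v → P z' v' → z < z' → v = -1 ∨ v' = 1) :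
    ∃ (B : ℕ) (G : ℤ → SignType), (∀ z w, clipZ B z = clipZ B w → G z = G w) ∧
      ∀ z v, P z v → G z = v := by
  classical
  let up : ℤ → Prop := fun z => (∃ z' ≤ z, P z' 1) ∨ ∃ z' < z, P z' 0
  let G : ℤ → SignType := fun z => if up z then 1 else if P z 0 then 0 else -1
  have hG : ∀ z v, P z v → G z = v := by
    intro z v hz
    have h1 : v ≠ 1 → ¬ up z := by
      rintro hv (⟨z', hle, h⟩ | ⟨z', hlt, h⟩)
      · rcases eq_or_lt_of_le hle with rfl | hlt
        · exact hv (huniq _ _ _ hz h)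
        · rcases hmono _ _ _ _ h hz hlt with h2 | h2
          · exact absurd h2 (by decide)
          · exact hv h2
      · rcases hmono _ _ _ _ h hz hlt with h2 | h2
        · exact absurd h2 (by decide)
        · exact hv h2
    rcases v with _ | _ | _
    · change P z 0 at hz
      simp only [G]
      rw [if_neg (h1 (by decide)), if_pos hz]; rfl
    · change P z (-1) at hz
      simp only [G]
      rw [if_neg (h1 (by decide)), if_neg (fun h => absurd (huniq _ _ _ hz h) (by decide))]; rfl
    · change P z 1 at hz
      simp only [G]
      rw [if_pos (Or.inl ⟨z, le_rfl, hz⟩)]; rfl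
  have hGm : ∀ z z', z < z' → G z = -1 ∨ G z' = 1 := by
    intro z z' hlt
    by_cases hz : up z ∨ P z 0
    · right
      have : up z' := by
        rcases hz with (⟨w, hw, h⟩ | ⟨w, hw, h⟩) | h
        · exact Or.inl ⟨w, by omega, h⟩
        · exact Or.inr ⟨w, by omega, h⟩
        · exact Or.inr ⟨z, hlt, h⟩
      simp only [G]
      rw [if_pos this]
    · left
      push Not at hz
      simp only [G]
      rw [if_neg hz.1, if_neg hz.2]
  have hK : ∃ K, ∀ z ≥ K, G z = G K := by
    by_cases h : ∃ z, G z = 1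
    · obtain ⟨K, hK⟩ := h
      refine ⟨K, fun z hz => ?_⟩
      rcases eq_or_lt_of_le hz with rfl | hlt
      · rfl
      · rcases hGm _ _ hlt with h2 | h2
        · rw [hK] at h2; exact absurd h2 (by decide)
        · rw [h2, hK]
    · push Not at h
      have : ∀ z, G z = -1 := fun z => (hGm z (z + 1) (by omega)).resolve_right (h _)
      exact ⟨0, fun z _ => by rw [this, this]⟩
  have hL : ∃ L, ∀ z ≤ L, G z = G L := by
    by_cases h : ∃ z, G z ≠ 1
    · obtain ⟨K, hK⟩ := h
      have : ∀ z < K, G z = -1 := fun z hz => (hGm _ _ hz).resolve_right hK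
      exact ⟨K - 1, fun z hz => by rw [this z (by omega), this _ (by omega)]⟩
    · push Not at h
      exact ⟨0, fun z _ => by rw [h, h]⟩
  obtain ⟨K, hK⟩ := hK
  obtain ⟨L, hL⟩ := hL
  obtain ⟨B, hB⟩ := clip_of_eventually hK hL
  exact ⟨B, G, hB, hG⟩

theorem const_on_ordConnected {α : Type*} {I : Set ℤ} (hI : I.OrdConnected) {f : ℤ → α}
    (hf : ∀ a, a ∈ I → a + 1 ∈ I → f (a + 1) = f a) {a b : ℤ} (ha : a ∈ I) (hb : b ∈ I) :
    f a = f b := by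
  have key : ∀ a ∈ I, ∀ k : ℕ, a + k ∈ I → f (a + k) = f a := by
    intro a ha k
    induction k with
    | zero => simp
    | succ k ih =>
      intro hk
      push_cast at hk ⊢
      have h1 : a + k ∈ I := hI.out ha hk ⟨by omega, by omega⟩
      rw [← ih h1, ← add_assoc]
      exact hf _ h1 (by rwa [add_assoc])
  rcases le_total a b with h | h
  · have := key a ha (b - a).toNat (by rwa [Int.toNat_of_nonneg (by omega), add_sub_cancel])
    rw [Int.toNat_of_nonneg (by omega), add_sub_cancel] at this
    exact this.symm
  · have := key b hb (a - b).toNat (by rwa [Int.toNat_of_nonneg (by omega), add_sub_cancel])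
    rwa [Int.toNat_of_nonneg (by omega), add_sub_cancel] at this

/-- Propagation of a sign signal along an interval. -/
theorem sign_propagate {I : Set ℤ} (hI : I.OrdConnected) {f : ℤ → SignType} {e : SignType}
    (he : e ≠ -e) (hf : ∀ a, a ∈ I → a + 1 ∈ I → f a ≠ e → f (a + 1) = -e) {a b : ℤ} (ha : a ∈ I)
    (hb : b ∈ I) (hab : a < b) : f a = e ∨ f b = -e := by
  by_contra! hcon
  have key : ∀ k : ℕ, a + 1 + k ∈ I → f (a + 1 + k) = -e := by
    intro k
    induction k with
    | zero => intro h; simp only [Nat.cast_zero, add_zero] at h ⊢; exact hf a ha h hcon.1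
    | succ k ih =>
      intro hk
      push_cast at hk ⊢
      have h1 : a + 1 + k ∈ I := hI.out ha hk ⟨by omega, by omega⟩
      rw [← add_assoc] at hk ⊢
      exact hf _ h1 hk (by rw [ih h1]; exact he.symm)
  have := key (b - a - 1).toNat (by rwa [Int.toNat_of_nonneg (by omega),
    show a + 1 + (b - a - 1) = b by ring])
  rw [Int.toNat_of_nonneg (by omega), show a + 1 + (b - a - 1) = b by ring] at this
  exact hcon.2 this

variable {Q : Type} {vF vL : Q → Bool} {W : Q → Q → Q → Q → Prop} {x : ℤ × ℤ → Raw Q}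

theorem raw_win (hx : x ∈ winSet (RawOK vF vL W)) (a b : ℤ) :
    RawOK vF vL W (x (a, b)) (x (a + 1, b)) (x (a, b + 1)) (x (a + 1, b + 1)) := by
  have := hx (a, b)
  simpa only [Prod.mk_add_mk, add_zero] using this

theorem raw_win' (hx : x ∈ winSet (RawOK vF vL W)) (a b : ℤ) :
    RawOK vF vL W (x (a, b - 1)) (x (a + 1, b - 1)) (x (a, b)) (x (a + 1, b)) := by
  simpa using raw_win hx a (b - 1)

theorem raw_cF (hx : x ∈ winSet (RawOK vF vL W)) (a b b' : ℤ) : (x (a, b)).cF = (x (a, b')).cF :=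
  const_of_succ (f := fun b => (x (a, b)).cF) (fun b => (raw_win hx a b).cF_l) b b'

theorem raw_rF (hx : x ∈ winSet (RawOK vF vL W)) (a a' b : ℤ) : (x (a, b)).rF = (x (a', b)).rF :=
  const_of_succ (f := fun a => (x (a, b)).rF) (fun a => (raw_win hx a b).rF_b) a a'

theorem raw_tame_quadrant (hx : x ∈ winSet (RawOK vF vL W)) {I J : Set ℤ}
    (hI' : IsUpperSet I ∨ IsLowerSet I) (hJ : J.OrdConnected)
    (hCI : ∀ a b, a ∈ I → a + 1 ∈ I → ¬ (x (a + 1, b)).cF)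
    (hRJ : ∀ a b, b ∈ J → b + 1 ∈ J → ¬ (x (a, b + 1)).rF) :
    ∃ z : ℤ × ℤ → SignType × SignType × Option Q, Tame z ∧
      ∀ a ∈ I, ∀ b ∈ J, z (a, b) = ((x (a, b)).s1, (x (a, b)).s2, some (x (a, b)).l) := by
  have hI : I.OrdConnected := hI'.elim IsUpperSet.ordConnected IsLowerSet.ordConnected
  by_cases hne : ∃ a ∈ I, ∃ b ∈ J, True
  swap
  · exact ⟨_, Tame.const (0, 0, none), fun a ha b hb => absurd ⟨a, ha, b, hb, trivial⟩ hne⟩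
  obtain ⟨a0, ha0, b0, hb0, -⟩ := hne
  have hl : ∀ a ∈ I, ∀ b ∈ J, (x (a, b)).l = (x (a0, b0)).l := by
    intro a ha b hb
    have h1 := const_on_ordConnected hI (f := fun a => (x (a, b)).l)
      (fun a h h' => (raw_win hx a b).l_b (hCI a b h h')) ha ha0
    have h2 := const_on_ordConnected hJ (f := fun b => (x (a0, b)).l)
      (fun b h h' => (raw_win hx a0 b).l_l (hRJ a0 b h h')) hb hb0
    exact h1.trans h2
  have hs2 : ∀ a ∈ I, ∀ b ∈ J, (x (a, b)).s2 = (x (a, b0)).s2 := by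
    intro a ha b hb
    exact const_on_ordConnected hJ (f := fun b => (x (a, b)).s2)
      (fun b h h' => (raw_win hx a b).s2_vert_l (hRJ a b h h')) hb hb0
  have hs1 : ∀ a b k : ℤ, a ∈ I → b ∈ J → a + k ∈ I → b + k ∈ J →
      (x (a + k, b + k)).s1 = (x (a, b)).s1 := by
    intro a b k h1 h2 h3 h4
    have h5 : ({k | a + k ∈ I ∧ b + k ∈ J} : Set ℤ).OrdConnected := by
      constructor
      rintro k ⟨h1, h2⟩ k' ⟨h3, h4⟩ i ⟨h5, h6⟩
      exact ⟨hI.out h1 h3 ⟨by omega, by omega⟩, hJ.out h2 h4 ⟨by omega, by omega⟩⟩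
    have := const_on_ordConnected h5 (f := fun k => (x (a + k, b + k)).s1) (a := k) (b := 0)
      (fun i h h' => by
        have e := raw_win hx (a + i) (b + i)
        simp only [← add_assoc]
        exact e.s1_diag (hCI _ _ h.1 (by rw [add_assoc]; exact h'.1))
          (hRJ _ _ h.2 (by rw [add_assoc]; exact h'.2))) ⟨h3, h4⟩ ⟨by simpa, by simpa⟩
    simpa using this
  have hcommon : ∀ a ∈ I, ∀ a' ∈ I, ∀ b ∈ J, ∀ b' ∈ J, ∃ r ∈ J, a + (r - b) ∈ I ∧ a' + (r - b') ∈ I := by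
    intro a ha a' ha' b hb b' hb'
    rcases hI' with h | h
    · rcases le_total b b' with h2 | h2
      · exact ⟨b', hb', h (by omega) ha, by simpa⟩
      · exact ⟨b, hb, by simpa, h (by omega) ha'⟩
    · rcases le_total b b' with h2 | h2
      · exact ⟨b, hb, by simpa, h (by omega) ha'⟩
      · exact ⟨b', hb', h (by omega) ha, by simpa⟩
  obtain ⟨B1, G1, hB1, hG1⟩ := exists_sign_extension
    (fun d v => ∃ a ∈ I, ∃ b ∈ J, b - a = d ∧ (x (a, b)).s1 = v)
    (by
      rintro _ _ _ ⟨a, ha, b, hb, rfl, rfl⟩ ⟨a', ha', b', hb', h, rfl⟩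
      have := hs1 a b (a' - a) ha hb (by rwa [add_sub_cancel])
        (by rwa [show b + (a' - a) = b' by omega])
      rw [← this, add_sub_cancel, show b + (a' - a) = b' by omega])
    (by
      rintro _ _ _ _ ⟨a, ha, b, hb, rfl, rfl⟩ ⟨a', ha', b', hb', rfl, rfl⟩ hlt
      obtain ⟨r, hr, h1, h2⟩ := hcommon a ha a' ha' b hb b' hb'
      have e1 := hs1 a b (r - b) ha hb h1 (by rwa [add_sub_cancel])
      have e2 := hs1 a' b' (r - b') ha' hb' h2 (by rwa [add_sub_cancel])
      rw [← e1, ← e2, add_sub_cancel, add_sub_cancel]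
      exact (sign_propagate hI (f := fun a => (x (a, r)).s1) (e := 1) (by decide)
        (fun a h h' hne => by
          rcases (raw_win hx a r).s1_pair (hCI a r h h') with h3 | h3
          · exact absurd h3.1 hne
          · exact h3.2) h2 h1 (by omega)).symm)
  obtain ⟨B2, G2, hB2, hG2⟩ := exists_sign_extension
    (fun a v => a ∈ I ∧ (x (a, b0)).s2 = v)
    (by rintro _ _ _ ⟨_, rfl⟩ ⟨_, rfl⟩; rfl)
    (by
      rintro a _ a' _ ⟨ha, rfl⟩ ⟨ha', rfl⟩ hlt
      exact sign_propagate hI (f := fun a => (x (a, b0)).s2) (e := -1) (by decide)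
        (fun a h h' hne => by
          rcases (raw_win hx a b0).s2_pair (hCI a b0 h h') with h3 | h3
          · exact absurd h3.1 hne
          · exact h3.2) ha ha' hlt)
  refine ⟨_, (Tame.of_form 2 B1 G1 hB1).comp₂ (Tame.of_form 0 B2 G2 hB2)
    fun u v => (u, v, some (x (a0, b0)).l), fun a ha b hb => ?_⟩
  simp only [lform, Prod.mk.injEq, Option.some.injEq]
  refine ⟨hG1 _ _ ⟨a, ha, b, hb, rfl, rfl⟩, hG2 _ _ ⟨ha, (hs2 a ha b hb).symm⟩, (hl a ha b hb).symm⟩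

theorem tame_lt (k : Fin 3) (c : ℤ) : Tame fun m => lform k m < c := by
  obtain ⟨B, hB⟩ := clip_of_eventually (h := fun z => z < c) (K := c) (L := c - 1)
    (fun z hz => by simp; omega) (fun z hz => by simp; omega)
  exact Tame.of_form k B _ hB

theorem tame_eq (k : Fin 3) (c : ℤ) : Tame fun m => lform k m = c := by
  refine ((tame_lt k c).comp₂ (tame_lt k (c + 1)) fun p q => ¬ p ∧ q).comp id |> fun h => ?_
  convert h using 2
  simp; omega

theorem Degen.tame (hd : Degen x) (hx : x ∈ winSet (RawOK vF vL W)) : Tame x := by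
  classical
  have hC : ∃ x0, ∀ m, (x m).cF → m.1 = x0 := by
    by_cases h : ∃ m, (x m).cF
    · exact ⟨h.choose.1, fun m hm => hd.1 _ _ hm h.choose_spec⟩
    · exact ⟨0, fun m hm => absurd ⟨m, hm⟩ h⟩
  have hR : ∃ y0, ∀ m, (x m).rF → m.2 = y0 := by
    by_cases h : ∃ m, (x m).rF
    · exact ⟨h.choose.2, fun m hm => hd.2 _ _ hm h.choose_spec⟩
    · exact ⟨0, fun m hm => absurd ⟨m, hm⟩ h⟩
  obtain ⟨x0, hC⟩ := hC
  obtain ⟨y0, hR⟩ := hR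
  have q1 := raw_tame_quadrant hx (I := Set.Iio x0) (J := Set.Iio y0) (Or.inr (isLowerSet_Iio _))
    Set.ordConnected_Iio (fun a b _ h h' => by have := hC _ h'; simp at this h; omega)
    (fun a b _ h h' => by have := hR _ h'; simp at this h; omega)
  have q2 := raw_tame_quadrant hx (I := Set.Iio x0) (J := Set.Ici y0) (Or.inr (isLowerSet_Iio _))
    Set.ordConnected_Ici (fun a b _ h h' => by have := hC _ h'; simp at this h; omega)
    (fun a b h _ h' => by have := hR _ h'; simp at this h; omega)
  have q3 := raw_tame_quadrant hx (I := Set.Ici x0) (J := Set.Iio y0) (Or.inl (isUpperSet_Ici _))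
    Set.ordConnected_Iio (fun a b h _ h' => by have := hC _ h'; simp at this h; omega)
    (fun a b _ h h' => by have := hR _ h'; simp at this h; omega)
  have q4 := raw_tame_quadrant hx (I := Set.Ici x0) (J := Set.Ici y0) (Or.inl (isUpperSet_Ici _))
    Set.ordConnected_Ici (fun a b h _ h' => by have := hC _ h'; simp at this h; omega)
    (fun a b h _ h' => by have := hR _ h'; simp at this h; omega)
  obtain ⟨z1, t1, h1⟩ := q1
  obtain ⟨z2, t2, h2⟩ := q2
  obtain ⟨z3, t3, h3⟩ := q3
  obtain ⟨z4, t4, h4⟩ := q4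
  have tz := Tame.ite (tame_lt 0 x0) (Tame.ite (tame_lt 1 y0) t1 t2) (Tame.ite (tame_lt 1 y0) t3 t4)
  have tc := (tame_eq 0 x0).comp fun p => decide (p ∧ (x (x0, 0)).cF)
  have tr := (tame_eq 1 y0).comp fun p => decide (p ∧ (x (0, y0)).rF)
  have := (tc.comp₂ tr Prod.mk).comp₂ tz fun (p : Bool × Bool)
    (q : SignType × SignType × Option Q) =>
      (⟨p.1, p.2, q.1, q.2.1, q.2.2.getD (x (0, 0)).l⟩ : Raw Q)
  convert this using 1
  funext ⟨a, b⟩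
  have e1 : (x (a, b)).cF = decide (a = x0 ∧ (x (x0, 0)).cF) := by
    rw [Bool.eq_iff_iff, decide_eq_true_iff]
    constructor
    · intro h
      have := hC _ h
      dsimp only at this
      subst this
      exact ⟨rfl, by rwa [raw_cF hx a 0 b]⟩
    · rintro ⟨rfl, h⟩
      rwa [raw_cF hx a b 0]
  have e2 : (x (a, b)).rF = decide (b = y0 ∧ (x (0, y0)).rF) := by
    rw [Bool.eq_iff_iff, decide_eq_true_iff]
    constructor
    · intro h
      have := hR _ h
      dsimp only at this
      subst this
      exact ⟨rfl, by rwa [raw_rF hx 0 a b]⟩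
    · rintro ⟨rfl, h⟩
      rwa [raw_rF hx a 0 b]
  have key : ∀ (r : Raw Q) (c d : Bool), r.cF = c → r.rF = d → r = ⟨c, d, r.s1, r.s2, r.l⟩ := by
    rintro ⟨⟩ _ _ rfl rfl; rfl
  have ha' : lform 0 (a, b) = a := rfl
  have hb' : lform 1 (a, b) = b := rfl
  have key' := key (x (a, b)) _ _ e1 e2
  by_cases ha : a < x0 <;> by_cases hb : b < y0 <;>
    simp only [ha', hb', ha, hb, if_true, if_false]
  · rw [h1 a ha b hb]; simp only [Option.getD_some]; convert key'
  · rw [h2 a ha b (not_lt.1 hb)]; simp only [Option.getD_some]; convert key'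
  · rw [h3 a (not_lt.1 ha) b hb]; simp only [Option.getD_some]; convert key'
  · rw [h4 a (not_lt.1 ha) b (not_lt.1 hb)]; simp only [Option.getD_some]; convert key'

end RawTame
/-! ### Every nondegenerate configuration is an inflation -/

theorem const_on_block {α : Type*} {N : ℤ} (hN : 0 < N) {f : ℤ → α}
    (h : ∀ x, (x + 1) % N ≠ 0 → f (x + 1) = f x) (x : ℤ) : f x = f (N * (x / N)) := by
  have key : ∀ k : ℕ, ∀ x, x % N = k → f x = f (N * (x / N)) := by
    intro k
    induction k with
    | zero =>
      intro x hx
      have := Int.mul_ediv_add_emod x N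
      congr 1
      push_cast at hx
      omega
    | succ k ih =>
      intro x hx
      obtain ⟨y, rfl⟩ : ∃ y, x = y + 1 := ⟨x - 1, by ring⟩
      push_cast at hx
      rcases succ_emod hN y with ⟨h1, h2, h3⟩ | ⟨h1, h2, h3⟩
      · omega
      · rw [h y (by omega), h3, ih y (by omega)]
  exact key (x % N).toNat x (Int.toNat_of_nonneg (Int.emod_nonneg x hN.ne')).symm

theorem exists_profile {N : ℤ} (hN : 0 < N) {h : ℤ → SignType} {F L : Prop}
    (hp : ∀ j, 0 ≤ j → j + 1 < N →
      (h j = -1 ∧ (h (j + 1) = -1 ∨ h (j + 1) = 0)) ∨ (h j ≠ -1 ∧ h (j + 1) = 1))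
    (hF : F → h 0 = 0) (hF' : ¬ F → h 0 = -1) (hL : L → h (N - 1) = 0)
    (hL' : ¬ L → h (N - 1) = 1) :
    ∃ r, 0 ≤ r ∧ r < N ∧ (F ↔ r = 0) ∧ (L ↔ r = N - 1) ∧
      ∀ j, 0 ≤ j → j < N → h j = sgn (j - r) := by
  classical
  have hlast : h ((N - 1).toNat : ℤ) ≠ -1 := by
    rw [Int.toNat_of_nonneg (by omega)]
    by_cases hl : L
    · rw [hL hl]; decide
    · rw [hL' hl]; decide
  have hex : ∃ k : ℕ, h k ≠ -1 := ⟨_, hlast⟩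
  obtain ⟨k, hk, hmin⟩ : ∃ k : ℕ, h k ≠ -1 ∧ ∀ j < k, h j = -1 :=
    ⟨Nat.find hex, Nat.find_spec hex, fun j hj => not_not.1 (Nat.find_min hex hj)⟩
  have hkN : (k : ℤ) < N := by
    by_contra hcon
    exact hlast (hmin _ (by omega))
  have hk0 : h k = 0 := by
    cases k with
    | zero =>
      by_cases hf : F
      · exact hF hf
      · exact absurd (hF' hf) hk
    | succ k =>
      push_cast at hk hkN ⊢
      rcases hp k (by omega) hkN with ⟨-, h1 | h1⟩ | ⟨h1, -⟩
      · exact absurd h1 hk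
      · exact h1
      · exact absurd (hmin k (by omega)) h1
  have hafter : ∀ i : ℕ, (k : ℤ) + 1 + i < N → h (k + 1 + i) = 1 := by
    intro i
    induction i with
    | zero =>
      intro hi
      simp only [Nat.cast_zero, add_zero] at hi ⊢
      rcases hp k (by omega) hi with ⟨h1, -⟩ | ⟨-, h1⟩
      · exact absurd h1 hk
      · exact h1
    | succ i ih =>
      intro hi
      push_cast at hi ⊢
      rw [← add_assoc] at hi ⊢
      rcases hp (k + 1 + i) (by omega) hi with ⟨h1, -⟩ | ⟨-, h1⟩
      · rw [ih (by omega)] at h1; exact absurd h1 (by decide)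
      · exact h1
  have hall : ∀ j, 0 ≤ j → j < N → h j = sgn (j - k) := by
    intro j h0 h1
    lift j to ℕ using h0
    rcases lt_trichotomy j k with hj | rfl | hj
    · rw [hmin j hj, eq_comm, sgn_eq_neg_one]; omega
    · rw [hk0, eq_comm, sgn_eq_zero]; omega
    · have := hafter (j - k - 1) (by omega)
      rw [show (k : ℤ) + 1 + (j - k - 1 : ℕ) = j by omega] at this
      rw [this, eq_comm, sgn_eq_one]; omega
  refine ⟨k, by omega, hkN, ?_, ?_, hall⟩
  · have h0 := hall 0 le_rfl hN
    constructor
    · intro hf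
      rw [hF hf, eq_comm, sgn_eq_zero] at h0
      omega
    · intro hk
      by_contra hf
      rw [hF' hf, eq_comm, sgn_eq_neg_one] at h0
      omega
  · have h0 := hall (N - 1) (by omega) (by omega)
    constructor
    · intro hf
      rw [hL hf, eq_comm, sgn_eq_zero] at h0
      omega
    · intro hk
      by_contra hf
      rw [hL' hf, eq_comm, sgn_eq_one] at h0
      omega

section Decode

variable {Q : Type} {vF vL : Q → Bool} {W : Q → Q → Q → Q → Prop} {x : ℤ × ℤ → Raw Q}

theorem raw_decode_aligned (hW : ∀ a b c d, W a b c d → vF c = vF d) {N : ℤ} (hN : 0 < N)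
    (hx : x ∈ winSet (RawOK vF vL W)) (hc : ∀ a b, (x (a, b)).cF ↔ a % N = 0)
    (hr : ∀ a b, (x (a, b)).rF ↔ b % N = 0)
    (hs1 : ∀ a b, (x (a, b)).s1 = sgn (b % N - a % N)) :
    ∃ n, ∃ t ∈ tilings vF vL W N, x = shift2 n (raw t N) := by
  set T : ℤ → ℤ → Q := fun u w => (x (N * u, N * w)).l with hT
  have hl : ∀ a b, (x (a, b)).l = T (a / N) (b / N) := by
    intro a b
    have h1 := const_on_block hN (f := fun a => (x (a, b)).l)
      (fun a h => (raw_win hx a b).l_b (by rwa [hc])) a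
    have h2 := const_on_block hN (f := fun b => (x (N * (a / N), b)).l)
      (fun b h => (raw_win hx _ b).l_l (by rwa [hr])) b
    exact h1.trans h2
  have hs2 : ∀ a b, (x (a, b)).s2 = (x (a, N * (b / N))).s2 := fun a b =>
    const_on_block hN (f := fun b => (x (a, b)).s2)
      (fun b h => (raw_win hx _ b).s2_vert_l (by rwa [hr])) b
  have hdiv : ∀ u j, 0 ≤ j → j < N → (N * u + j) / N = u ∧ (N * u + j) % N = j := by
    intro u j h0 h1
    rw [add_comm, Int.add_mul_ediv_left _ _ hN.ne', Int.add_mul_emod_self_left,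
      Int.ediv_eq_zero_of_lt h0 h1, Int.emod_eq_of_lt h0 h1, zero_add]
    exact ⟨rfl, rfl⟩
  have hprof : ∀ u w, ∃ r, 0 ≤ r ∧ r < N ∧ (vF (T u w) ↔ r = 0) ∧ (vL (T u w) ↔ r = N - 1) ∧
      ∀ j, 0 ≤ j → j < N → (x (N * u + j, N * w)).s2 = sgn (j - r) := by
    intro u w
    have hd0 := hdiv u 0 le_rfl hN
    have hd1 := hdiv u (N - 1) (by omega) (by omega)
    have hw0 := hdiv w 0 le_rfl hN
    rw [add_zero] at hw0
    have e0 : (x (N * u + 0, N * w)).s2 = if vF (T u w) then 0 else -1 := by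
      have := (raw_win' hx (N * u + 0 - 1) (N * w)).s2_first (by
        rw [hc, sub_add_cancel]; exact hd0.2)
      rwa [sub_add_cancel, hl, hd0.1, hw0.1] at this
    have e1 : (x (N * u + (N - 1), N * w)).s2 = if vL (T u w) then 0 else 1 := by
      have := (raw_win hx (N * u + (N - 1)) (N * w)).s2_last (by
        rw [hc, show N * u + (N - 1) + 1 = N * (u + 1) by ring]; simp)
      rwa [hl, hd1.1, hw0.1] at this
    refine exists_profile hN (h := fun j => (x (N * u + j, N * w)).s2) ?_
      (fun h => by simpa [h] using e0) (fun h => by simpa [h] using e0)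
      (fun h => by simpa [h] using e1) (fun h => by simpa [h] using e1)
    intro j h0 h1
    have := (raw_win hx (N * u + j) (N * w)).s2_pair (by
      rw [hc, add_assoc, (hdiv u (j + 1) (by omega) h1).2]; omega)
    simpa only [add_assoc] using this
  choose r r0 rN rF rL rs using hprof
  have ht : (fun m : ℤ × ℤ => T m.1 m.2) ∈ winSet W := by
    rintro ⟨u, w⟩
    have h1 := hdiv u (N - 1) (by omega) (by omega)
    have h2 := hdiv w (N - 1) (by omega) (by omega)
    have h3 := hdiv (u + 1) 0 le_rfl hN
    have h4 := hdiv (w + 1) 0 le_rfl hN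
    have e1 : N * u + (N - 1) + 1 = N * (u + 1) + 0 := by ring
    have e2 : N * w + (N - 1) + 1 = N * (w + 1) + 0 := by ring
    have := (raw_win hx (N * u + (N - 1)) (N * w + (N - 1))).l_win
      (by rw [hc, e1, h3.2]) (by rw [hr, e2, h4.2])
    simp only [hl, e1, e2, h1.1, h2.1, h3.1, h4.1] at this
    simpa only [Prod.mk_add_mk, add_zero] using this
  have hup : ∀ u w, r u (w + 1) = (r u w + 1) % N := by
    intro u w
    have hw := hdiv w (N - 1) (by omega) (by omega)
    have hw1 := hdiv (w + 1) 0 le_rfl hN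
    have e2 : N * w + (N - 1) + 1 = N * (w + 1) + 0 := by ring
    have hd0 := hdiv u 0 le_rfl hN
    have hv : vF (T u (w + 1)) = vL (T u w) := by
      have := (raw_win hx (N * u + 0) (N * w + (N - 1))).v_l (by rw [hr, e2, hw1.2])
      rwa [hl, hl, e2, hd0.1, hw.1, hw1.1] at this
    by_cases hL : vL (T u w)
    · rw [(rF _ _).1 (hv.trans hL), (rL _ _).1 hL, sub_add_cancel, Int.emod_self]
    · have h1 : r u w + 1 < N := by
        have := mt (rL u w).2 hL
        have := rN u w
        omega
      have h2 := hdiv u (r u w + 1) (by have := r0 u w; omega) h1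
      have h3 := hdiv u (r u w) (r0 u w) (rN u w)
      have := (raw_win hx (N * u + r u w) (N * w + (N - 1))).s2_diag (by rw [hr, e2, hw1.2])
        (by rw [hc, add_assoc, h2.2]; have := r0 u w; omega)
      rw [hl, h3.1, hw.1, if_neg hL, add_assoc, e2, add_zero,
        rs u (w + 1) _ (by have := r0 u w; omega) h1, hs2 _ (N * w + (N - 1)), hw.1,
        rs u w _ (r0 u w) (rN u w), sgn_eq_zero.2 (sub_self (r u w)), sgn_eq_zero] at this
      rw [Int.emod_eq_of_lt (by have := r0 u w; omega) h1]
      omega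
  have hlin : ∀ u w, r u w = (r u 0 + w) % N := by
    intro u w
    have := const_of_succ (f := fun w => (r u w - w) % N) (fun w => by
      rw [hup, Int.emod_sub_emod]
      congr 1; ring) w 0
    simp only [sub_zero, Int.emod_eq_of_lt (r0 u 0) (rN u 0)] at this
    rw [← this, Int.emod_add_emod, sub_add_cancel, Int.emod_eq_of_lt (r0 u w) (rN u w)]
  have hcol : ∀ u, r u 0 = r 0 0 := by
    intro u
    refine const_of_succ (f := fun u => r u 0) (fun u => ?_) u 0
    have hz : r u (-r u 0) = 0 := by rw [hlin]; simp
    have hv := hW _ _ _ _ (ht (u, -r u 0 - 1))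
    simp only [Prod.mk_add_mk, add_zero, sub_add_cancel] at hv
    have hz' : r (u + 1) (-r u 0) = 0 := (rF _ _).1 (hv ▸ (rF _ _).2 hz)
    rw [hlin] at hz'
    have h1 := r0 u 0
    have h2 := rN u 0
    have h3 := r0 (u + 1) 0
    have h4 := rN (u + 1) 0
    have := Int.eq_zero_of_abs_lt_dvd (Int.dvd_of_emod_eq_zero hz') (by rw [abs_lt]; omega)
    omega
  set c := r 0 0 with hc0
  have hrc : ∀ u w, r u w = (c + w) % N := fun u w => by rw [hlin, hcol]
  refine ⟨(0, N * c), fun m => T m.1 (m.2 - c), ⟨?_, ?_⟩, ?_⟩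
  · intro m
    have := ht (m + (0, -c))
    simpa [Prod.fst_add, Prod.snd_add, sub_eq_add_neg, add_right_comm] using this
  · rintro ⟨u, w⟩
    dsimp only
    refine ⟨by rw [rF, hrc]; simp, ?_⟩
    rw [rL, hrc, add_sub_cancel]
    rcases succ_emod hN w with ⟨h1, h2, -⟩ | ⟨h1, h2, -⟩
    · simp [h1, h2]
    · have := Int.emod_nonneg w hN.ne'
      omega
  · have hraw : ∀ (q : Raw Q) (c1 c2 : Bool) s s' l, (q.cF ↔ c1) → (q.rF ↔ c2) → q.s1 = s →
        q.s2 = s' → q.l = l → q = ⟨c1, c2, s, s', l⟩ := by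
      rintro ⟨a, b, _, _, _⟩ c1 c2 s s' l h1 h2 rfl rfl rfl
      rw [← Bool.eq_iff_iff] at h1 h2
      simp only at h1 h2
      rw [h1, h2]
    funext ⟨a, b⟩
    simp only [shift2, raw, Prod.mk_add_mk, zero_add]
    have e1 : (N * c + b) / N = c + b / N := by
      rw [Int.add_ediv_of_dvd_left (Dvd.intro _ rfl), Int.mul_ediv_cancel_left _ hN.ne']
    have e2 : (N * c + b) % N = b % N := by simp
    have ea : N * (a / N) + a % N = a := Int.mul_ediv_add_emod a N
    refine hraw _ _ _ _ _ _ ?_ ?_ ?_ ?_ ?_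
    · rw [hc, decide_eq_true_iff]
    · rw [hr, decide_eq_true_iff, e2]
    · rw [hs1, e2]
    · have := rs (a / N) (b / N) (a % N) (Int.emod_nonneg _ hN.ne') (Int.emod_lt_of_pos _ hN)
      rw [ea, ← hs2, hrc] at this
      rw [this, e1]
    · rw [hl, e1, add_sub_cancel_left]

theorem raw_decode (hW : ∀ a b c d, W a b c d → vF c = vF d)
    (hx : x ∈ winSet (RawOK vF vL W)) (hd : ¬ Degen x) :
    ∃ N : ℤ, 0 < N ∧ ∃ n, ∃ t ∈ tilings vF vL W N, x = shift2 n (raw t N) := by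
  have hgrid : ∀ y ∈ winSet (RawOK vF vL W), DiagGrid (fun a => (y (a, 0)).cF)
      (fun b => (y (0, b)).rF) (fun a b => (y (a, b)).s1) := by
    intro y hy
    have hC : ∀ a b, (y (a, 0)).cF = (y (a, b)).cF := fun a b => raw_cF hy a 0 b
    have hR : ∀ a b, (y (0, b)).rF = (y (a, b)).rF := fun a b => raw_rF hy 0 a b
    constructor
    · intro a b h1 h2
      rw [hC a b] at h1; rw [hR a b] at h2
      simpa using (raw_win' hy (a - 1) b).s1_cr (by simpa using h1) (by simpa using h2)
    · intro a b h1 h2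
      rw [hC a b] at h1; rw [hR a b] at h2
      simpa using (raw_win' hy (a - 1) b).s1_cn (by simpa using h1) (by simpa using h2)
    · intro a b h1 h2
      rw [hC a b] at h1; rw [hR a b] at h2
      simpa using (raw_win' hy (a - 1) b).s1_nr (by simpa using h1) (by simpa using h2)
    · intro a b h1 h2
      rw [hC _ (b + 1)] at h1; rw [hR (a + 1)] at h2
      exact (raw_win hy a b).s1_diag h1 h2
    · intro a b h1 h2
      rw [hC _ (b + 1)] at h1; rw [hR (a + 1)] at h2
      exact (raw_win hy a b).s1_lcr h1 h2
    · intro a b h1 h2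
      rw [hC _ (b + 1)] at h1; rw [hR (a + 1)] at h2
      exact (raw_win hy a b).s1_lcn h1 h2
    · intro a b h1 h2
      rw [hC _ (b + 1)] at h1; rw [hR (a + 1)] at h2
      exact (raw_win hy a b).s1_lnr h1 h2
  have h2 : (∃ a a', a ≠ a' ∧ (x (a, 0)).cF ∧ (x (a', 0)).cF) ∨
      ∃ b b', b ≠ b' ∧ (x (0, b)).rF ∧ (x (0, b')).rF := by
    by_contra! hcon
    refine hd ⟨?_, ?_⟩
    · rintro ⟨a, b⟩ ⟨a', b'⟩ h h'
      by_contra hne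
      rw [raw_cF hx a b 0] at h
      rw [raw_cF hx a' b' 0] at h'
      exact hcon.1 a a' hne h h'
    · rintro ⟨a, b⟩ ⟨a', b'⟩ h h'
      by_contra hne
      rw [raw_rF hx a 0 b] at h
      rw [raw_rF hx a' 0 b'] at h'
      exact hcon.2 b b' hne h h'
  obtain ⟨N, x0, y0, hN, hc, hr⟩ := (hgrid x hx).rigid h2
  have hy : shift2 (x0, y0) x ∈ winSet (RawOK vF vL W) := winSet_shift hx _
  have hc' : ∀ a b, (shift2 (x0, y0) x (a, b)).cF ↔ N ∣ a := by
    intro a b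
    have := hc (x0 + a)
    rw [raw_cF hx _ 0 (y0 + b), add_sub_cancel_left] at this
    exact this
  have hr' : ∀ a b, (shift2 (x0, y0) x (a, b)).rF ↔ N ∣ b := by
    intro a b
    have := hr (y0 + b)
    rw [raw_rF hx 0 (x0 + a), add_sub_cancel_left] at this
    exact this
  have hg := hgrid _ hy
  simp only [hc', hr'] at hg
  have hs := hg.sign_eq hN
  obtain ⟨n, t, ht, he⟩ := raw_decode_aligned hW hN hy
    (fun a b => (hc' a b).trans Int.dvd_iff_emod_eq_zero)
    (fun a b => (hr' a b).trans Int.dvd_iff_emod_eq_zero) hs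
  refine ⟨N, hN, n + -(x0, y0), t, ht, ?_⟩
  rw [← shift2_shift2, ← he, shift2_shift2, add_neg_cancel, shift2_zero]

end Decode
/-! ### Counter machines in square supercells -/

/-- Increment, decrement or do nothing. -/
def opApply (o : SignType) (n : ℕ) : ℕ := if o = 1 then n + 1 else if o = -1 then n - 1 else n

/-- A counter machine with states `St` and counters `κ`. -/
structure Mach (St κ : Type) where
  trans : St → (κ → Bool) → St × (κ → SignType)
  s0 : St
  acc : St → Bool
  inp : κ → Fin 5
  out : κ

namespace Mach

variable {St κ : Type} (M : Mach St κ)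

/-- The effect of the state and of the zero tests of a configuration. -/
def next (c : St × (κ → ℕ)) : St × (κ → SignType) := M.trans c.1 fun k => decide (0 < c.2 k)

/-- One step of the machine. -/
def step (c : St × (κ → ℕ)) : St × (κ → ℕ) :=
  ((M.next c).1, fun k => opApply ((M.next c).2 k) (c.2 k))

/-- The configuration at time `v` on the input `(i, p, q, α)`. -/
def run (i p q α : ℕ) : ℕ → St × (κ → ℕ)
  | 0 => (M.s0, fun k => ![i, p, q, α, 0] (M.inp k))
  | v + 1 => M.step (run i p q α v)

/-- The counter operations leading to time `v`. -/
def opAt (i p q α : ℕ) : ℕ → κ → SignType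
  | 0 => fun _ => 0
  | v + 1 => (M.next (M.run i p q α v)).2

end Mach

/-- The letters of the computation layer. -/
structure Letter (St κ : Type) where
  jF : Bool
  jL : Bool
  vF : Bool
  vL : Bool
  s : SignType
  idx : Bool
  p : Bool
  q : Bool
  al : Bool
  ei : Bool
  ep : Bool
  st : St
  op : κ → SignType
  c : κ → Bool
  pc : κ → Bool

instance {St κ : Type} [Finite St] [Finite κ] : Finite (Letter St κ) :=
  Finite.of_injective (fun r : Letter St κ => ((r.jF, r.jL, r.vF, r.vL, r.s, r.idx, r.p),
    (r.q, r.al, r.ei, r.ep, r.st), r.op, r.c, r.pc)) fun a b h => by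
    cases a; cases b; simpa [and_assoc] using h

section Rules

variable {St κ : Type} (M : Mach St κ) (δ : Bool)

/-- The window rule of the computation layer, in sheared coordinates: `a` is below `d`, `b` is
to the right of `a`, and `c` is to the left of `d`. -/
structure LetterOK (a b c d : Letter St κ) : Prop where
  jF_l : d.jF = c.jL
  jF_v : d.jF = a.jF
  jL_v : d.jL = a.jL
  vF_h : c.vF = d.vF
  vL_h : c.vL = d.vL
  s_h : ¬ d.jF → (c.s = 1 ∧ (d.s = 1 ∨ d.s = 0)) ∨ (c.s ≠ 1 ∧ d.s = -1)
  s_v : ¬ d.vF → (a.s = -1 ∧ (d.s = -1 ∨ d.s = 0)) ∨ (a.s ≠ -1 ∧ d.s = 1)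
  s_first : d.jF → d.s = if d.vF then 0 else 1
  s_first' : ¬ d.jF → d.vF → d.s = -1
  s_last : d.jL → d.s = if d.vL then 0 else -1
  s_last' : ¬ d.jL → d.vL → d.s = 1
  idx_v : d.idx = a.idx
  idx_m : ¬ d.jF → d.idx → c.idx
  p_f : d.vF → d.p = a.c M.out
  p_v : ¬ d.vF → d.p = a.p
  al_f : d.vF → δ → d.al = false
  al_v : ¬ d.vF → d.al = a.al
  al_m : ¬ d.jF → d.al → c.al
  ei_d : d.s = 0 → d.ei = d.idx ∧ c.ei = d.idx
  ei_h : d.s ≠ 0 → d.ei = c.ei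
  ep_d : d.s = 0 → d.ep = d.p
  ep_h : d.s ≠ 0 → d.ep = c.ep
  q_d : d.s = 0 → d.q = c.ep
  q_v : d.s = 1 → d.q = a.q
  q_n : d.s = -1 → d.q = false
  f_st : d.vF → d.st = M.s0
  f_op : d.vF → d.op = fun _ => 0
  f_c : d.vF → d.c = fun k => ![d.idx, d.p, a.q, d.al, false] (M.inp k)
  f_pc : d.vF → d.pc = fun _ => false
  n_st : ¬ d.vF → (d.st, d.op) = if d.jF then M.trans a.st a.c else (c.st, c.op)
  n_pc : ¬ d.vF → d.pc = a.c
  n_c : ¬ d.vF → ∀ k, d.c k = if d.op k = 1 then (if d.jF then true else c.pc k) else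
    if d.op k = -1 then (if d.jL then false else b.c k) else a.c k
  c_m : ¬ d.jF → ∀ k, d.c k → c.c k
  ovf : ¬ d.vF → d.jL → ∀ k, d.op k = 1 → ¬ a.c k
  fin : d.jF → d.vL → M.acc d.st ∧ d.c M.out

variable {M δ}

theorem LetterOK.det (hδ : δ = true) {a b c d d' : Letter St κ} (h : LetterOK M δ a b c d)
    (h' : LetterOK M δ a b c d') : d = d' := by
  have ejF : d.jF = d'.jF := h.jF_v.trans h'.jF_v.symm
  have ejL : d.jL = d'.jL := h.jL_v.trans h'.jL_v.symm
  have evF : d.vF = d'.vF := h.vF_h.symm.trans h'.vF_h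
  have evL : d.vL = d'.vL := h.vL_h.symm.trans h'.vL_h
  have es : d.s = d'.s := by
    by_cases hj : d.jF
    · rw [h.s_first hj, h'.s_first (ejF ▸ hj), evF]
    · by_cases hv : d.vF
      · rw [h.s_first' hj hv, h'.s_first' (ejF ▸ hj) (evF ▸ hv)]
      · have h1 := h.s_h hj
        have h2 := h'.s_h (ejF ▸ hj)
        have h3 := h.s_v hv
        have h4 := h'.s_v (evF ▸ hv)
        revert h1 h2 h3 h4
        generalize d.s = x
        generalize d'.s = y
        generalize a.s = z
        generalize c.s = w
        revert x y z w
        decide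
  have eidx : d.idx = d'.idx := h.idx_v.trans h'.idx_v.symm
  have ep : d.p = d'.p := by
    by_cases hv : d.vF
    · rw [h.p_f hv, h'.p_f (evF ▸ hv)]
    · rw [h.p_v hv, h'.p_v (evF ▸ hv)]
  have eal : d.al = d'.al := by
    by_cases hv : d.vF
    · rw [h.al_f hv hδ, h'.al_f (evF ▸ hv) hδ]
    · rw [h.al_v hv, h'.al_v (evF ▸ hv)]
  have eei : d.ei = d'.ei := by
    by_cases hs : d.s = 0
    · rw [(h.ei_d hs).1, (h'.ei_d (es ▸ hs)).1, eidx]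
    · rw [h.ei_h hs, h'.ei_h (es ▸ hs)]
  have eep : d.ep = d'.ep := by
    by_cases hs : d.s = 0
    · rw [h.ep_d hs, h'.ep_d (es ▸ hs), ep]
    · rw [h.ep_h hs, h'.ep_h (es ▸ hs)]
  have eq : d.q = d'.q := by
    rcases hs : d.s with _ | _ | _
    · rw [h.q_d hs, h'.q_d (es ▸ hs)]
    · rw [h.q_n hs, h'.q_n (es ▸ hs)]
    · rw [h.q_v hs, h'.q_v (es ▸ hs)]
  have estep : d.st = d'.st ∧ d.op = d'.op := by
    by_cases hv : d.vF
    · exact ⟨(h.f_st hv).trans (h'.f_st (evF ▸ hv)).symm, (h.f_op hv).trans (h'.f_op (evF ▸ hv)).symm⟩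
    · have := (h.n_st hv).trans ((ejF ▸ h'.n_st (evF ▸ hv)).symm)
      exact Prod.mk.inj this
  have ec : d.c = d'.c := by
    by_cases hv : d.vF
    · rw [h.f_c hv, h'.f_c (evF ▸ hv), eidx, ep, eal]
    · funext k
      rw [h.n_c hv, h'.n_c (evF ▸ hv), estep.2, ejF, ejL]
  have epc : d.pc = d'.pc := by
    by_cases hv : d.vF
    · rw [h.f_pc hv, h'.f_pc (evF ▸ hv)]
    · rw [h.n_pc hv, h'.n_pc (evF ▸ hv)]
  obtain ⟨est, eop⟩ := estep
  cases d; cases d'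
  simp only at *
  subst_vars
  rfl

/-- The letter at the point `(J, w)` of the array of supercells with values `θ`. -/
def encL (M : Mach St κ) (δ : Bool) (N : ℤ) (i : ℕ) (θ : ℤ × ℤ → ℕ) (J w : ℤ) : Letter St κ :=
  let A := J / N
  let B := w / N
  let al := if δ then 0 else θ (A, B + 1)
  let run := M.run i (θ (A, B)) (θ (A - 1, B - 1)) al
  { jF := decide (J % N = 0)
    jL := decide ((J + 1) % N = 0)
    vF := decide (w % N = 0)
    vL := decide ((w + 1) % N = 0)
    s := sgn (w % N - J % N)
    idx := decide (J % N < i)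
    p := decide (J % N < θ (A, B))
    q := decide (J % N ≤ w % N ∧ J % N < θ (A - 1, B))
    al := decide (J % N < al)
    ei := decide (w % N < i)
    ep := decide (w % N < if w % N ≤ J % N then θ (A, B) else θ (A - 1, B))
    st := (run (w % N).toNat).1
    op := M.opAt i (θ (A, B)) (θ (A - 1, B - 1)) al (w % N).toNat
    c := fun k => decide (J % N < (run (w % N).toNat).2 k)
    pc := fun k => decide (w % N ≠ 0 ∧ J % N < (run (w % N - 1).toNat).2 k) }

/-- The value arrays accepted by `φ` with index `i`. -/
def Theta (φ : ℕ → ℕ → ℕ → ℕ → ℕ) (δ : Bool) (i : ℕ) : Set (ℤ × ℤ → ℕ) :=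
  {θ | ∀ A B, φ i (θ (A, B)) (θ (A - 1, B - 1)) (if δ then 0 else θ (A, B + 1)) = θ (A, B + 1) ∧
    θ (A, B + 1) ≠ 0}

/-- The machine `M` computes `φ`, accepting exactly at time `Nf i - 1` and within space `Nf i`. -/
structure Mach.Computes (M : Mach St κ) (φ : ℕ → ℕ → ℕ → ℕ → ℕ) (Nf : ℕ → ℕ) : Prop where
  pos : ∀ i, 0 < Nf i
  sound : ∀ i p q α v, M.acc (M.run i p q α v).1 → (M.run i p q α v).2 M.out ≠ 0 →
    v + 1 = Nf i ∧ φ i p q α = (M.run i p q α v).2 M.out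
  complete : ∀ i p q α, φ i p q α ≠ 0 → M.acc (M.run i p q α (Nf i - 1)).1 ∧
    (M.run i p q α (Nf i - 1)).2 M.out = φ i p q α
  space : ∀ i p q α, φ i p q α ≠ 0 → ∀ v < Nf i, ∀ k, (M.run i p q α v).2 k ≤ Nf i

end Rules
section Encode

variable {St κ : Type} {M : Mach St κ} {δ : Bool} {φ : ℕ → ℕ → ℕ → ℕ → ℕ} {Nf : ℕ → ℕ} {i : ℕ}
  {θ : ℤ × ℤ → ℕ}

theorem pred_emod {N : ℤ} (hN : 0 < N) (x : ℤ) :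
    (x % N = 0 ∧ (x - 1) % N = N - 1 ∧ (x - 1) / N = x / N - 1) ∨
      (0 < x % N ∧ (x - 1) % N = x % N - 1 ∧ (x - 1) / N = x / N) := by
  have := succ_emod hN (x - 1)
  rw [sub_add_cancel] at this
  have := Int.emod_nonneg (x - 1) hN.ne'
  omega

theorem encL_ok (hM : M.Computes φ Nf) (hθ : θ ∈ Theta φ δ i) (J w : ℤ) :
    LetterOK M δ (encL M δ (Nf i) i θ J w) (encL M δ (Nf i) i θ (J + 1) w)
      (encL M δ (Nf i) i θ (J - 1) (w + 1)) (encL M δ (Nf i) i θ J (w + 1)) := by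
  obtain ⟨N, hNdef⟩ : ∃ N : ℤ, N = Nf i := ⟨_, rfl⟩
  have hN : 0 < N := by have := hM.pos i; omega
  rw [← hNdef]
  have hJ0 := Int.emod_nonneg J hN.ne'
  have hJN := Int.emod_lt_of_pos J hN
  have hw0 := Int.emod_nonneg w hN.ne'
  have hwN := Int.emod_lt_of_pos w hN
  have hJp := pred_emod hN J
  have hJs := succ_emod hN J
  have hws := succ_emod hN w
  have hwss := succ_emod hN (w + 1)
  have hw0' := Int.emod_nonneg (w + 1) hN.ne'
  have hwN' := Int.emod_lt_of_pos (w + 1) hN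
  have hrun : ∀ A B, (∀ v : ℤ, 0 ≤ v → v < N → ∀ k, ((M.run i (θ (A, B)) (θ (A - 1, B - 1))
      (if δ then 0 else θ (A, B + 1)) v.toNat).2 k : ℤ) ≤ N) ∧
      M.acc (M.run i (θ (A, B)) (θ (A - 1, B - 1)) (if δ then 0 else θ (A, B + 1)) (N - 1).toNat).1 ∧
      (M.run i (θ (A, B)) (θ (A - 1, B - 1)) (if δ then 0 else θ (A, B + 1)) (N - 1).toNat).2 M.out
        = θ (A, B + 1) ∧ θ (A, B + 1) ≠ 0 := by
    intro A B
    obtain ⟨h1, h2⟩ := hθ A B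
    have h3 := hM.complete i _ _ _ (h1.trans_ne h2)
    rw [h1, show Nf i - 1 = (N - 1).toNat by omega] at h3
    refine ⟨fun v hv hvN k => ?_, h3.1, h3.2, h2⟩
    have := hM.space i _ _ _ (h1.trans_ne h2) v.toNat (by omega) k
    omega
  have hθN : ∀ A B, (θ (A, B) : ℤ) ≤ N := by
    intro A B
    have h := hrun A (B - 1)
    rw [sub_add_cancel] at h
    rw [← h.2.2.1]
    exact h.1 _ (by omega) (by omega) _
  constructor
  case fin =>
    simp only [encL, decide_eq_true_eq]
    intro h1 h2
    have e : (w + 1) % N = N - 1 := by omega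
    obtain ⟨-, h3, h4, h5⟩ := hrun (J / N) ((w + 1) / N)
    rw [e, h4, h1]
    exact ⟨h3, by omega⟩
  case f_c =>
    simp only [encL, decide_eq_true_eq]
    intro h
    funext k
    have e : (w + 1) / N = w / N + 1 := by omega
    have e2 : w % N = N - 1 := by omega
    simp only [h, Int.toNat_zero, Mach.run, e, e2, add_sub_cancel_right]
    have : J % N ≤ N - 1 := by omega
    generalize M.inp k = x
    fin_cases x <;> simp [this, hJ0] <;> rfl
  case n_st =>
    simp only [encL, decide_eq_true_eq]
    intro h
    have e : (w + 1) / N = w / N := by omega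
    have e2 : ((w + 1) % N).toNat = (w % N).toNat + 1 := by omega
    by_cases h2 : J % N = 0
    · simp only [e, e2, Mach.run, Mach.opAt, Mach.step, Mach.next, h2, Nat.cast_pos, if_true]
    · have e3 : (J - 1) / N = J / N := by omega
      rw [e3, if_neg h2]
  case n_pc =>
    simp only [encL, decide_eq_true_eq]
    intro h
    have e : (w + 1) / N = w / N := by omega
    have e2 : (w + 1) % N - 1 = w % N := by omega
    simp only [e, e2, h, not_false_eq_true, ne_eq, true_and]
  case n_c =>
    simp only [encL, decide_eq_true_eq]
    intro h k
    have e : (w + 1) / N = w / N := by omega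
    have e2 : ((w + 1) % N).toNat = (w % N).toNat + 1 := by omega
    have e2' : ((w + 1) % N - 1).toNat = (w % N).toNat := by omega
    rw [e, e2, e2', Mach.run, Mach.opAt]
    dsimp only [Mach.step]
    have hsp := (hrun (J / N) (w / N)).1 (w % N) hw0 hwN k
    generalize hal : (if δ = true then 0 else θ (J / N, w / N + 1)) = al at hsp ⊢
    generalize hX : M.run i (θ (J / N, w / N)) (θ (J / N - 1, w / N - 1)) al (w % N).toNat = X
      at hsp ⊢
    rcases hJp with ⟨h1, h2, h3⟩ | ⟨h1, h2, h3⟩ <;> rcases hJs with ⟨h4, h5, h6⟩ | ⟨h4, h5, h6⟩ <;>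
    simp only [h3, h5, h6, h2, h, hal, not_false_eq_true, ne_eq, true_and, if_true, opApply,
      show J % N + 1 ≠ 0 by omega, h1, if_false, hX, h4] <;>
    split_ifs <;> simp only [decide_eq_decide, decide_eq_true_eq, decide_eq_false_iff_not] <;> omega
  case c_m =>
    simp only [encL, decide_eq_true_eq]
    intro h k
    have e3 : (J - 1) / N = J / N := by omega
    rw [e3]
    omega
  case ovf =>
    simp only [encL, decide_eq_true_eq]
    intro h h1 k h2
    have e : (w + 1) / N = w / N := by omega
    have e2 : ((w + 1) % N).toNat = (w % N).toNat + 1 := by omega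
    have hsp := (hrun (J / N) (w / N)).1 ((w + 1) % N) hw0' hwN' k
    rw [e2, Mach.run] at hsp
    rw [e, e2, Mach.opAt] at h2
    simp only [Mach.step, h2, opApply, if_true] at hsp
    push_cast at hsp
    omega
  case p_f =>
    simp only [encL, decide_eq_true_eq]
    intro h
    have e : (w + 1) / N = w / N + 1 := by omega
    have e2 : w % N = N - 1 := by omega
    rw [e, e2, (hrun _ _).2.2.1]
  all_goals
    have hJJ := hθN (J / N) ((w + 1) / N)
    have hJ1 := hθN (J / N - 1) ((w + 1) / N)
    rcases hJp with ⟨h1, h2, h3⟩ | ⟨h1, h2, h3⟩ <;> rcases hJs with ⟨h4, h5, h6⟩ | ⟨h4, h5, h6⟩ <;>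
    rcases hws with ⟨h7, h8, h9⟩ | ⟨h7, h8, h9⟩ <;>
    simp only [encL, decide_eq_true_eq, h2, h3, h5, h8, h9, sgn_eq_one, sgn_eq_zero,
      sgn_eq_neg_one, ne_eq, sub_add_cancel, decide_eq_decide, h1, Int.toNat_zero, Mach.run,
      Mach.opAt, not_true, IsEmpty.forall_iff, h4, implies_true]
  all_goals
    first
      | done
      | omega
      | (intros; simp only [and_self]; done)
      | (intros; simp only [decide_eq_false_iff_not]; omega)
      | (intros; split_ifs <;> first | omega | simp [sgn_eq_one, sgn_eq_zero, sgn_eq_neg_one] <;> omega)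

end Encode

theorem exists_word {N : ℤ} {f : ℤ → Bool} (h : ∀ j, 0 ≤ j → j + 1 < N → f (j + 1) → f j) :
    ∃ n : ℕ, ((n : ℤ) ≤ N ∨ n = 0) ∧ ∀ j, 0 ≤ j → j < N → f j = decide (j < (n : ℤ)) := by
  have key : ∀ K : ℕ, (K : ℤ) ≤ N → ∃ n : ℕ, n ≤ K ∧ ∀ j, 0 ≤ j → j < (K : ℤ) →
      f j = decide (j < (n : ℤ)) := by
    intro K
    induction K with
    | zero => intro _; exact ⟨0, le_rfl, fun j h0 h1 => by push_cast at h1; omega⟩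
    | succ K ih =>
      intro hK
      push_cast at hK
      obtain ⟨n, hn, hf⟩ := ih (by omega)
      by_cases hKf : f K
      · refine ⟨K + 1, le_rfl, fun j h0 h1 => ?_⟩
        have down : ∀ i : ℕ, i ≤ K → f ((K : ℤ) - i) := by
          intro i
          induction i with
          | zero => intro _; simpa using hKf
          | succ i ih =>
            intro hi
            refine h _ (by omega) (by omega) ?_
            have := ih (by omega)
            rwa [show (K : ℤ) - (i + 1 : ℕ) + 1 = K - i by push_cast; ring]
        have := down (K - j).toNat (by omega)
        rw [show (K : ℤ) - (K - j).toNat = j by omega] at this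
        rw [this, eq_comm, decide_eq_true_iff]
        exact_mod_cast h1
      · refine ⟨n, by omega, fun j h0 h1 => ?_⟩
        by_cases hj : j = K
        · subst hj
          have : ¬ ((K : ℤ) < n) := by omega
          simp [this, hKf]
        · exact hf j h0 (by push_cast at h1; omega)
  by_cases hN : 0 ≤ N
  · obtain ⟨n, h1, h2⟩ := key N.toNat (by omega)
    exact ⟨n, by omega, fun j h3 h4 => h2 j h3 (by omega)⟩
  · exact ⟨0, Or.inr rfl, fun j h3 h4 => by omega⟩

theorem word_inj {N : ℤ} {a b : ℕ} (ha : (a : ℤ) ≤ N) (hb : (b : ℤ) ≤ N)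
    (h : ∀ j : ℤ, 0 ≤ j → j < N → (decide (j < (a : ℤ)) = decide (j < (b : ℤ)))) : a = b := by
  rcases lt_trichotomy a b with hlt | rfl | hlt
  · have := h a (by omega) (by omega)
    rw [decide_eq_decide] at this
    omega
  · rfl
  · have := h b (by omega) (by omega)
    rw [decide_eq_decide] at this
    omega

section DecodeL

variable {St κ : Type} {M : Mach St κ} {δ : Bool} {φ : ℕ → ℕ → ℕ → ℕ → ℕ} {Nf : ℕ → ℕ}
  {L : ℤ → ℤ → Letter St κ} {N : ℤ}

theorem diag_floor (hN : 0 < N) (J w : ℤ) :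
    (N * ((J - w) / N) + w) / N = if w % N ≤ J % N then J / N else J / N - 1 := by
  have hJ0 := Int.emod_nonneg J hN.ne'
  have hJN := Int.emod_lt_of_pos J hN
  have hw0 := Int.emod_nonneg w hN.ne'
  have hwN := Int.emod_lt_of_pos w hN
  have h1 := Int.mul_ediv_add_emod J N
  have h2 := Int.mul_ediv_add_emod w N
  rw [Int.mul_add_ediv_left _ _ hN.ne']
  have : (J - w) / N = (if w % N ≤ J % N then J / N - w / N else J / N - w / N - 1) := by
    split_ifs with h
    · rw [show J - w = (J % N - w % N) + N * (J / N - w / N) by rw [mul_sub]; omega,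
        Int.add_mul_ediv_left _ _ hN.ne', Int.ediv_eq_zero_of_lt (by omega) (by omega), zero_add]
    · rw [show J - w = (J % N - w % N + N) + N * (J / N - w / N - 1) by
          rw [mul_sub, mul_sub]; omega,
        Int.add_mul_ediv_left _ _ hN.ne', Int.ediv_eq_zero_of_lt (by omega) (by omega), zero_add]
  rw [this]
  split_ifs <;> ring

theorem decodeL_aligned (hM : M.Computes φ Nf) (hφ : δ = false → ∀ i p q α, φ i p q α ≠ 0 →
      φ i p q α = α) (hN : 0 < N)
    (hL : ∀ J w, LetterOK M δ (L J (w - 1)) (L (J + 1) (w - 1)) (L (J - 1) w) (L J w))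
    (hjF : ∀ J w, (L J w).jF ↔ J % N = 0) (hjL : ∀ J w, (L J w).jL ↔ (J + 1) % N = 0)
    (hvF : ∀ J w, (L J w).vF ↔ w % N = 0) (hvL : ∀ J w, (L J w).vL ↔ (w + 1) % N = 0)
    (hs : ∀ J w, (L J w).s = sgn (w % N - J % N)) :
    ∃ i, N = Nf i ∧ ∃ θ ∈ Theta φ δ i, L = encL M δ N i θ := by
  have hdiv : ∀ u j, 0 ≤ j → j < N → (N * u + j) / N = u ∧ (N * u + j) % N = j := by
    intro u j h0 h1
    rw [add_comm, Int.add_mul_ediv_left _ _ hN.ne', Int.add_mul_emod_self_left,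
      Int.ediv_eq_zero_of_lt h0 h1, Int.emod_eq_of_lt h0 h1, zero_add]
    exact ⟨rfl, rfl⟩
  have hm0 : ∀ x, 0 ≤ x % N := fun x => Int.emod_nonneg x hN.ne'
  have hmN : ∀ x, x % N < N := fun x => Int.emod_lt_of_pos x hN
  have hme : ∀ x, N * (x / N) + x % N = x := fun x => Int.mul_ediv_add_emod x N
  have notF : ∀ A j w, 0 ≤ j → j + 1 < N → ¬ (L (N * A + (j + 1)) w).jF := by
    intro A j w h0 h1
    rw [hjF, (hdiv A (j + 1) (by omega) h1).2]
    omega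
  -- words
  have hidx_w : ∀ J w, (L J w).idx = (L J 0).idx := fun J w =>
    const_of_succ (f := fun w => (L J w).idx) (fun w => by
      have := (hL J (w + 1)).idx_v
      rwa [add_sub_cancel_right] at this) w 0
  have hp_w : ∀ J w, (L J w).p = (L J (N * (w / N))).p := fun J w =>
    const_on_block hN (f := fun w => (L J w).p) (fun w h => by
      have := (hL J (w + 1)).p_v (by rwa [hvF])
      rwa [add_sub_cancel_right] at this) w
  have hal_w : ∀ J w, (L J w).al = (L J (N * (w / N))).al := fun J w =>
    const_on_block hN (f := fun w => (L J w).al) (fun w h => by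
      have := (hL J (w + 1)).al_v (by rwa [hvF])
      rwa [add_sub_cancel_right] at this) w
  have hidx_ex : ∀ A, ∃ n : ℕ, ((n : ℤ) ≤ N ∨ n = 0) ∧ ∀ j, 0 ≤ j → j < N →
      (L (N * A + j) 0).idx = decide (j < (n : ℤ)) := fun A => exists_word fun j h0 h1 h => by
    have := (hL (N * A + (j + 1)) 0).idx_m (notF _ _ _ h0 h1) h
    rwa [← add_assoc, add_sub_cancel_right] at this
  have hal_ex : ∀ A B, ∃ n : ℕ, ((n : ℤ) ≤ N ∨ n = 0) ∧ ∀ j, 0 ≤ j → j < N →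
      (L (N * A + j) (N * B)).al = decide (j < (n : ℤ)) := fun A B =>
    exists_word fun j h0 h1 h => by
      have := (hL (N * A + (j + 1)) (N * B)).al_m (notF _ _ _ h0 h1) h
      rwa [← add_assoc, add_sub_cancel_right] at this
  have hpf : ∀ J B, (L J (N * B)).p = (L J (N * B - 1)).c M.out := fun J B =>
    (hL J (N * B)).p_f (by rw [hvF]; simp)
  have hp_ex : ∀ A B, ∃ n : ℕ, ((n : ℤ) ≤ N ∨ n = 0) ∧ ∀ j, 0 ≤ j → j < N →
      (L (N * A + j) (N * B)).p = decide (j < (n : ℤ)) := fun A B =>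
    exists_word fun j h0 h1 h => by
      rw [hpf] at h ⊢
      have := (hL (N * A + (j + 1)) (N * B - 1)).c_m (notF _ _ _ h0 h1) _ h
      rwa [← add_assoc, add_sub_cancel_right] at this
  choose I hIN hI using hidx_ex
  choose al halN hal using hal_ex
  choose θ' hθN hθ using hp_ex
  replace hIN : ∀ A, (I A : ℤ) ≤ N := fun A => by have := hIN A; omega
  replace halN : ∀ A B, (al A B : ℤ) ≤ N := fun A B => by have := halN A B; omega
  replace hθN : ∀ A B, (θ' A B : ℤ) ≤ N := fun A B => by have := hθN A B; omega
  have hI' : ∀ J w, (L J w).idx = decide (J % N < I (J / N)) := fun J w => by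
    rw [hidx_w, ← hI _ _ (hm0 J) (hmN J), hme]
  have hal' : ∀ J w, (L J w).al = decide (J % N < al (J / N) (w / N)) := fun J w => by
    rw [hal_w, ← hal _ _ _ (hm0 J) (hmN J), hme]
  have hθ' : ∀ J w, (L J w).p = decide (J % N < θ' (J / N) (w / N)) := fun J w => by
    rw [hp_w, ← hθ _ _ _ (hm0 J) (hmN J), hme]
  -- horizontal transport
  have hsne : ∀ x w, (x + 1) % N ≠ 0 → (L (x + 1 + w) w).s ≠ 0 := by
    intro x w h h2
    rw [hs, sgn_eq_zero] at h2
    apply h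
    have : ((x + 1 + w) % N - w % N) % N = 0 := by
      rw [show (x + 1 + w) % N - w % N = 0 by omega]; simp
    rwa [Int.emod_sub_emod, Int.sub_emod_emod, add_sub_cancel_right] at this
  have hdiag : ∀ z w, (N * z + w) % N = w % N := by intro z w; simp
  have hsd : ∀ z w, (L (N * z + w) w).s = 0 := fun z w => by
    rw [hs, hdiag, sgn_eq_zero, sub_self]
  have hei : ∀ J w, (L J w).ei =
      decide (w % N < I (if w % N ≤ J % N then J / N else J / N - 1)) := by
    intro J w
    have := const_on_block hN (f := fun x => (L (x + w) w).ei) (fun x h => by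
      have := (hL (x + 1 + w) w).ei_h (hsne x w h)
      rwa [show x + 1 + w - 1 = x + w by ring] at this) (J - w)
    rw [sub_add_cancel] at this
    rw [this, ((hL _ w).ei_d (hsd _ w)).1, hI', hdiag, diag_floor hN]
  have hep : ∀ J w, (L J w).ep =
      decide (w % N < θ' (if w % N ≤ J % N then J / N else J / N - 1) (w / N)) := by
    intro J w
    have := const_on_block hN (f := fun x => (L (x + w) w).ep) (fun x h => by
      have := (hL (x + 1 + w) w).ep_h (hsne x w h)
      rwa [show x + 1 + w - 1 = x + w by ring] at this) (J - w)
    rw [sub_add_cancel] at this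
    rw [this, (hL _ w).ep_d (hsd _ w), hθ', hdiag, diag_floor hN]
  have hpred : ∀ A w, (if w % N ≤ (N * A + w % N - 1) % N then (N * A + w % N - 1) / N
      else (N * A + w % N - 1) / N - 1) = A - 1 := by
    intro A w
    obtain ⟨h1, h2⟩ := hdiv A (w % N) (hm0 w) (hmN w)
    have := pred_emod hN (N * A + w % N)
    have := hm0 w
    have := hmN w
    split_ifs <;> omega
  have hIc : ∀ A, I A = I 0 := fun A => by
    have key : ∀ A, I A = I (A - 1) := by
      intro A
      refine word_inj (hIN A) (hIN _) fun j h0 h1 => ?_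
      have hj := hdiv 0 j h0 h1
      rw [mul_zero, zero_add] at hj
      have hd : (L (N * A + j) j).s = 0 := hsd A j
      have := ((hL _ j).ei_d hd).2
      have hp := hpred A j
      rw [hj.2] at hp
      rw [hei, hI', hj.2, hp, (hdiv A j h0 h1).1, (hdiv A j h0 h1).2] at this
      exact this.symm
    refine const_of_succ (fun A => ?_) A 0
    have := key (A + 1)
    rwa [add_sub_cancel_right] at this
  obtain ⟨i, hi⟩ : ∃ i, i = I 0 := ⟨_, rfl⟩
  have hiN : (i : ℤ) ≤ N := hi ▸ hIN 0
  simp only [hIc, ← hi] at hI' hei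
  -- diagonal transport
  have hq1 : ∀ k : ℕ, ∀ J w, w % N = J % N + k → (L J w).q = decide (J % N < θ' (J / N - 1) (w / N)) := by
    intro k
    induction k with
    | zero =>
      intro J w h
      simp only [Nat.cast_zero, add_zero] at h
      have hd : (L J w).s = 0 := by rw [hs, h, sgn_eq_zero, sub_self]
      have hp := hpred (J / N) w
      rw [h, hme] at hp
      rw [(hL J w).q_d hd, hep, h, hp]
    | succ k ih =>
      intro J w h
      push_cast at h
      have hd : (L J w).s = 1 := by rw [hs, h, sgn_eq_one]; omega
      have := pred_emod hN w
      have := hm0 J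
      rw [(hL J w).q_v hd, ih J (w - 1) (by omega), show (w - 1) / N = w / N by omega]
  have hq : ∀ J w, (L J w).q = decide (J % N ≤ w % N ∧ J % N < θ' (J / N - 1) (w / N)) := by
    intro J w
    by_cases h : J % N ≤ w % N
    · rw [hq1 (w % N - J % N).toNat J w (by omega)]
      simp [h]
    · rw [(hL J w).q_n (by rw [hs, sgn_eq_neg_one]; omega)]
      simp [h]
  -- the machine
  have hrun : ∀ A B, ∀ v : ℕ, (v : ℤ) < N → (∀ k, ((M.run i (θ' A B) (θ' (A - 1) (B - 1)) (al A B) v).2 k : ℤ) ≤ N) ∧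
      ∀ j, 0 ≤ j → j < N → (L (N * A + j) (N * B + v)).st =
          (M.run i (θ' A B) (θ' (A - 1) (B - 1)) (al A B) v).1 ∧
        (L (N * A + j) (N * B + v)).op = M.opAt i (θ' A B) (θ' (A - 1) (B - 1)) (al A B) v ∧
        (L (N * A + j) (N * B + v)).c =
          fun k => decide (j < (M.run i (θ' A B) (θ' (A - 1) (B - 1)) (al A B) v).2 k) := by
    intro A B v
    induction v with
    | zero =>
      intro _
      simp only [Mach.run, Mach.opAt, Nat.cast_zero, add_zero]
      constructor
      · intro k
        have h1 := hθN A B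
        have h2 := hθN (A - 1) (B - 1)
        have h3 := halN A B
        generalize M.inp k = x
        fin_cases x <;> simp [*] <;> omega
      · intro j h0 h1
        have hf : (L (N * A + j) (N * B)).vF := by rw [hvF]; simp
        have hw := hL (N * A + j) (N * B)
        refine ⟨hw.f_st hf, hw.f_op hf, ?_⟩
        rw [hw.f_c hf, hI', hal', hθ', hq]
        have e1 : (N * B - 1) / N = B - 1 ∧ (N * B - 1) % N = N - 1 := by
          have := pred_emod hN (N * B)
          have := hdiv B 0 le_rfl hN
          rw [add_zero] at this
          omega
        have e2 := hdiv A j h0 h1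
        have e3 := hdiv B 0 le_rfl hN
        rw [add_zero] at e3
        rw [e1.1, e1.2, e2.1, e2.2, e3.1]
        have e4 : j ≤ N - 1 := by omega
        funext k
        have key : ∀ x : Fin 5, (![decide (j < (i : ℤ)), decide (j < (θ' A B : ℤ)),
            decide (j ≤ N - 1 ∧ j < (θ' (A - 1) (B - 1) : ℤ)), decide (j < (al A B : ℤ)), false] x :
            Bool) = decide (j < ((![i, θ' A B, θ' (A - 1) (B - 1), al A B, 0] x : ℕ) : ℤ)) := by
          intro x
          fin_cases x <;> simp [e4, h0] <;> rfl
        exact key _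
    | succ v ih =>
      intro hv
      push_cast at hv
      obtain ⟨ih1, ih2⟩ := ih (by omega)
      push_cast
      set X := M.run i (θ' A B) (θ' (A - 1) (B - 1)) (al A B) v with hX
      have hnf : ∀ J, ¬ (L J (N * B + (v + 1))).vF := by
        intro J
        rw [hvF, (hdiv B (v + 1) (by omega) hv).2]
        omega
      have ew : N * B + (v + 1 : ℤ) - 1 = N * B + v := by ring
      have hsto : ∀ j : ℕ, (j : ℤ) < N → (L (N * A + j) (N * B + (v + 1))).st = (M.next X).1 ∧
          (L (N * A + j) (N * B + (v + 1))).op = (M.next X).2 := by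
        intro j
        induction j with
        | zero =>
          intro _
          have hF : (L (N * A + (0 : ℕ)) (N * B + (v + 1))).jF := by rw [hjF]; simp
          have := (hL (N * A + (0 : ℕ)) (N * B + (v + 1))).n_st (hnf _)
          rw [if_pos hF, ew] at this
          have h2 := ih2 0 le_rfl hN
          rw [Nat.cast_zero] at this ⊢
          rw [h2.1, h2.2.2] at this
          have e := Prod.mk.inj this
          refine ⟨e.1.trans ?_, e.2.trans ?_⟩ <;> simp [Mach.next, X]
        | succ j ihj =>
          intro hj
          push_cast at hj
          have hF := notF A j (N * B + (v + 1)) (by omega) hj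
          have := (hL (N * A + (j + 1)) (N * B + (v + 1))).n_st (hnf _)
          rw [if_neg hF, ← add_assoc, add_sub_cancel_right] at this
          have e := Prod.mk.inj this
          push_cast
          rw [← add_assoc, e.1, e.2]
          exact ihj (by omega)
      constructor
      · intro k
        simp only [Mach.run, Mach.step, opApply, ← hX]
        have h1 := ih1 k
        by_cases ho : (M.next X).2 k = 1
        · have hl : (L (N * A + (N - 1)) (N * B + (v + 1))).jL := by
            rw [hjL, show N * A + (N - 1) + 1 = N * (A + 1) by ring]; simp
          have h2 := hsto (N - 1).toNat (by omega)
          rw [Int.toNat_of_nonneg (by omega)] at h2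
          have := (hL (N * A + (N - 1)) (N * B + (v + 1))).ovf (hnf _) hl k (by rw [h2.2, ho])
          rw [ew, (ih2 (N - 1) (by omega) (by omega)).2.2, decide_eq_true_eq] at this
          rw [if_pos ho]
          push_cast
          omega
        · rw [if_neg ho]
          split_ifs <;> omega
      · intro j h0 h1
        have h2 := hsto j.toNat (by omega)
        rw [Int.toNat_of_nonneg h0] at h2
        refine ⟨h2.1, h2.2, ?_⟩
        funext k
        simp only [Mach.run, Mach.step, opApply, ← hX]
        have hw := (hL (N * A + j) (N * B + (v + 1))).n_c (hnf _) k
        rw [hw, h2.2, ew]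
        have hk := ih1 k
        by_cases ho : (M.next X).2 k = 1
        · rw [if_pos ho, if_pos ho]
          by_cases hj : j = 0
          · have hF : (L (N * A + j) (N * B + (v + 1))).jF := by rw [hjF, hj]; simp
            rw [if_pos hF, hj, eq_comm, decide_eq_true_iff]
            omega
          · have hF : ¬ (L (N * A + j) (N * B + (v + 1))).jF := by
              rw [hjF, (hdiv A j h0 h1).2]; omega
            rw [if_neg hF, (hL (N * A + j - 1) (N * B + (v + 1))).n_pc (hnf _), ew, add_sub_assoc,
              (ih2 (j - 1) (by omega) (by omega)).2.2, decide_eq_decide]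
            omega
        · rw [if_neg ho, if_neg ho]
          by_cases ho' : (M.next X).2 k = -1
          · rw [if_pos ho', if_pos ho']
            by_cases hj : j + 1 = N
            · have hF : (L (N * A + j) (N * B + (v + 1))).jL := by
                rw [hjL, add_assoc, hj, show N * A + N = N * (A + 1) by ring]; simp
              rw [if_pos hF, eq_comm, decide_eq_false_iff_not]
              omega
            · have hF : ¬ (L (N * A + j) (N * B + (v + 1))).jL := by
                rw [hjL, add_assoc, (hdiv A (j + 1) (by omega) (by omega)).2]; omega
              rw [if_neg hF, add_assoc, (ih2 (j + 1) (by omega) (by omega)).2.2, decide_eq_decide]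
              omega
          · rw [if_neg ho', if_neg ho', (ih2 j h0 h1).2.2]
  have hfin : ∀ A B, N = Nf i ∧ φ i (θ' A B) (θ' (A - 1) (B - 1)) (al A B) = θ' A (B + 1) ∧
      θ' A (B + 1) ≠ 0 := by
    intro A B
    obtain ⟨h1, h2⟩ := hrun A B (N - 1).toNat (by omega)
    rw [Int.toNat_of_nonneg (by omega)] at h2
    have h3 := h2 0 le_rfl hN
    obtain ⟨h4, h5⟩ := (hL (N * A + 0) (N * B + (N - 1))).fin (by rw [hjF]; simp)
      (by rw [hvL, show N * B + (N - 1) + 1 = N * (B + 1) by ring]; simp)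
    rw [h3.1] at h4
    rw [h3.2.2, decide_eq_true_eq] at h5
    obtain ⟨h6, h7⟩ := hM.sound _ _ _ _ _ h4 (by omega)
    have h8 : θ' A (B + 1) = (M.run i (θ' A B) (θ' (A - 1) (B - 1)) (al A B) (N - 1).toNat).2 M.out := by
      refine word_inj (hθN _ _) (h1 _) fun j h0 h1 => ?_
      rw [← hθ _ _ _ h0 h1, hpf, show N * (B + 1) - 1 = N * B + (N - 1) by ring, (h2 j h0 h1).2.2]
    exact ⟨by omega, by rw [h7, h8], by omega⟩
  have hals : ∀ A B, al A B = if δ then 0 else θ' A (B + 1) := by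
    intro A B
    split_ifs with hδ
    · refine word_inj (halN _ _) (by simpa using hN.le) fun j h0 h1 => ?_
      rw [← hal _ _ _ h0 h1, (hL _ _).al_f (by rw [hvF]; simp) hδ]
      simp [h0]
    · obtain ⟨-, h2, h3⟩ := hfin A B
      have := hφ (by simpa using hδ) i (θ' A B) (θ' (A - 1) (B - 1)) (al A B) (by rw [h2]; exact h3)
      rw [← this, h2]
  refine ⟨i, (hfin 0 0).1, fun m => θ' m.1 m.2, fun A B => ?_, ?_⟩
  · have := hfin A B
    rw [hals] at this
    exact this.2
  · funext J w
    have hr := (hrun (J / N) (w / N) (w % N).toNat (by have := hm0 w; have := hmN w; omega)).2 _ (hm0 J) (hmN J)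
    rw [Int.toNat_of_nonneg (hm0 w), hme, hme] at hr
    have hpc : (L J w).pc = fun k => decide (w % N ≠ 0 ∧ J % N < (M.run i (θ' (J / N) (w / N))
        (θ' (J / N - 1) (w / N - 1)) (al (J / N) (w / N)) (w % N - 1).toNat).2 k) := by
      by_cases h0 : w % N = 0
      · rw [(hL J w).f_pc ((hvF _ _).2 h0)]
        simp [h0]
      · rw [(hL J w).n_pc (by rw [hvF]; exact h0)]
        have h1 := hm0 w
        have h2 := hmN w
        have := (hrun (J / N) (w / N) (w % N - 1).toNat (by omega)).2 _ (hm0 J) (hmN J)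
        rw [Int.toNat_of_nonneg (by omega), ← add_sub_assoc, hme, hme] at this
        rw [this.2.2]
        simp [h0]
    rw [hals] at hr hpc
    have ext : ∀ x y : Letter St κ, x.jF = y.jF → x.jL = y.jL → x.vF = y.vF → x.vL = y.vL →
        x.s = y.s → x.idx = y.idx → x.p = y.p → x.q = y.q → x.al = y.al → x.ei = y.ei →
        x.ep = y.ep → x.st = y.st → x.op = y.op → x.c = y.c → x.pc = y.pc → x = y := by
      rintro ⟨⟩ ⟨⟩
      simp only
      rintro rfl rfl rfl rfl rfl rfl rfl rfl rfl rfl rfl rfl rfl rfl rfl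
      rfl
    apply ext
    · rw [Bool.eq_iff_iff, hjF]; simp [encL]
    · rw [Bool.eq_iff_iff, hjL]; simp [encL]
    · rw [Bool.eq_iff_iff, hvF]; simp [encL]
    · rw [Bool.eq_iff_iff, hvL]; simp [encL]
    · exact hs J w
    · exact hI' J w
    · exact hθ' J w
    · exact hq J w
    · rw [hal', hals]; rfl
    · exact hei J w
    · rw [hep]; simp only [encL]; split_ifs <;> rfl
    · exact hr.1
    · exact hr.2.1
    · exact hr.2.2
    · exact hpc

end DecodeL
section Enc

variable {St κ : Type} {M : Mach St κ} {δ : Bool} {φ : ℕ → ℕ → ℕ → ℕ → ℕ} {Nf : ℕ → ℕ} {i : ℕ}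
  {θ : ℤ × ℤ → ℕ}

/-- The sheared array of supercells, as a configuration. -/
def tileEnc (M : Mach St κ) (δ : Bool) (N : ℤ) (i : ℕ) (θ : ℤ × ℤ → ℕ) :
    ℤ × ℤ → Letter St κ := fun m => encL M δ N i θ (m.1 - m.2) m.2

theorem tileEnc_mem (hM : M.Computes φ Nf) (hθ : θ ∈ Theta φ δ i) :
    tileEnc M δ (Nf i) i θ ∈ tilings Letter.vF Letter.vL (LetterOK M δ) (Nf i) := by
  refine ⟨?_, fun m => ⟨?_, ?_⟩⟩
  · rintro ⟨u, w⟩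
    have := encL_ok hM hθ (u - w) w
    simp only [tileEnc, Prod.mk_add_mk, add_zero]
    convert this using 2 <;> ring_nf
  · simp [tileEnc, encL]
  · simp [tileEnc, encL]

theorem raw_shift_first {Q : Type} (N n : ℤ) (t : ℤ × ℤ → Q) (hN : 0 < N) :
    raw (shift2 (n, 0) t) N = shift2 (N * n, 0) (raw t N) := by
  funext m
  have h1 : (N * n + m.1) % N = m.1 % N := by simp
  have h2 : (N * n + m.1) / N = n + m.1 / N := by
    rw [add_comm, Int.add_mul_ediv_left _ _ hN.ne', add_comm]
  simp [raw, shift2, h1, h2]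

theorem tilings_decode (hM : M.Computes φ Nf)
    (hφ : δ = false → ∀ i p q α, φ i p q α ≠ 0 → φ i p q α = α) {N : ℤ} (hN : 0 < N)
    {t : ℤ × ℤ → Letter St κ} (ht : t ∈ tilings Letter.vF Letter.vL (LetterOK M δ) N) :
    ∃ i, N = Nf i ∧ ∃ θ ∈ Theta φ δ i, ∃ n, t = shift2 (n, 0) (tileEnc M δ N i θ) := by
  set L : ℤ → ℤ → Letter St κ := fun J w => t (J + w, w) with hLdef
  have hL : ∀ J w, LetterOK M δ (L J (w - 1)) (L (J + 1) (w - 1)) (L (J - 1) w) (L J w) := by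
    intro J w
    have := ht.1 (J + (w - 1), w - 1)
    simp only [Prod.mk_add_mk, add_zero] at this
    convert this using 2 <;> ring_nf
  have hvF : ∀ J w, (L J w).vF ↔ w % N = 0 := fun J w => (ht.2 _).1
  have hvL : ∀ J w, (L J w).vL ↔ (w + 1) % N = 0 := fun J w => (ht.2 _).2
  have hjFv : ∀ J w, (L J w).jF = (L J 0).jF := fun J w =>
    const_of_succ (f := fun w => (L J w).jF)
      (fun w => by have := (hL J (w + 1)).jF_v; rwa [add_sub_cancel_right] at this) w 0
  have hjL' : ∀ J w, (L J w).jL = (L (J + 1) 0).jF := fun J w => by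
    have := (hL (J + 1) w).jF_l
    rw [add_sub_cancel_right, hjFv] at this
    exact this.symm
  have hgrid : DiagGrid (fun J => (L J 0).jF) (fun w => N ∣ w) (fun J w => (L J w).s) := by
    have hR : ∀ J w, (L J w).vF ↔ N ∣ w := fun J w => (hvF J w).trans Int.dvd_iff_emod_eq_zero.symm
    have hR' : ∀ J w, (L J w).vL ↔ N ∣ w + 1 := fun J w =>
      (hvL J w).trans Int.dvd_iff_emod_eq_zero.symm
    constructor
    · intro J w h1 h2
      have := (hL J w).s_first (by rwa [hjFv])
      rwa [if_pos ((hR J w).2 h2)] at this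
    · intro J w h1 h2
      have := (hL J w).s_first (by rwa [hjFv])
      rwa [if_neg (fun h => h2 ((hR J w).1 h))] at this
    · intro J w h1 h2
      exact (hL J w).s_first' (by rwa [hjFv]) ((hR J w).2 h2)
    · intro J w h1 h2
      have a1 := (hL (J + 1) (w + 1)).s_h (by rwa [hjFv])
      have a2 := (hL (J + 1) (w + 1)).s_v (fun h => h2 ((hR _ _).1 h))
      have a3 := (hL (J + 1) w).s_h (by rwa [hjFv])
      have a4 := (hL J (w + 1)).s_v (fun h => h2 ((hR _ _).1 h))
      simp only [add_sub_cancel_right] at a1 a2 a3 a4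
      revert a1 a2 a3 a4
      generalize (L (J + 1) (w + 1)).s = x
      generalize (L (J + 1) w).s = y
      generalize (L J (w + 1)).s = z
      generalize (L J w).s = u
      revert x y z u
      decide
    · intro J w h1 h2
      have := (hL J w).s_last (by rwa [hjL'])
      rwa [if_pos ((hR' J w).2 h2)] at this
    · intro J w h1 h2
      have := (hL J w).s_last (by rwa [hjL'])
      rwa [if_neg (fun h => h2 ((hR' J w).1 h))] at this
    · intro J w h1 h2
      exact (hL J w).s_last' (by rwa [hjL']) ((hR' J w).2 h2)
  obtain ⟨N', x0, y0, hN', hC, hR⟩ := hgrid.rigid (Or.inr ⟨0, N, hN.ne, dvd_zero _, dvd_refl _⟩)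
  have hNN : N' = N := by
    have h1 := (hR 0).1 (dvd_zero _)
    have h2 := (hR N).1 (dvd_refl _)
    have h3 : N' ∣ N := by simpa using dvd_sub h2 h1
    have h4 : N ∣ N' := (hR N').2 (by
      have := dvd_add (dvd_refl N') h1
      rwa [show N' + (0 - y0) = N' - y0 by ring] at this)
    exact Int.dvd_antisymm hN'.le hN.le h3 h4
  subst hNN
  set L' : ℤ → ℤ → Letter St κ := fun J w => L (J + x0) w with hL'def
  have hg' : DiagGrid (fun J => N' ∣ J) (fun w => N' ∣ w) (fun J w => (L' J w).s) := by
    have key : ∀ J, N' ∣ J ↔ (L (J + x0) 0).jF := fun J => by rw [hC, add_sub_cancel_right]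
    constructor <;> intro J w
    · rw [key]; exact hgrid.cr _ _
    · rw [key]; exact hgrid.cn _ _
    · rw [key]; exact hgrid.nr _ _
    · intro h1 h2
      rw [key, add_right_comm] at h1
      have := hgrid.diag (J + x0) w h1 h2
      simpa only [hL'def, add_right_comm] using this
    · rw [key, add_right_comm]; exact hgrid.lcr _ _
    · rw [key, add_right_comm]; exact hgrid.lcn _ _
    · rw [key, add_right_comm]; exact hgrid.lnr _ _
  obtain ⟨i, hi, θ, hθ, he⟩ := decodeL_aligned (L := L') hM hφ hN
    (fun J w => by
      have := hL (J + x0) w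
      simp only [hL'def]
      convert this using 2 <;> ring_nf)
    (fun J w => by
      rw [← Int.dvd_iff_emod_eq_zero]; simp only [hL'def]; rw [hjFv, hC, add_sub_cancel_right])
    (fun J w => by
      rw [← Int.dvd_iff_emod_eq_zero]; simp only [hL'def]
      rw [hjL', hC, show J + x0 + 1 - x0 = J + 1 by ring])
    (fun J w => hvF _ _) (fun J w => hvL _ _) (fun J w => hg'.sign_eq hN J w)
  refine ⟨i, hi, θ, hθ, -x0, ?_⟩
  funext ⟨u, w⟩
  have := congrFun (congrFun he (-x0 + u - w)) w
  simp only [hL'def, hLdef] at this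
  rw [show -x0 + u - w + x0 + w = u by ring] at this
  simp [shift2, tileEnc, this]

/-- The configuration encoding the array `θ` of values accepted with index `i`. -/
def encE (M : Mach St κ) (δ : Bool) (Nf : ℕ → ℕ) (i : ℕ) (θ : ℤ × ℤ → ℕ) :
    ℤ × ℤ → Raw (Letter St κ) := raw (tileEnc M δ (Nf i) i θ) (Nf i)

theorem encE_decode (hM : M.Computes φ Nf)
    (hφ : δ = false → ∀ i p q α, φ i p q α ≠ 0 → φ i p q α = α)
    {x : ℤ × ℤ → Raw (Letter St κ)}
    (hx : x ∈ winSet (RawOK Letter.vF Letter.vL (LetterOK M δ))) (hd : ¬ Degen x) :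
    ∃ i, ∃ θ ∈ Theta φ δ i, ∃ n, x = shift2 n (encE M δ Nf i θ) := by
  obtain ⟨N, hN, n, t, ht, rfl⟩ := raw_decode (fun a b c d h => h.vF_h) hx hd
  obtain ⟨i, hi, θ, hθ, k, rfl⟩ := tilings_decode hM hφ hN ht
  refine ⟨i, θ, hθ, (N * k, 0) + n, ?_⟩
  rw [raw_shift_first _ _ _ hN, shift2_shift2, encE, hi]

theorem encE_mem (hM : M.Computes φ Nf) (hθ : θ ∈ Theta φ δ i) :
    encE M δ Nf i θ ∈ winSet (RawOK Letter.vF Letter.vL (LetterOK M δ)) :=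
  raw_mem (by have := hM.pos i; omega) (tileEnc_mem hM hθ)

end Enc

section EncOrder

theorem ediv_bounds {N r x : ℤ} (hN : 0 < N) (hr : 0 ≤ r) (h1 : -r ≤ x) (h2 : x ≤ r) :
    -r ≤ x / N ∧ x / N ≤ r := by
  rw [Int.le_ediv_iff_mul_le hN]
  refine ⟨by nlinarith, ?_⟩
  have : x / N < r + 1 := by
    rw [Int.ediv_lt_iff_lt_mul hN]
    nlinarith
  omega

variable {St κ : Type} {M : Mach St κ} {δ : Bool} {φ : ℕ → ℕ → ℕ → ℕ → ℕ} {Nf : ℕ → ℕ} {i i' : ℕ}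
  {θ θ' : ℤ × ℤ → ℕ}

theorem raw_shift {Q : Type} (N a b : ℤ) (t : ℤ × ℤ → Q) (hN : 0 < N) (hb : N ∣ b) :
    raw (shift2 (a, b) t) N = shift2 (N * a, N * b) (raw t N) := by
  obtain ⟨b, rfl⟩ := hb
  funext m
  have h1 : ∀ a x : ℤ, (N * a + x) % N = x % N := fun a x => by simp
  have h2 : ∀ a x : ℤ, (N * a + x) / N = a + x / N := fun a x => by
    rw [add_comm, Int.add_mul_ediv_left _ _ hN.ne', add_comm]
  simp only [raw, shift2, Prod.fst_add, Prod.snd_add, h1, h2]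
  rfl

theorem encE_shift (hN : 0 < Nf i) (e f : ℤ) :
    ∃ n, encE M δ Nf i (shift2 (e, f) θ) = shift2 n (encE M δ Nf i θ) := by
  have hN' : (0 : ℤ) < Nf i := by exact_mod_cast hN
  refine ⟨(Nf i * (Nf i * e + Nf i * f), Nf i * (Nf i * f)), ?_⟩
  rw [encE, encE, ← raw_shift _ _ _ _ hN' (dvd_mul_right _ _)]
  congr 1
  generalize (Nf i : ℤ) = N at hN'
  funext ⟨u, w⟩
  have h1 : ∀ a x : ℤ, (N * a + x) % N = x % N := fun a x => by simp
  have h2 : ∀ a x : ℤ, (N * a + x) / N = a + x / N := fun a x => by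
    rw [add_comm, Int.add_mul_ediv_left _ _ hN'.ne', add_comm]
  have h3 : N * e + N * f + u - (N * f + w) = N * e + (u - w) := by ring
  simp only [tileEnc, shift2, Prod.mk_add_mk, h3]
  simp only [encL, h1, h2, add_assoc, add_sub_assoc]
  rfl

theorem encE_congr (hN : 0 < Nf i) (r : ℕ) (h : ∀ m ∈ boxR (2 * r + 2), θ m = θ' m) (m : ℤ × ℤ)
    (hm : m ∈ boxR r) : encE M δ Nf i θ m = encE M δ Nf i θ' m := by
  have hN' : (0 : ℤ) < Nf i := by exact_mod_cast hN
  rw [mem_boxR] at hm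
  obtain ⟨u, w⟩ := m
  simp only at hm
  have b1 := ediv_bounds hN' (r := r) (by omega) hm.1.1 hm.1.2
  have b2 := ediv_bounds hN' (r := r) (by omega) hm.2.1 hm.2.2
  have b3 := ediv_bounds hN' (r := r) (by omega) b2.1 b2.2
  have b4 := ediv_bounds hN' (r := 2 * r) (x := u / Nf i - w / Nf i) (by omega)
    (by omega) (by omega)
  have key : ∀ a b : ℤ, -(2 * r + 2) ≤ a → a ≤ 2 * r + 2 → -(2 * r + 2) ≤ b → b ≤ 2 * r + 2 →
      θ (a, b) = θ' (a, b) := fun a b h1 h2 h3 h4 => h _ (by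
    rw [mem_boxR]; push_cast; exact ⟨⟨h1, h2⟩, h3, h4⟩)
  simp only [encE, raw, tileEnc, encL]
  generalize hA : (u / (Nf i : ℤ) - w / Nf i) / Nf i = A at b4
  generalize hB : (w / (Nf i : ℤ)) / Nf i = B at b3
  rw [key A B, key (A - 1) B, key (A - 1) (B - 1), key A (B + 1)] <;> omega

theorem theta_le (hM : M.Computes φ Nf) (hθ : θ ∈ Theta φ δ i) (m : ℤ × ℤ) : θ m ≤ Nf i := by
  obtain ⟨A, B⟩ := m
  obtain ⟨h1, h2⟩ := hθ A (B - 1)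
  rw [sub_add_cancel] at h1 h2
  have h3 : φ i (θ (A, B - 1)) (θ (A - 1, B - 1 - 1)) (if δ then 0 else θ (A, B)) ≠ 0 := by
    rwa [h1]
  rw [← h1, ← (hM.complete _ _ _ _ h3).2]
  exact hM.space _ _ _ _ h3 _ (by have := hM.pos i; omega) _

theorem encE_ple (hM : M.Computes φ Nf) (hNf : ∀ i, i ≤ Nf i) (hθ : θ ∈ Theta φ δ i)
    (hθ' : θ' ∈ Theta φ δ i') :
    patLE2 (encE M δ Nf i θ) (encE M δ Nf i' θ') ↔ i = i' ∧ patLE2 θ θ' := by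
  constructor
  · intro h
    rw [patLE2_iff_box] at h
    have hN : (0 : ℤ) < Nf i := by exact_mod_cast hM.pos i
    have hN' : (0 : ℤ) < Nf i' := by exact_mod_cast hM.pos i'
    have hle : (i : ℤ) ≤ Nf i := by exact_mod_cast hNf i
    have hle' : (i' : ℤ) ≤ Nf i' := by exact_mod_cast hNf i'
    have ht : ∀ m, (θ m : ℤ) ≤ Nf i := fun m => by exact_mod_cast theta_le hM hθ m
    have ht' : ∀ m, (θ' m : ℤ) ≤ Nf i' := fun m => by exact_mod_cast theta_le hM hθ' m
    have key : ∀ r : ℕ, i = i' ∧ ∃ n, ∀ m ∈ boxR r, θ' (n + m) = θ m := by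
      intro r
      obtain ⟨n, hn⟩ := h (Nf i * (Nf i * (2 * r + 1)) + Nf i + Nf i')
      obtain ⟨n1, n2⟩ := n
      have hn' : ∀ a b : ℤ, |a| ≤ Nf i * (Nf i * (2 * r + 1)) + Nf i + Nf i' →
          |b| ≤ Nf i * (Nf i * (2 * r + 1)) + Nf i + Nf i' →
          encE M δ Nf i' θ' (n1 + a, n2 + b) = encE M δ Nf i θ (a, b) := fun a b h1 h2 => by
        rw [abs_le] at h1 h2
        exact hn (a, b) (by rw [mem_boxR]; push_cast; exact ⟨h1, h2⟩)
      clear hn h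
      unfold encE at hn'
      obtain ⟨N, hNe⟩ : ∃ N : ℤ, N = Nf i := ⟨_, rfl⟩
      obtain ⟨N', hNe'⟩ : ∃ N' : ℤ, N' = Nf i' := ⟨_, rfl⟩
      simp only [← hNe, ← hNe'] at *
      have hpos : 0 ≤ N * (N * (2 * r + 1)) := by positivity
      have hc : ∀ a, |a| ≤ N + N' → ((n1 + a) % N' = 0 ↔ a % N = 0) := fun a ha => by
        have := congrArg Raw.cF (hn' a 0 (by omega) (by simp; omega))
        simpa [raw] using this
      have hr : ∀ a, |a| ≤ N + N' → ((n2 + a) % N' = 0 ↔ a % N = 0) := fun a ha => by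
        have := congrArg Raw.rF (hn' 0 a (by simp; omega) (by omega))
        simpa [raw] using this
      simp only [← Int.dvd_iff_emod_eq_zero] at hc hr
      have d1 : N' ∣ n1 := by simpa using (hc 0 (by simp; omega)).2 (dvd_zero _)
      have d2 : N' ∣ n2 := by simpa using (hr 0 (by simp; omega)).2 (dvd_zero _)
      have hNN : N = N' := by
        refine Int.dvd_antisymm hN.le hN'.le ?_ ?_
        · exact (hc N' (by rw [abs_of_pos hN']; omega)).1 (dvd_add d1 (dvd_refl _))
        · have := (hc N (by rw [abs_of_pos hN]; omega)).2 (dvd_refl _)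
          exact (Int.dvd_add_right d1).1 this
      subst hNN
      obtain ⟨a, rfl⟩ := d1
      obtain ⟨b, rfl⟩ := d2
      have hl : ∀ u w : ℤ, |u| ≤ N * (2 * r + 1) → |w| ≤ N * (2 * r + 1) →
          encL M δ N i' θ' (a - b + (u - w)) (b + w) = encL M δ N i θ (u - w) w := by
        intro u w hu hw
        have hmul : ∀ x : ℤ, |x| ≤ N * (2 * r + 1) →
            |N * x| ≤ N * (N * (2 * r + 1)) + N + N := fun x hx => by
          rw [abs_mul, abs_of_pos hN]
          nlinarith
        have := congrArg Raw.l (hn' (N * u) (N * w) (hmul u hu) (hmul w hw))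
        simp only [raw, ← mul_add, tileEnc, Int.mul_ediv_cancel_left _ hN.ne'] at this
        rwa [show a + u - (b + w) = a - b + (u - w) by ring] at this
      have h00 := hl 0 0 (by simp; positivity) (by simp; positivity)
      have d2 : N ∣ b := by
        have := congrArg Letter.vF h00
        rw [Int.dvd_iff_emod_eq_zero]
        simpa [encL] using this
      have d1 : N ∣ a - b := by
        have := congrArg Letter.jF h00
        rw [Int.dvd_iff_emod_eq_zero]
        simpa [encL] using this
      obtain ⟨b, rfl⟩ := d2
      obtain ⟨a', ha'⟩ := d1
      rw [ha'] at hl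
      have h1 : ∀ a x : ℤ, (N * a + x) % N = x % N := fun a x => by simp
      have h2 : ∀ a x : ℤ, (N * a + x) / N = a + x / N := fun a x => by
        rw [add_comm, Int.add_mul_ediv_left _ _ hN.ne', add_comm]
      have hmain : ∀ A B j : ℤ, |A| ≤ r → |B| ≤ r → 0 ≤ j → j < N →
          (j < i' ↔ j < i) ∧ (j < θ' (a' + A, b + B) ↔ j < θ (A, B)) := by
        intro A B j hA hB h0 h3
        rw [abs_le] at hA hB
        have := hl (N * A + j + N * B) (N * B) (by rw [abs_le]; constructor <;> nlinarith)
          (by rw [abs_le]; constructor <;> nlinarith)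
        rw [add_sub_cancel_right] at this
        have e1 := congrArg Letter.idx this
        have e2 := congrArg Letter.p this
        simp only [encL, h1, h2, Int.mul_ediv_cancel_left _ hN.ne', decide_eq_decide,
          Int.emod_eq_of_lt h0 h3, Int.ediv_eq_zero_of_lt h0 h3, add_zero] at e1 e2
        exact ⟨e1, e2⟩
      have hword : ∀ x y : ℕ, (x : ℤ) ≤ N → (y : ℤ) ≤ N →
          (∀ j : ℤ, 0 ≤ j → j < N → (j < x ↔ j < y)) → x = y := by
        intro x y hx hy h
        rcases lt_trichotomy x y with hxy | hxy | hxy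
        · have := h x (by omega) (by omega); omega
        · exact hxy
        · have := h y (by omega) (by omega); omega
      refine ⟨(hword _ _ hle' hle fun j h0 h3 => (hmain 0 0 j (by simp) (by simp) h0 h3).1).symm,
        (a', b), ?_⟩
      rintro ⟨A, B⟩ hm
      rw [mem_boxR] at hm
      exact hword _ _ (ht' _) (ht _) fun j h0 h3 =>
        (hmain A B j (abs_le.2 hm.1) (abs_le.2 hm.2) h0 h3).2
    exact ⟨(key 0).1, patLE2_iff_box.2 fun r => (key r).2⟩
  · rintro ⟨rfl, h⟩
    refine ple_map_of_local (fun r => ⟨2 * r + 2, fun n hn => ?_⟩) h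
    obtain ⟨k, hk⟩ := encE_shift (M := M) (δ := δ) (θ := θ') (hM.pos i) n.1 n.2
    refine ⟨k, fun m hm => ?_⟩
    rw [← encE_congr (hM.pos i) r hn m hm]
    exact (congrFun hk m).symm

end EncOrder

/-- The union of the subshifts encoded by the accepted arrays of a machine. -/
theorem exists_union_of_machine {St κ : Type} [Finite St] [Finite κ] (M : Mach St κ) (δ : Bool)
    {φ : ℕ → ℕ → ℕ → ℕ → ℕ} {Nf : ℕ → ℕ} (hM : M.Computes φ Nf)
    (hφ : δ = false → ∀ i p q α, φ i p q α ≠ 0 → φ i p q α = α) (hNf : ∀ i, i ≤ Nf i)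
    (Xs : ℕ → Set (ℤ × ℤ → ℕ)) (hcnt : ∀ i, (Xs i).Countable)
    (g : ∀ i, SubPt (Xs i) → ℤ × ℤ → ℕ) (hg : ∀ i x, g i x ∈ Theta φ δ i)
    (hord : ∀ i x y, patLE2 (g i x) (g i y) ↔ patLE2 x.1 y.1)
    (hsurj : ∀ i, ∀ θ ∈ Theta φ δ i, ∃ x n, θ = shift2 n (g i x)) :
    ∃ (S : Type) (_ : Fintype S) (X : Set (ℤ × ℤ → S)),
      IsSFT2 X ∧ X.Countable ∧
      (∃ (P' : Type) (instP : PartialOrder P'),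
        letI := instP
        (∀ c : Fin 5 → P', ¬ StrictMono c) ∧
        Nonempty (SP X ≃o (P' ⊕ (Σ i : ℕ, SP (Xs i))))) ∧
      (δ = true → DetInDir (1, 1) X) := by
  set X := winSet (RawOK Letter.vF Letter.vL (LetterOK M δ)) with hX
  set Z := {x | x ∈ X ∧ Degen x} with hZ
  have hpos : ∀ i, (0 : ℤ) < Nf i := fun i => by exact_mod_cast hM.pos i
  have hcov : ∀ y ∈ X, y ∈ Z ∨ ∃ i x n, y = shift2 n (encE M δ Nf i (g i x)) := by
    intro y hy
    by_cases hd : Degen y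
    · exact Or.inl ⟨hy, hd⟩
    · right
      obtain ⟨i, θ, hθ, n, rfl⟩ := encE_decode hM hφ hy hd
      obtain ⟨x, k, rfl⟩ := hsurj i θ hθ
      obtain ⟨m, hm⟩ := encE_shift (M := M) (δ := δ) (θ := g i x) (hM.pos i) k.1 k.2
      exact ⟨i, x, m + n, by rw [hm, shift2_shift2]⟩
  refine ⟨Raw (Letter St κ), Fintype.ofFinite _, X, isSFT2_winSet _, ?_,
    ⟨SP Z, inferInstance, no_chain_of_tame fun y hy => hy.2.tame hy.1, ?_⟩, ?_⟩
  · have hE : ((⋃ i, ⋃ n : ℤ × ℤ, Set.range fun x => shift2 n (encE M δ Nf i (g i x))) :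
        Set (ℤ × ℤ → Raw (Letter St κ))).Countable := by
      refine Set.countable_iUnion fun i => Set.countable_iUnion fun n => ?_
      have : Countable (SubPt (Xs i)) := (hcnt i).to_subtype
      exact Set.countable_range _
    refine (countable_tame.union hE).mono fun y hy => ?_
    rcases hcov y hy with h | ⟨i, x, n, rfl⟩
    · exact Or.inl (h.2.tame h.1)
    · refine Or.inr ?_
      simp only [Set.mem_iUnion]
      exact ⟨i, n, x, rfl⟩
  · refine sp_iso_of_decomposition (fun i x => encE M δ Nf i (g i x))
      (fun i x => encE_mem hM (hg i x)) (fun _ h => h.1) ?_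
      (fun z hz i x => hz.2.not_ple_raw (hpos i) _) hcov
    intro i j x y
    rw [encE_ple hM hNf (hg i x) (hg j y)]
    constructor
    · rintro ⟨rfl, h⟩
      exact ⟨rfl, (hord _ _ _).1 h⟩
    · rintro ⟨rfl, h⟩
      exact ⟨rfl, (hord _ _ _).2 h⟩
  · intro hδ
    exact detInDir_winSet (RawOK.det fun a b c d d' h₁ h₂ => LetterOK.det hδ h₁ h₂)

/-! ### Loop programs on registers -/

/-- Structured register programs. -/
inductive Prog : Type
  | skip : Prog
  | inc : ℕ → Prog
  | dec : ℕ → Prog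
  | seq : Prog → Prog → Prog
  | loop : ℕ → Prog → Prog

namespace Prog

/-- The next continuation and the register operations, depending on the nonzero registers. -/
def ctl : List Prog → (ℕ → Bool) → List Prog × (ℕ → SignType)
  | [], _ => ([], fun _ => 0)
  | skip :: K, _ => (K, fun _ => 0)
  | inc k :: K, _ => (K, fun j => if j = k then 1 else 0)
  | dec k :: K, _ => (K, fun j => if j = k then -1 else 0)
  | seq a b :: K, _ => (a :: b :: K, fun _ => 0)
  | loop k p :: K, τ => (if τ k then p :: loop k p :: K else K, fun _ => 0)

/-- One step of the execution. -/
def stepP (c : List Prog × (ℕ → ℕ)) : List Prog × (ℕ → ℕ) :=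
  ((ctl c.1 fun k => decide (0 < c.2 k)).1,
    fun k => opApply ((ctl c.1 fun k => decide (0 < c.2 k)).2 k) (c.2 k))

/-- Execution of a program changes the registers from `σ` to `σ'`. -/
def Runs (p : Prog) (σ σ' : ℕ → ℕ) : Prop := ∀ K, ∃ t, stepP^[t] (p :: K, σ) = (K, σ')

theorem runs_skip (σ : ℕ → ℕ) : Runs skip σ σ := fun K => ⟨1, by simp [stepP, ctl, opApply]⟩

theorem runs_inc (k : ℕ) (σ : ℕ → ℕ) : Runs (inc k) σ (Function.update σ k (σ k + 1)) := fun K =>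
  ⟨1, by
    simp only [Function.iterate_one, stepP, ctl, Prod.mk.injEq, true_and]
    funext j
    by_cases h : j = k
    · subst h; simp [opApply]
    · simp [h, opApply]⟩

theorem runs_dec (k : ℕ) (σ : ℕ → ℕ) : Runs (dec k) σ (Function.update σ k (σ k - 1)) := fun K =>
  ⟨1, by
    simp only [Function.iterate_one, stepP, ctl, Prod.mk.injEq, true_and]
    funext j
    by_cases h : j = k
    · subst h; simp [opApply]
    · simp [h, opApply]⟩

theorem Runs.seq {p q : Prog} {σ σ' σ'' : ℕ → ℕ} (h : Runs p σ σ') (h' : Runs q σ' σ'') :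
    Runs (seq p q) σ σ'' := fun K => by
  obtain ⟨t, ht⟩ := h (q :: K)
  obtain ⟨t', ht'⟩ := h' K
  refine ⟨t' + (t + 1), ?_⟩
  rw [Function.iterate_add_apply, Function.iterate_succ_apply]
  have : stepP (Prog.seq p q :: K, σ) = (p :: q :: K, σ) := by simp [stepP, ctl, opApply]
  rw [this, ht, ht']

theorem runs_loop {p : Prog} {k : ℕ} (n : ℕ) (s : ℕ → ℕ → ℕ)
    (h : ∀ j < n, s j k ≠ 0 ∧ Runs p (s j) (s (j + 1))) (h0 : s n k = 0) :
    Runs (loop k p) (s 0) (s n) := by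
  induction n generalizing s with
  | zero => exact fun K => ⟨1, by simp [stepP, ctl, opApply, h0]⟩
  | succ n ih =>
    intro K
    obtain ⟨t, ht⟩ := ih (fun j => s (j + 1)) (fun j hj => h (j + 1) (by omega)) h0 K
    obtain ⟨h1, h2⟩ := h 0 (by omega)
    obtain ⟨t', ht'⟩ := h2 (loop k p :: K)
    refine ⟨t + (t' + 1), ?_⟩
    rw [Function.iterate_add_apply, Function.iterate_succ_apply]
    have : stepP (loop k p :: K, s 0) = (p :: loop k p :: K, s 0) := by
      simp [stepP, ctl, opApply, Nat.pos_of_ne_zero h1]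
    rw [this, ht', ht]

theorem runs_clear (k : ℕ) (σ : ℕ → ℕ) : Runs (loop k (dec k)) σ (Function.update σ k 0) := by
  have := runs_loop (p := dec k) (k := k) (σ k) (fun j => Function.update σ k (σ k - j))
    (fun j hj => ⟨by simp; omega, by
      have := runs_dec k (Function.update σ k (σ k - j))
      simpa [Nat.sub_sub] using this⟩) (by simp)
  simpa using this

theorem runs_move {a b : ℕ} (hab : a ≠ b) (σ : ℕ → ℕ) :
    Runs (loop a (seq (dec a) (inc b))) σ
      (Function.update (Function.update σ b (σ b + σ a)) a 0) := by
  have := runs_loop (p := seq (dec a) (inc b)) (k := a) (σ a)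
    (fun j => Function.update (Function.update σ b (σ b + j)) a (σ a - j))
    (fun j hj => ⟨by simp; omega, by
      refine Runs.seq (runs_dec a _) ?_
      have := runs_inc b (Function.update (Function.update σ b (σ b + j)) a (σ a - j - 1))
      convert this using 1
      · simp
      · funext m
        by_cases h1 : m = a <;> by_cases h2 : m = b <;>
          simp_all [Function.update_apply, Nat.sub_sub] <;> omega⟩) (by simp)
  simpa using this

/-- Add `a` to `b` with the help of the empty register `t`. -/
theorem exists_copy {a b t : ℕ} (hab : a ≠ b) (hat : a ≠ t) (hbt : b ≠ t) :
    ∃ P, ∀ σ, σ t = 0 → Runs P σ (Function.update σ b (σ b + σ a)) := by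
  refine ⟨seq (loop a (seq (dec a) (seq (inc b) (inc t)))) (loop t (seq (dec t) (inc a))),
    fun σ h0 => ?_⟩
  have := runs_loop (p := seq (dec a) (seq (inc b) (inc t))) (k := a) (σ a)
    (fun j => Function.update (Function.update (Function.update σ b (σ b + j)) a (σ a - j)) t j)
    (fun j hj => ⟨by simp [hat]; omega, by
      refine Runs.seq (runs_dec a _) (Runs.seq (runs_inc b _) ?_)
      convert runs_inc t _ using 1
      funext m
      simp only [Function.update_apply]
      split_ifs <;> simp_all <;> omega⟩)
    (by simp [hat])
  refine Runs.seq (σ' := Function.update (Function.update (Function.update σ b (σ b + σ a)) a 0)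
    t (σ a)) ?_ ?_
  · convert this using 1
    · funext m
      simp only [Function.update_apply]
      split_ifs <;> simp_all
    · simp
  · convert runs_move hat.symm _ using 1
    funext m
    simp only [Function.update_apply]
    split_ifs <;> simp_all

theorem exists_seq (n : ℕ) (R : ℕ → (ℕ → ℕ) → (ℕ → ℕ) → Prop)
    (h : ∀ j < n, ∃ P, ∀ σ σ', R j σ σ' → Runs P σ σ') :
    ∃ P, ∀ s : ℕ → ℕ → ℕ, (∀ j < n, R j (s j) (s (j + 1))) → Runs P (s 0) (s n) := by
  induction n with
  | zero => exact ⟨skip, fun s _ => runs_skip _⟩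
  | succ n ih =>
    obtain ⟨P, hP⟩ := ih fun j hj => h j (by omega)
    obtain ⟨Q, hQ⟩ := h n (by omega)
    exact ⟨seq P Q, fun s hs => (hP s fun j hj => hs j (by omega)).seq (hQ _ _ (hs n (by omega)))⟩

/-- The partial function `f` can be computed by programs, with any choice of the input and output
registers and of the range of the scratch registers. -/
def Comp {n : ℕ} (f : List.Vector ℕ n →. ℕ) : Prop :=
  ∀ (ins : Fin n → ℕ) (out base : ℕ), (∀ j, ins j < base) → out < base → (∀ j, ins j ≠ out) →
    ∃ P, ∀ σ : ℕ → ℕ, (∀ k ≥ base, σ k = 0) → σ out = 0 →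
      ∀ y ∈ f (List.Vector.ofFn fun j => σ (ins j)), Runs P σ (Function.update σ out y)

theorem comp_zero : Comp (n := 0) (fun _ => Part.some 0) := by
  intro ins out base _ _ _
  refine ⟨skip, fun σ _ h0 y hy => ?_⟩
  rw [Part.mem_some_iff] at hy
  rw [hy, ← h0, Function.update_eq_self]
  exact runs_skip σ

theorem comp_get {n : ℕ} (i : Fin n) : Comp fun v : List.Vector ℕ n => Part.some (v.get i) := by
  intro ins out base h1 h2 h3
  obtain ⟨P, hP⟩ := exists_copy (a := ins i) (b := out) (t := base) (h3 i) (h1 i).ne h2.ne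
  refine ⟨P, fun σ hσ h0 y hy => ?_⟩
  have := hP σ (hσ _ le_rfl)
  rw [Part.mem_some_iff, List.Vector.get_ofFn] at hy
  rwa [h0, zero_add, ← hy] at this

theorem comp_succ : Comp fun v : List.Vector ℕ 1 => Part.some (Nat.succ v.head) := by
  intro ins out base h1 h2 h3
  obtain ⟨P, hP⟩ := exists_copy (a := ins 0) (b := out) (t := base) (h3 0) (h1 0).ne h2.ne
  refine ⟨seq P (inc out), fun σ hσ h0 y hy => ?_⟩
  have h4 := hP σ (hσ _ le_rfl)
  rw [Part.mem_some_iff, List.Vector.ofFn, List.Vector.head_cons] at hy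
  rw [h0, zero_add] at h4
  have h5 := runs_inc out (Function.update σ out (σ (ins 0)))
  rw [Function.update_self, Function.update_idem, ← Nat.succ_eq_add_one, ← hy] at h5
  exact h4.seq h5

theorem comp_comp {m n : ℕ} {f : List.Vector ℕ n →. ℕ} {g : Fin n → List.Vector ℕ m →. ℕ}
    {h : List.Vector ℕ m →. ℕ} (hf : Comp f) (hg : ∀ i, Comp (g i))
    (hh : ∀ v, ∀ y ∈ h v, ∃ w : Fin n → ℕ, (∀ i, w i ∈ g i v) ∧ y ∈ f (List.Vector.ofFn w)) :
    Comp h := by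
  intro ins out base h1 h2 h3
  obtain ⟨F, hF⟩ := hf (fun j => base + j) out (base + n) (fun j => by omega) (by omega)
    (fun j => by omega)
  obtain ⟨G, hG⟩ := exists_seq n (fun j τ τ' => ∃ hj : j < n, (∀ k ≥ base + n, τ k = 0) ∧
      τ (base + j) = 0 ∧ ∃ y ∈ g ⟨j, hj⟩ (List.Vector.ofFn fun j => τ (ins j)),
        τ' = Function.update τ (base + j) y) (fun j hj => by
    obtain ⟨P, hP⟩ := hg ⟨j, hj⟩ ins (base + j) (base + n) (fun i => by have := h1 i; omega)
      (by omega) (fun i => by have := h1 i; omega)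
    refine ⟨P, ?_⟩
    rintro τ τ' ⟨_, h4, h5, y, hy, rfl⟩
    exact hP τ h4 h5 y hy)
  obtain ⟨C, hC⟩ := exists_seq n (fun j τ τ' => τ' = Function.update τ (base + j) 0)
    (fun j hj => ⟨loop (base + j) (dec (base + j)), by rintro τ _ rfl; exact runs_clear _ _⟩)
  refine ⟨seq G (seq F C), fun σ hσ h0 y hy => ?_⟩
  obtain ⟨w, hw, hy⟩ := hh _ _ hy
  let w' : ℕ → ℕ := fun k => if hk : k < n then w ⟨k, hk⟩ else 0
  have hG' := hG (fun j k => if base ≤ k ∧ k < base + j then w' (k - base) else σ k) (by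
    intro j hj
    refine ⟨hj, ?_, ?_, w ⟨j, hj⟩, ?_, ?_⟩
    · intro k hk
      rw [if_neg (by omega), hσ _ (by omega)]
    · rw [if_neg (by omega), hσ _ (by omega)]
    · convert hw ⟨j, hj⟩ using 4 with i
      have := h1 i
      rw [if_neg (by omega)]
    · funext k
      simp only [Function.update_apply]
      by_cases hk : k = base + j
      · subst hk
        rw [if_pos (by omega), if_pos rfl, Nat.add_sub_cancel_left]
        simp [w', hj]
      · rw [if_neg hk]
        have : (base ≤ k ∧ k < base + (j + 1)) ↔ (base ≤ k ∧ k < base + j) := by omega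
        simp only [this])
  have hF' := hF (fun k => if base ≤ k ∧ k < base + n then w' (k - base) else σ k)
    (fun k hk => by rw [if_neg (by omega), hσ _ (by omega)]) (by rw [if_neg (by omega), h0]) y (by
      convert hy using 3
      funext j
      rw [if_pos (by omega), Nat.add_sub_cancel_left]
      simp [w'])
  have hC' := hC (fun j k => if k = out then y else if base + j ≤ k ∧ k < base + n then
      w' (k - base) else σ k) (by
    intro j hj
    funext k
    simp only [Function.update_apply]
    by_cases hk : k = base + j
    · subst hk
      rw [if_pos rfl, if_neg (by omega), if_neg (by omega), hσ _ (by omega)]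
    · rw [if_neg hk]
      have : (base + (j + 1) ≤ k ∧ k < base + n) ↔ (base + j ≤ k ∧ k < base + n) := by omega
      simp only [this])
  refine Runs.seq ?_ (Runs.seq hF' ?_)
  · convert hG' using 1
    funext k
    rw [if_neg (by omega)]
  · convert hC' using 1 <;> funext k <;> simp only [Function.update_apply] <;> split_ifs <;>
      first | rfl | omega

end Prog

end UnionSFT

namespace UnionSFT
namespace Prog

/-- The registers `base`, …, `base + 3` of `σ` are replaced. -/
def put4 (σ : ℕ → ℕ) (base c y a t : ℕ) : ℕ → ℕ := fun k =>
  if k = base then c else if k = base + 1 then y else if k = base + 2 then a else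
    if k = base + 3 then t else σ k

theorem update_put4_0 (σ : ℕ → ℕ) (base c y a t z : ℕ) :
    Function.update (put4 σ base c y a t) base z = put4 σ base z y a t := by
  funext k; simp only [Function.update_apply, put4]; split_ifs <;> rfl

theorem update_put4_1 (σ : ℕ → ℕ) (base c y a t z : ℕ) :
    Function.update (put4 σ base c y a t) (base + 1) z = put4 σ base c z a t := by
  funext k; simp only [Function.update_apply, put4]; split_ifs <;> first | rfl | omega

theorem update_put4_2 (σ : ℕ → ℕ) (base c y a t z : ℕ) :
    Function.update (put4 σ base c y a t) (base + 2) z = put4 σ base c y z t := by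
  funext k; simp only [Function.update_apply, put4]; split_ifs <;> first | rfl | omega

theorem update_put4_3 (σ : ℕ → ℕ) (base c y a t z : ℕ) :
    Function.update (put4 σ base c y a t) (base + 3) z = put4 σ base c y a z := by
  funext k; simp only [Function.update_apply, put4]; split_ifs <;> first | rfl | omega

theorem put4_0 (σ : ℕ → ℕ) (base c y a t : ℕ) : put4 σ base c y a t base = c := by simp [put4]

theorem put4_1 (σ : ℕ → ℕ) (base c y a t : ℕ) : put4 σ base c y a t (base + 1) = y := by
  simp [put4]

theorem put4_2 (σ : ℕ → ℕ) (base c y a t : ℕ) : put4 σ base c y a t (base + 2) = a := by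
  simp [put4]

theorem put4_3 (σ : ℕ → ℕ) (base c y a t : ℕ) : put4 σ base c y a t (base + 3) = t := by
  simp [put4]

theorem put4_lt (σ : ℕ → ℕ) {base k : ℕ} (c y a t : ℕ) (h : k < base) :
    put4 σ base c y a t k = σ k := by
  simp only [put4]; split_ifs <;> first | rfl | omega

theorem put4_ge (σ : ℕ → ℕ) {base k : ℕ} (c y a t : ℕ) (h : base + 4 ≤ k) :
    put4 σ base c y a t k = σ k := by
  simp only [put4]; split_ifs <;> first | rfl | omega

theorem put4_zero {σ : ℕ → ℕ} {base : ℕ} (h : ∀ k ≥ base, σ k = 0) : put4 σ base 0 0 0 0 = σ := by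
  funext k
  simp only [put4]
  split_ifs with h1 h2 h3 h4
  all_goals first | rfl | exact (h k (by omega)).symm

theorem comp_prec {n : ℕ} {f : List.Vector ℕ n → ℕ} {g : List.Vector ℕ (n + 2) → ℕ}
    (hf : Comp fun v => Part.some (f v)) (hg : Comp fun v => Part.some (g v)) :
    Comp fun v : List.Vector ℕ (n + 1) => Part.some
      (v.head.rec (f v.tail) fun y IH => g (y ::ᵥ IH ::ᵥ v.tail) : ℕ) := by
  intro ins out base h1 h2 h3
  obtain ⟨C, hC⟩ := exists_copy (a := ins 0) (b := base) (t := base + 3) (h1 0).ne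
    (by have := h1 0; omega) (by omega)
  obtain ⟨F, hF⟩ := hf (fun j => ins j.succ) (base + 2) (base + 4)
    (fun j => by have := h1 j.succ; omega) (by omega) (fun j => by have := h1 j.succ; omega)
  obtain ⟨G, hG⟩ := hg (Fin.cons (base + 1) (Fin.cons (base + 2) fun j => ins j.succ)) (base + 3)
    (base + 4) (fun j => by
      refine Fin.cases (by simp) (fun j => Fin.cases (by simp) (fun j => ?_) j) j
      have := h1 j.succ
      simp only [Fin.cons_succ]; omega) (by omega) (fun j => by
      refine Fin.cases (by simp) (fun j => Fin.cases (by simp) (fun j => ?_) j) j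
      have := h1 j.succ
      simp only [Fin.cons_succ]; omega)
  refine ⟨seq C (seq F (seq (loop base (seq (dec base) (seq G (seq (loop (base + 2) (dec (base + 2)))
    (seq (loop (base + 3) (seq (dec (base + 3)) (inc (base + 2)))) (inc (base + 1)))))))
    (seq (loop (base + 1) (dec (base + 1))) (loop (base + 2) (seq (dec (base + 2)) (inc out)))))),
    fun σ hσ h0 y hy => ?_⟩
  set v := List.Vector.ofFn fun j => σ (ins j) with hv
  rw [Part.mem_some_iff] at hy
  let r : ℕ → ℕ := fun k => k.rec (f v.tail) fun y IH => g (y ::ᵥ IH ::ᵥ v.tail)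
  have hvt : ∀ c y a t, (List.Vector.ofFn fun j : Fin n => put4 σ base c y a t (ins j.succ)) =
      v.tail := by
    intro c y a t
    rw [hv, List.Vector.ofFn, List.Vector.tail_cons]
    congr 1
    funext j
    exact put4_lt σ _ _ _ _ (h1 _)
  have hvh : v.head = σ (ins 0) := by rw [hv, List.Vector.ofFn, List.Vector.head_cons]
  set N := v.head with hN
  have e0 : Runs C σ (put4 σ base N 0 0 0) := by
    have := hC σ (hσ _ (by omega))
    rw [← hvh, ← put4_zero hσ, put4_0, zero_add, update_put4_0, put4_zero hσ] at this
    exact this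
  have e1 : Runs F (put4 σ base N 0 0 0) (put4 σ base N 0 (r 0) 0) := by
    have := hF (put4 σ base N 0 0 0) (fun k hk => by rw [put4_ge _ _ _ _ _ hk, hσ _ (by omega)])
      (put4_2 ..) _ (Part.mem_some _)
    rwa [hvt, update_put4_2] at this
  have e2 : ∀ c y, Runs G (put4 σ base c y (r y) 0) (put4 σ base c y (r y) (r (y + 1))) := by
    intro c y
    have := hG (put4 σ base c y (r y) 0) (fun k hk => by rw [put4_ge _ _ _ _ _ hk, hσ _ (by omega)])
      (put4_3 ..) _ (Part.mem_some _)
    rw [update_put4_3] at this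
    simpa only [List.Vector.ofFn, Fin.cons_zero, Fin.cons_succ, put4_1, put4_2, hvt] using this
  have e3 := runs_loop (k := base) (p := (seq (dec base) (seq G (seq (loop (base + 2) (dec (base + 2)))
    (seq (loop (base + 3) (seq (dec (base + 3)) (inc (base + 2)))) (inc (base + 1))))))) N
    (fun j => put4 σ base (N - j) j (r j) 0) (fun j hj => by
      refine ⟨by rw [put4_0]; omega, ?_⟩
      refine Runs.seq (σ' := put4 σ base (N - (j + 1)) j (r j) 0) ?_ (Runs.seq (e2 _ _) (Runs.seq
        (runs_clear _ _) (Runs.seq (runs_move (by omega) _) ?_)))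
      · have := runs_dec base (put4 σ base (N - j) j (r j) 0)
        rwa [put4_0, update_put4_0, Nat.sub_sub] at this
      · have := runs_inc (base + 1) (put4 σ base (N - (j + 1)) j (r (j + 1)) 0)
        rw [put4_1, update_put4_1] at this
        simpa only [update_put4_2, update_put4_3, put4_2, put4_3, zero_add] using this)
    (by rw [put4_0]; omega)
  refine e0.seq (e1.seq (Runs.seq ?_ (Runs.seq (runs_clear _ (put4 σ base 0 N (r N) 0)) ?_)))
  · simpa only [Nat.sub_zero, Nat.sub_self] using e3
  · have := runs_move (a := base + 2) (b := out) (by omega) (put4 σ base 0 0 (r N) 0)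
    rw [update_put4_1]
    convert this using 1
    rw [put4_2, put4_lt _ _ _ _ _ h2, h0, zero_add, hy]
    funext k
    simp only [Function.update_apply, put4]
    split_ifs <;> first | rfl | exact hσ _ (by omega) | omega

theorem comp_rfind {n : ℕ} {f : List.Vector ℕ (n + 1) → ℕ} (hf : Comp fun v => Part.some (f v)) :
    Comp fun v : List.Vector ℕ n => Nat.rfind fun y => Part.some (decide (f (y ::ᵥ v) = 0)) := by
  intro ins out base h1 h2 h3
  obtain ⟨F, hF⟩ := hf (Fin.cons base ins) (base + 1) (base + 4) (fun j => by
      refine Fin.cases (by simp) (fun j => ?_) j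
      have := h1 j
      simp only [Fin.cons_succ]; omega) (by omega) (fun j => by
      refine Fin.cases (by simp) (fun j => ?_) j
      have := h1 j
      simp only [Fin.cons_succ]; omega)
  refine ⟨seq F (seq (loop (base + 1) (seq (loop (base + 1) (dec (base + 1))) (seq (inc base) F)))
    (loop base (seq (dec base) (inc out)))), fun σ hσ h0 N hN => ?_⟩
  set v := List.Vector.ofFn fun j => σ (ins j) with hv
  obtain ⟨hN, hlt⟩ := Nat.mem_rfind.1 hN
  replace hN : f (N ::ᵥ v) = 0 := of_decide_eq_true (Part.mem_some_iff.1 hN).symm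
  replace hlt : ∀ m < N, f (m ::ᵥ v) ≠ 0 := fun m hm =>
    of_decide_eq_false (Part.mem_some_iff.1 (hlt hm)).symm
  have e : ∀ y, Runs F (put4 σ base y 0 0 0) (put4 σ base y (f (y ::ᵥ v)) 0 0) := by
    intro y
    have := hF (put4 σ base y 0 0 0) (fun k hk => by rw [put4_ge _ _ _ _ _ hk, hσ _ (by omega)])
      (put4_1 ..) _ (Part.mem_some _)
    rw [update_put4_1] at this
    convert this using 4
    rw [List.Vector.ofFn]
    simp only [Fin.cons_zero, Fin.cons_succ, put4_0]
    congr 2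
    rw [hv]
    congr 1
    funext j
    exact (put4_lt _ _ _ _ _ (h1 j)).symm
  have e3 := runs_loop (k := base + 1)
    (p := seq (loop (base + 1) (dec (base + 1))) (seq (inc base) F)) N
    (fun j => put4 σ base j (f (j ::ᵥ v)) 0 0) (fun j hj => by
      refine ⟨by rw [put4_1]; exact hlt j hj, ?_⟩
      refine Runs.seq (runs_clear _ _) (Runs.seq (runs_inc _ _) ?_)
      simpa only [update_put4_1, put4_0, update_put4_0] using e (j + 1))
    (by rw [put4_1]; exact hN)
  have e0 := e 0
  rw [put4_zero hσ] at e0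
  refine e0.seq (e3.seq ?_)
  have := runs_move (a := base) (b := out) (by omega) (put4 σ base N (f (N ::ᵥ v)) 0 0)
  convert this using 1
  rw [put4_0, put4_lt _ _ _ _ _ h2, h0, zero_add, hN]
  funext k
  simp only [Function.update_apply, put4]
  split_ifs <;> first | rfl | exact hσ _ (by omega) | omega

theorem comp_of_primrec' {n : ℕ} {f : List.Vector ℕ n → ℕ} (hf : Nat.Primrec' f) :
    Comp fun v => Part.some (f v) := by
  induction hf with
  | zero => exact comp_zero
  | succ => exact comp_succ
  | get i => exact comp_get i
  | comp g _ _ ihf ihg =>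
    refine comp_comp ihf ihg fun v y hy => ⟨fun i => g i v, fun i => Part.mem_some _, hy⟩
  | prec _ _ ihf ihg => exact comp_prec ihf ihg

theorem get_mem_of_mem_mOfFn {n : ℕ} {g : Fin n → Part ℕ} {w : List.Vector ℕ n}
    (hw : w ∈ List.Vector.mOfFn g) (i : Fin n) : w.get i ∈ g i := by
  induction n with
  | zero => exact i.elim0
  | succ n ih =>
    obtain ⟨a, ha, hw⟩ := Part.mem_bind_iff.1 hw
    obtain ⟨u, hu, hw⟩ := Part.mem_bind_iff.1 hw
    obtain rfl := Part.mem_some_iff.1 hw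
    refine Fin.cases ?_ (fun i => ?_) i
    · rwa [List.Vector.get_zero, List.Vector.head_cons]
    · rw [List.Vector.get_cons_succ]
      exact ih hu i

theorem comp_of_partrec' {n : ℕ} {f : List.Vector ℕ n →. ℕ} (hf : Nat.Partrec' f) : Comp f := by
  induction hf with
  | prim hf => exact comp_of_primrec' hf
  | comp g _ _ ihf ihg =>
    refine comp_comp ihf ihg fun v y hy => ?_
    obtain ⟨w, hw, hy⟩ := Part.mem_bind_iff.1 hy
    refine ⟨w.get, get_mem_of_mem_mOfFn hw, ?_⟩
    rwa [List.Vector.ofFn_get]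
  | rfind _ ih => exact comp_rfind ih

end Prog
end UnionSFT

namespace UnionSFT
namespace Prog

theorem exists_closed (p : Prog) (K : List Prog) : ∃ R : Set (List Prog), R.Finite ∧ p :: K ∈ R ∧
    ∀ l ∈ R, ∀ τ, (ctl l τ).1 ∈ insert K R := by
  induction p generalizing K with
  | skip => exact ⟨{skip :: K}, Set.finite_singleton _, rfl, by rintro _ rfl τ; exact Or.inl rfl⟩
  | inc k => exact ⟨{inc k :: K}, Set.finite_singleton _, rfl, by rintro _ rfl τ; exact Or.inl rfl⟩
  | dec k => exact ⟨{dec k :: K}, Set.finite_singleton _, rfl, by rintro _ rfl τ; exact Or.inl rfl⟩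
  | seq a b iha ihb =>
    obtain ⟨A, hA, hA1, hA2⟩ := iha (b :: K)
    obtain ⟨B, hB, hB1, hB2⟩ := ihb K
    refine ⟨insert (seq a b :: K) (A ∪ B), (hA.union hB).insert _, Or.inl rfl, ?_⟩
    rintro l (rfl | hl | hl) τ
    · exact Or.inr (Or.inr (Or.inl hA1))
    · rcases hA2 l hl τ with h | h
      · rw [h]; exact Or.inr (Or.inr (Or.inr hB1))
      · exact Or.inr (Or.inr (Or.inl h))
    · rcases hB2 l hl τ with h | h
      · exact Or.inl h
      · exact Or.inr (Or.inr (Or.inr h))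
  | loop k p ih =>
    obtain ⟨A, hA, hA1, hA2⟩ := ih (loop k p :: K)
    refine ⟨insert (loop k p :: K) A, hA.insert _, Or.inl rfl, ?_⟩
    rintro l (rfl | hl) τ
    · simp only [ctl]
      split_ifs
      · exact Or.inr (Or.inr hA1)
      · exact Or.inl rfl
    · rcases hA2 l hl τ with h | h
      · rw [h]; exact Or.inr (Or.inl rfl)
      · exact Or.inr (Or.inr h)

theorem exists_ctl_eq (l : List Prog) :
    ∃ N, ∀ τ τ' : ℕ → Bool, (∀ k < N, τ k = τ' k) → ctl l τ = ctl l τ' := by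
  match l with
  | [] => exact ⟨0, fun τ τ' _ => rfl⟩
  | skip :: K => exact ⟨0, fun τ τ' _ => rfl⟩
  | inc k :: K => exact ⟨0, fun τ τ' _ => rfl⟩
  | dec k :: K => exact ⟨0, fun τ τ' _ => rfl⟩
  | seq a b :: K => exact ⟨0, fun τ τ' _ => rfl⟩
  | loop k p :: K => exact ⟨k + 1, fun τ τ' h => by simp only [ctl, h k (by omega)]⟩

end Prog

/-- One step of the counter automaton with transition table `tr`. -/
def dstep {St κ : Type} (tr : St → (κ → Bool) → St × (κ → SignType)) (c : St × (κ → ℕ)) :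
    St × (κ → ℕ) :=
  ((tr c.1 fun k => decide (0 < c.2 k)).1,
    fun k => opApply ((tr c.1 fun k => decide (0 < c.2 k)).2 k) (c.2 k))

open Prog in
theorem exists_device {a : ℕ} {f : List.Vector ℕ a → ℕ} (hf : Computable f) :
    ∃ (m n : ℕ) (tr : Fin m → (Fin n → Bool) → Fin m × (Fin n → SignType)) (s0 h : Fin m)
      (inp : Fin n → Option (Fin a)) (out : Fin n), (∀ τ, tr h τ = (h, fun _ => 0)) ∧
      inp out = none ∧ ∀ v, ∃ T σ, (dstep tr)^[T] (s0, fun k => (inp k).elim 0 v.get) = (h, σ) ∧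
        σ out = f v := by
  obtain ⟨P, hP⟩ := comp_of_partrec' (Nat.Partrec'.part_iff.2 hf) (fun j => (j : ℕ)) a (a + 1)
    (fun j => by omega) (by omega) (fun j => by omega)
  obtain ⟨R, hR, hPR, hcl⟩ := exists_closed P []
  replace hcl : ∀ l ∈ insert [] R, ∀ τ, (ctl l τ).1 ∈ insert [] R := by
    rintro l (rfl | hl) τ
    · exact Or.inl rfl
    · exact hcl l hl τ
  have hR' : (insert [] R).Finite := hR.insert _
  obtain ⟨N, hN, haN⟩ : ∃ N, (∀ l ∈ insert [] R, ∀ τ τ' : ℕ → Bool, (∀ k < N, τ k = τ' k) →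
      ctl l τ = ctl l τ') ∧ a < N := by
    choose N hN using exists_ctl_eq
    obtain ⟨B, hB⟩ := (hR'.image N).bddAbove
    refine ⟨max B (a + 1), fun l hl τ τ' h => hN l τ τ' fun k hk => h k ?_, by omega⟩
    have := hB (Set.mem_image_of_mem N hl)
    omega
  have := hR'.to_subtype
  obtain ⟨m, ⟨e⟩⟩ := Finite.exists_equiv_fin ↥(insert [] R)
  let ext : (Fin N → Bool) → ℕ → Bool := fun τ k => if hk : k < N then τ ⟨k, hk⟩ else false
  let tr : Fin m → (Fin N → Bool) → Fin m × (Fin N → SignType) := fun s τ =>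
    (e ⟨(ctl (e.symm s).1 (ext τ)).1, hcl _ (e.symm s).2 _⟩,
      fun k => (ctl (e.symm s).1 (ext τ)).2 k)
  have hstep : ∀ l (hl : l ∈ insert [] R) (σ : ℕ → ℕ), dstep tr (e ⟨l, hl⟩, fun k : Fin N => σ k) =
      (e ⟨(stepP (l, σ)).1, hcl l hl _⟩, fun k : Fin N => (stepP (l, σ)).2 k) := by
    intro l hl σ
    have h1 : ctl l (ext fun k => decide (0 < σ k)) = ctl l fun k => decide (0 < σ k) :=
      hN l hl _ _ fun k hk => by simp [ext, hk]
    simp only [dstep, tr, Equiv.symm_apply_apply, stepP, h1]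
  have hiter : ∀ t l (hl : l ∈ insert [] R) (σ : ℕ → ℕ), ∃ hl',
      (dstep tr)^[t] (e ⟨l, hl⟩, fun k : Fin N => σ k) =
      (e ⟨(stepP^[t] (l, σ)).1, hl'⟩, fun k : Fin N => (stepP^[t] (l, σ)).2 k) := by
    intro t
    induction t with
    | zero => exact fun l hl σ => ⟨hl, rfl⟩
    | succ t ih =>
      intro l hl σ
      obtain ⟨hl', h⟩ := ih (stepP (l, σ)).1 (hcl l hl _) (stepP (l, σ)).2
      refine ⟨hl', ?_⟩
      rw [Function.iterate_succ_apply, hstep]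
      exact h
  refine ⟨m, N, tr, e ⟨[P], Or.inr hPR⟩, e ⟨[], Or.inl rfl⟩,
    fun k => if hk : (k : ℕ) < a then some ⟨k, hk⟩ else none, ⟨a, haN⟩, ?_, ?_, ?_⟩
  · intro τ
    simp [tr, ctl]
  · simp
  · intro v
    let σ : ℕ → ℕ := fun k => if hk : k < a then v.get ⟨k, hk⟩ else 0
    have h1 := hP σ (fun k hk => dif_neg (by omega)) (dif_neg (by omega)) (f v) (by
      have : (List.Vector.ofFn fun j : Fin a => σ j) = v := by
        ext j
        simp [σ]
      rw [this]
      exact Part.mem_some _)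
    obtain ⟨T, hT⟩ := h1 []
    obtain ⟨hl', h2⟩ := hiter T [P] (Or.inr hPR) σ
    refine ⟨T, fun k => (Function.update σ a (f v)) k, ?_, by simp⟩
    have h3 : (fun k : Fin N => (if hk : (k : ℕ) < a then some (⟨k, hk⟩ : Fin a) else none).elim 0
        v.get) = fun k : Fin N => σ k := by
      funext k
      by_cases hk : (k : ℕ) < a <;> simp [σ, hk]
    rw [h3, h2]
    simp only [hT]

theorem opApply_le (o : SignType) (n : ℕ) : opApply o n ≤ n + 1 := by
  unfold opApply
  split_ifs <;> omega

/-- A counter automaton with `a` inputs and a halting state. -/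
structure Dev (a : ℕ) where
  m : ℕ
  n : ℕ
  tr : Fin m → (Fin n → Bool) → Fin m × (Fin n → SignType)
  s0 : Fin m
  h : Fin m
  inp : Fin n → Option (Fin a)
  out : Fin n
  halt : ∀ τ, tr h τ = (h, fun _ => 0)
  inp_out : inp out = none

namespace Dev

variable {a : ℕ} (D : Dev a)

/-- The configuration at time `t` on the input `v`. -/
def conf (v : List.Vector ℕ a) (t : ℕ) : Fin D.m × (Fin D.n → ℕ) :=
  (dstep D.tr)^[t] (D.s0, fun k => (D.inp k).elim 0 v.get)

theorem conf_succ (v : List.Vector ℕ a) (t : ℕ) : D.conf v (t + 1) = dstep D.tr (D.conf v t) :=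
  Function.iterate_succ_apply' _ _ _

theorem conf_le (v : List.Vector ℕ a) (t : ℕ) (k : Fin D.n) :
    (D.conf v t).2 k ≤ (D.inp k).elim 0 v.get + t := by
  induction t with
  | zero => exact le_rfl
  | succ t ih =>
    rw [conf_succ]
    have := opApply_le ((D.tr (D.conf v t).1 fun k => decide (0 < (D.conf v t).2 k)).2 k)
      ((D.conf v t).2 k)
    simp only [dstep]
    omega

theorem conf_of_halt {v : List.Vector ℕ a} {T : ℕ} (hT : (D.conf v T).1 = D.h) {t : ℕ}
    (ht : T ≤ t) : D.conf v t = D.conf v T := by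
  induction t, ht using Nat.le_induction with
  | base => rfl
  | succ t _ ih =>
    rw [conf_succ, ih]
    simp only [dstep, hT, D.halt]
    exact Prod.ext hT.symm (funext fun k => by simp [opApply])

/-- The automaton computes `f`. -/
def Computes (f : List.Vector ℕ a → ℕ) : Prop :=
  ∀ v, ∃ T, (D.conf v T).1 = D.h ∧ (D.conf v T).2 D.out = f v

variable {D} {f : List.Vector ℕ a → ℕ} (hD : D.Computes f)

theorem Computes.halts (hD : D.Computes f) (v : List.Vector ℕ a) : ∃ T, (D.conf v T).1 = D.h :=
  (hD v).imp fun _ h => h.1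

/-- The halting time. -/
noncomputable def Computes.time (v : List.Vector ℕ a) : ℕ := Nat.find (hD.halts v)

theorem Computes.halt_iff (v : List.Vector ℕ a) (t : ℕ) :
    (D.conf v t).1 = D.h ↔ hD.time v ≤ t := by
  refine ⟨fun h => Nat.find_min' _ h, fun h => ?_⟩
  have := Nat.find_spec (hD.halts v)
  rwa [D.conf_of_halt this h]

theorem Computes.out_eq (v : List.Vector ℕ a) {t : ℕ} (ht : hD.time v ≤ t) :
    (D.conf v t).2 D.out = f v := by
  obtain ⟨T, hT, ho⟩ := hD v
  have h1 := (hD.halt_iff v T).1 hT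
  rw [D.conf_of_halt ((hD.halt_iff v _).2 le_rfl) ht,
    ← D.conf_of_halt ((hD.halt_iff v _).2 le_rfl) h1, ho]

theorem Computes.le_time (v : List.Vector ℕ a) : f v ≤ hD.time v := by
  rw [← hD.out_eq v le_rfl]
  have := D.conf_le v (hD.time v) D.out
  rwa [D.inp_out, Option.elim_none, zero_add] at this

variable (D) in
theorem primrec_dstep : Primrec (dstep D.tr) := by
  have h1 : Primrec fun c : Fin D.m × (Fin D.n → ℕ) =>
      ((c.1, fun k => decide (0 < c.2 k)) : Fin D.m × (Fin D.n → Bool)) := by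
    refine Primrec.fst.pair (Primrec.fin_curry.2 ?_)
    exact (PrimrecRel.decide Primrec.nat_lt).comp (Primrec.const 0)
      (Primrec.fin_app.comp (Primrec.snd.comp Primrec.fst) Primrec.snd)
  refine Primrec.pair ((Primrec.dom_finite fun p : Fin D.m × (Fin D.n → Bool) =>
    (D.tr p.1 p.2).1).comp h1) (Primrec.fin_curry.2 ?_)
  have hx : Primrec fun p : (Fin D.m × (Fin D.n → ℕ)) × Fin D.n => p.1.2 p.2 :=
    Primrec.fin_app.comp (Primrec.snd.comp Primrec.fst) Primrec.snd
  have ho : ∀ o : SignType, Primrec fun p : (Fin D.m × (Fin D.n → ℕ)) × Fin D.n =>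
      decide ((D.tr p.1.1 fun k => decide (0 < p.1.2 k)).2 p.2 = o) := fun o =>
    (Primrec.dom_finite fun q : (Fin D.m × (Fin D.n → Bool)) × Fin D.n =>
      decide ((D.tr q.1.1 q.1.2).2 q.2 = o)).comp ((h1.comp Primrec.fst).pair Primrec.snd)
  have := Primrec.cond (ho 1) (Primrec.succ.comp hx) (Primrec.cond (ho (-1)) (Primrec.pred.comp hx) hx)
  refine this.of_eq fun p => ?_
  simp only [opApply, Bool.cond_decide]
  rfl

variable (D) in
theorem primrec_conf : Primrec₂ D.conf := by
  refine Primrec.nat_iterate Primrec.snd (Primrec.pair (Primrec.const _) (Primrec.fin_curry.2 ?_))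
    (D.primrec_dstep.comp₂ Primrec₂.right)
  have h1 : ∀ k : Fin D.n, Primrec fun v : List.Vector ℕ a => (D.inp k).elim 0 v.get := by
    intro k
    cases D.inp k with
    | none => exact Primrec.const 0
    | some j => exact Primrec.vector_get.comp Primrec.id (Primrec.const j)
  have h2 : Primrec₂ fun (k : Fin D.n) (v : List.Vector ℕ a) => (D.inp k).elim 0 v.get :=
    Primrec.fin_curry₁.2 h1
  exact h2.comp Primrec.snd (Primrec.fst.comp Primrec.fst)

theorem Computes.computable_time : Computable hD.time := by
  have h1 : Primrec₂ fun (v : List.Vector ℕ a) t => decide ((D.conf v t).1 = D.h) :=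
    (PrimrecRel.decide Primrec.eq).comp (Primrec.fst.comp D.primrec_conf) (Primrec.const _)
  have h2 : Partrec fun v => Nat.rfind fun t => Part.some (decide ((D.conf v t).1 = D.h)) :=
    Partrec.rfind h1.to_comp
  refine h2.of_eq fun v => ?_
  refine Part.eq_some_iff.2 (Nat.mem_rfind.2 ⟨?_, fun {m} hm => ?_⟩)
  · rw [Part.mem_some_iff, eq_comm, decide_eq_true_eq]
    exact (hD.halt_iff v _).2 le_rfl
  · rw [Part.mem_some_iff, eq_comm, decide_eq_false_iff_not]
    exact fun h => absurd ((hD.halt_iff v _).1 h) (by omega)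

end Dev

theorem exists_dev {a : ℕ} {f : List.Vector ℕ a → ℕ} (hf : Computable f) :
    ∃ D : Dev a, D.Computes f := by
  obtain ⟨m, n, tr, s0, h, inp, out, h1, h2, h3⟩ := exists_device hf
  exact ⟨⟨m, n, tr, s0, h, inp, out, h1, h2⟩, fun v => by
    obtain ⟨T, σ, hT, ho⟩ := h3 v
    exact ⟨T, by simp only [Dev.conf, hT], by simp only [Dev.conf, hT, ho]⟩⟩

namespace Dev

/-- Run `A` and `B` in parallel at half speed, and accept when `A` halts if `B` has halted. -/
def par (A : Dev 1) (B : Dev 4) :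
    Mach (Bool × Bool × Fin A.m × Fin B.m) (Fin A.n ⊕ Fin B.n) where
  trans s τ := if s.1 then
      ((false, s.2.1, (A.tr s.2.2.1 fun k => τ (.inl k)).1, (B.tr s.2.2.2 fun k => τ (.inr k)).1),
        Sum.elim (A.tr s.2.2.1 fun k => τ (.inl k)).2 (B.tr s.2.2.2 fun k => τ (.inr k)).2)
    else ((true, decide (s.2.2.1 = A.h), s.2.2.1, s.2.2.2), fun _ => 0)
  s0 := (false, false, A.s0, B.s0)
  acc s := !s.1 && !s.2.1 && decide (s.2.2.1 = A.h) && decide (s.2.2.2 = B.h)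
  inp := Sum.elim (fun k => (A.inp k).elim 4 fun _ => 0) fun k => (B.inp k).elim 4 Fin.castSucc
  out := .inr B.out

/-- The vector with four given entries. -/
def vec4 (i p q α : ℕ) : List.Vector ℕ 4 := i ::ᵥ p ::ᵥ q ::ᵥ α ::ᵥ List.Vector.nil

variable (A : Dev 1) (B : Dev 4) (i p q α : ℕ)

theorem par_run_zero : (par A B).run i p q α 0 =
    ((false, false, (A.conf (i ::ᵥ .nil) 0).1, (B.conf (vec4 i p q α) 0).1),
      Sum.elim (A.conf (i ::ᵥ .nil) 0).2 (B.conf (vec4 i p q α) 0).2) := by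
  simp only [Mach.run, par, conf, Function.iterate_zero, id]
  refine Prod.ext rfl (funext fun k => ?_)
  rcases k with k | k
  · simp only [Sum.elim_inl]
    cases h : A.inp k with
    | none => rfl
    | some j => fin_cases j; rfl
  · simp only [Sum.elim_inr]
    cases h : B.inp k with
    | none => rfl
    | some j => fin_cases j <;> rfl

theorem par_run (v : ℕ) : ∃ d : Bool, (d = true ↔ ∃ u < v, (A.conf (i ::ᵥ .nil) u).1 = A.h) ∧
    (par A B).run i p q α (2 * v) =
    ((false, d, (A.conf (i ::ᵥ .nil) v).1, (B.conf (vec4 i p q α) v).1),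
      Sum.elim (A.conf (i ::ᵥ .nil) v).2 (B.conf (vec4 i p q α) v).2) ∧
    ((par A B).run i p q α (2 * v + 1)).1.1 = true ∧
    ((par A B).run i p q α (2 * v + 1)).2 = ((par A B).run i p q α (2 * v)).2 := by
  have hstep : ∀ d v, (par A B).run i p q α (2 * v) =
      ((false, d, (A.conf (i ::ᵥ .nil) v).1, (B.conf (vec4 i p q α) v).1),
      Sum.elim (A.conf (i ::ᵥ .nil) v).2 (B.conf (vec4 i p q α) v).2) →
      (par A B).run i p q α (2 * v + 1) =
      ((true, decide ((A.conf (i ::ᵥ .nil) v).1 = A.h), (A.conf (i ::ᵥ .nil) v).1,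
        (B.conf (vec4 i p q α) v).1),
      Sum.elim (A.conf (i ::ᵥ .nil) v).2 (B.conf (vec4 i p q α) v).2) := by
    intro d v h
    rw [Mach.run, h]
    simp [Mach.step, Mach.next, par, opApply]
  induction v with
  | zero =>
    have := par_run_zero A B i p q α
    have h1 := hstep false 0 this
    refine ⟨false, by simp, this, ?_, ?_⟩
    · rw [h1]
    · rw [h1]; exact (congrArg Prod.snd this).symm
  | succ v ih =>
    obtain ⟨d, -, hd, -⟩ := ih
    have h1 := hstep d v hd
    have h2 : (par A B).run i p q α (2 * (v + 1)) =
      ((false, decide ((A.conf (i ::ᵥ .nil) v).1 = A.h), (A.conf (i ::ᵥ .nil) (v + 1)).1,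
        (B.conf (vec4 i p q α) (v + 1)).1),
      Sum.elim (A.conf (i ::ᵥ .nil) (v + 1)).2 (B.conf (vec4 i p q α) (v + 1)).2) := by
      rw [show 2 * (v + 1) = (2 * v + 1) + 1 from rfl, Mach.run, h1, conf_succ, conf_succ]
      simp only [Mach.step, Mach.next, par, dstep, if_true, Sum.elim_inl, Sum.elim_inr]
      refine Prod.ext rfl (funext fun k => ?_)
      rcases k with k | k <;> rfl
    have h3 := hstep _ (v + 1) h2
    refine ⟨_, ?_, h2, by rw [h3], by rw [h3, h2]⟩
    rw [decide_eq_true_eq]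
    refine ⟨fun h => ⟨v, by omega, h⟩, ?_⟩
    rintro ⟨u, hu, h⟩
    rwa [A.conf_of_halt h (by omega)]

theorem par_computes {f : List.Vector ℕ 1 → ℕ} {φ : ℕ → ℕ → ℕ → ℕ → ℕ} (hA : A.Computes f)
    (hB : B.Computes fun v => φ (v.get 0) (v.get 1) (v.get 2) (v.get 3)) (hi : ∀ v, v.get 0 ≤ f v)
    (hφ : ∀ i p q α, φ i p q α ≠ 0 → p ≤ f (i ::ᵥ .nil) ∧ q ≤ f (i ::ᵥ .nil) ∧
      α ≤ f (i ::ᵥ .nil) ∧ hB.time (vec4 i p q α) ≤ f (i ::ᵥ .nil)) :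
    (par A B).Computes φ fun i => 2 * hA.time (i ::ᵥ .nil) + 1 := by
  have hacc : ∀ i p q α v, (par A B).acc ((par A B).run i p q α v).1 = true ↔
      v = 2 * hA.time (i ::ᵥ .nil) ∧ hB.time (vec4 i p q α) ≤ hA.time (i ::ᵥ .nil) := by
    intro i p q α v
    obtain ⟨w, rfl | rfl⟩ := Nat.even_or_odd' v
    · obtain ⟨d, hd, h1, -⟩ := par_run A B i p q α w
      rw [h1]
      simp only [hA.halt_iff] at hd
      simp only [par, Bool.not_false, Bool.true_and, Bool.and_eq_true, Bool.not_eq_true',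
        decide_eq_true_eq, hA.halt_iff, hB.halt_iff, ← Bool.not_eq_true, hd]
      constructor
      · rintro ⟨⟨h2, h3⟩, h4⟩
        have : ¬ hA.time (i ::ᵥ .nil) < w := fun h => h2 ⟨_, h, le_rfl⟩
        omega
      · rintro ⟨h2, h3⟩
        refine ⟨⟨?_, by omega⟩, by omega⟩
        rintro ⟨u, hu, h4⟩
        omega
    · obtain ⟨d, -, -, h1, -⟩ := par_run A B i p q α w
      simp only [par] at h1 ⊢
      simp only [h1, Bool.not_true, Bool.false_and, Bool.false_eq_true, false_iff]
      omega
  have hout : ∀ i p q α, hB.time (vec4 i p q α) ≤ hA.time (i ::ᵥ .nil) →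
      ((par A B).run i p q α (2 * hA.time (i ::ᵥ .nil))).2 (par A B).out = φ i p q α := by
    intro i p q α h
    obtain ⟨d, -, h1, -⟩ := par_run A B i p q α (hA.time (i ::ᵥ .nil))
    rw [h1]
    exact hB.out_eq _ h
  refine ⟨fun i => by omega, ?_, ?_, ?_⟩
  · intro i p q α v h _
    obtain ⟨rfl, h2⟩ := (hacc i p q α v).1 h
    exact ⟨rfl, (hout i p q α h2).symm⟩
  · intro i p q α h
    have h1 := (hφ i p q α h).2.2.2.trans (hA.le_time _)
    exact ⟨(hacc _ _ _ _ _).2 ⟨rfl, h1⟩, hout i p q α h1⟩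
  · intro i p q α h v hv k
    obtain ⟨h1, h2, h3, -⟩ := hφ i p q α h
    have h4 := hA.le_time (i ::ᵥ .nil)
    have h5 := hi (i ::ᵥ .nil)
    rw [List.Vector.get_zero, List.Vector.head_cons] at h5
    have key : ∀ w ≤ hA.time (i ::ᵥ .nil),
        ((par A B).run i p q α (2 * w)).2 k ≤ 2 * hA.time (i ::ᵥ .nil) + 1 := by
      intro w hw
      obtain ⟨d, -, h6, -⟩ := par_run A B i p q α w
      rw [h6]
      rcases k with k | k
      · have h7 := A.conf_le (i ::ᵥ .nil) w k
        have h8 : (A.inp k).elim 0 (i ::ᵥ List.Vector.nil).get ≤ i := by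
          cases A.inp k with
          | none => exact Nat.zero_le _
          | some j => fin_cases j; exact le_rfl
        simp only [Sum.elim_inl]
        omega
      · have h7 := B.conf_le (vec4 i p q α) w k
        have h8 : (B.inp k).elim 0 (vec4 i p q α).get ≤ f (i ::ᵥ .nil) := by
          cases B.inp k with
          | none => exact Nat.zero_le _
          | some j => fin_cases j <;> assumption
        simp only [Sum.elim_inr]
        omega
    obtain ⟨w, rfl | rfl⟩ := Nat.even_or_odd' v
    · exact key w (by omega)
    · obtain ⟨d, -, -, -, h6⟩ := par_run A B i p q α w
      rw [h6]
      exact key w (by omega)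

end Dev

theorem exists_mach {φ : ℕ → ℕ → ℕ → ℕ → ℕ} {β : ℕ → ℕ}
    (hφ : Computable fun v : List.Vector ℕ 4 => φ (v.get 0) (v.get 1) (v.get 2) (v.get 3))
    (hβ : Computable β)
    (hb : ∀ i p q α, φ i p q α ≠ 0 → p ≤ β i ∧ q ≤ β i ∧ α ≤ β i) :
    ∃ (St κ : Type) (_ : Finite St) (_ : Finite κ) (M : Mach St κ) (Nf : ℕ → ℕ),
      M.Computes φ Nf ∧ ∀ i, i ≤ Nf i := by
  obtain ⟨B, hB⟩ := exists_dev hφ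
  let T' : ℕ → ℕ → ℕ := fun i c =>
    hB.time (Dev.vec4 i c.unpair.1 c.unpair.2.unpair.1 c.unpair.2.unpair.2)
  let K : ℕ → ℕ := fun i => Nat.pair (β i) (Nat.pair (β i) (β i)) + 1
  let S : ℕ → ℕ → ℕ := fun i c => c.rec 0 fun c acc => acc + T' i c
  have hS : ∀ i c k, c < k → T' i c ≤ S i k := by
    intro i c k hk
    induction k, hk using Nat.le_induction with
    | base => exact Nat.le_add_left _ _
    | succ k _ ih => exact ih.trans (Nat.le_add_right _ _)
  have hT' : Computable₂ T' := by
    have hu : Primrec fun p : ℕ × ℕ => p.2.unpair := Primrec.unpair.comp Primrec.snd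
    have hu2 : Primrec fun p : ℕ × ℕ => p.2.unpair.2.unpair :=
      Primrec.unpair.comp (Primrec.snd.comp hu)
    refine hB.computable_time.comp (Primrec.to_comp (f := fun p : ℕ × ℕ =>
      Dev.vec4 p.1 p.2.unpair.1 p.2.unpair.2.unpair.1 p.2.unpair.2.unpair.2) ?_)
    exact Primrec.vector_cons.comp Primrec.fst (Primrec.vector_cons.comp (Primrec.fst.comp hu)
      (Primrec.vector_cons.comp (Primrec.fst.comp hu2) (Primrec.vector_cons.comp
        (Primrec.snd.comp hu2) (Primrec.const _))))
  have hK : Computable K := by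
    have h1 : Primrec fun b : ℕ => Nat.pair b (Nat.pair b b) + 1 :=
      Primrec.succ.comp (Primrec₂.natPair.comp Primrec.id (Primrec₂.natPair.comp Primrec.id Primrec.id))
    exact h1.to_comp.comp hβ
  have hg : Computable fun i => i + β i + S i (K i) := by
    have hadd : Computable fun p : ℕ × ℕ => p.1 + p.2 := Primrec.nat_add.to_comp
    have h1 : Computable fun i => S i (K i) := by
      refine Computable.nat_rec (h := fun i p => p.2 + T' i p.1) hK (Computable.const 0) ?_
      exact hadd.comp ((Computable.snd.comp Computable.snd).pair
        (hT'.comp Computable.fst (Computable.fst.comp Computable.snd)))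
    exact hadd.comp ((hadd.comp (Computable.id.pair hβ)).pair h1)
  obtain ⟨A, hA⟩ := exists_dev (a := 1) (f := fun v => v.head + β v.head + S v.head (K v.head))
    (hg.comp Primrec.vector_head.to_comp)
  refine ⟨_, _, inferInstance, inferInstance, Dev.par A B, _,
    Dev.par_computes A B hA hB (fun v => by rw [List.Vector.get_zero]; omega) ?_, fun i => ?_⟩
  · intro i p q α h
    obtain ⟨h1, h2, h3⟩ := hb i p q α h
    rw [List.Vector.head_cons]
    refine ⟨by omega, by omega, by omega, ?_⟩
    have h4 := hS i (Nat.pair p (Nat.pair q α)) (K i) (by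
      have pmono : ∀ {a b c d : ℕ}, a ≤ b → c ≤ d → Nat.pair a c ≤ Nat.pair b d := by
        intro a b c d hab hcd
        rcases hab.lt_or_eq with h | rfl <;> rcases hcd.lt_or_eq with h' | rfl
        · exact ((Nat.pair_lt_pair_left _ h).trans (Nat.pair_lt_pair_right _ h')).le
        · exact (Nat.pair_lt_pair_left _ h).le
        · exact (Nat.pair_lt_pair_right _ h').le
        · exact le_rfl
      have := pmono h1 (pmono h2 h3)
      simp only [K]; omega)
    simp only [T', Nat.unpair_pair] at h4
    omega
  · have := hA.le_time (i ::ᵥ .nil)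
    rw [List.Vector.head_cons] at this
    show i ≤ 2 * hA.time (i ::ᵥ .nil) + 1
    omega

section Closure

variable {α β : Type*} [Primcodable α] [Primcodable β]

theorem primrecPred_forall_lt {f : α → ℕ} {R : α → ℕ → Prop} (hf : Primrec f)
    (hR : PrimrecPred fun p : α × ℕ => R p.1 p.2) : PrimrecPred fun a => ∀ x < f a, R a x := by
  have h : PrimrecRel fun (x : ℕ) (a : α) => R a x :=
    hR.comp (Primrec.snd.pair Primrec.fst)
  exact (h.forall_mem_list.comp (Primrec.list_range.comp hf) Primrec.id).of_eq fun a => by simp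

theorem primrecPred_exists_lt {f : α → ℕ} {R : α → ℕ → Prop} (hf : Primrec f)
    (hR : PrimrecPred fun p : α × ℕ => R p.1 p.2) : PrimrecPred fun a => ∃ x < f a, R a x := by
  have h : PrimrecRel fun (x : ℕ) (a : α) => R a x :=
    hR.comp (Primrec.snd.pair Primrec.fst)
  exact (h.exists_mem_list.comp (Primrec.list_range.comp hf) Primrec.id).of_eq fun a => by simp

theorem primrecPred_forall_mem {l : α → List β} {R : α → β → Prop} (hl : Primrec l)
    (hR : PrimrecPred fun p : α × β => R p.1 p.2) : PrimrecPred fun a => ∀ x ∈ l a, R a x := by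
  have h : PrimrecRel fun (x : β) (a : α) => R a x :=
    hR.comp (Primrec.snd.pair Primrec.fst)
  exact h.forall_mem_list.comp hl Primrec.id

variable {f g : α → ℕ}

theorem primrec_add (hf : Primrec f) (hg : Primrec g) : Primrec fun a => f a + g a :=
  Primrec.nat_add.comp hf hg

theorem primrec_mul (hf : Primrec f) (hg : Primrec g) : Primrec fun a => f a * g a :=
  Primrec.nat_mul.comp hf hg

theorem primrec_sub (hf : Primrec f) (hg : Primrec g) : Primrec fun a => f a - g a :=
  Primrec.nat_sub.comp hf hg

theorem primrec_pow (hf : Primrec f) (hg : Primrec g) : Primrec fun a => f a ^ g a := by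
  have : Primrec₂ fun a b : ℕ => a ^ b := Primrec₂.unpaired'.1 Nat.Primrec.pow
  exact this.comp hf hg

end Closure

theorem encode_int_natCast (m : ℕ) : Encodable.encode (m : ℤ) = 2 * m := rfl

theorem encode_int_negSucc (m : ℕ) : Encodable.encode (Int.negSucc m) = 2 * m + 1 := rfl

theorem primrec_toNat : Primrec Int.toNat := by
  have h : Primrec fun a : ℤ => if Encodable.encode a % 2 = 0 then Encodable.encode a / 2 else 0 :=
    Primrec.ite (Primrec.eq.comp (Primrec.nat_mod.comp Primrec.encode (Primrec.const 2))
      (Primrec.const 0)) (Primrec.nat_div.comp Primrec.encode (Primrec.const 2)) (Primrec.const 0)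
  refine h.of_eq fun a => ?_
  rcases a with m | m
  · rw [Int.ofNat_eq_natCast, encode_int_natCast]
    simp
  · rw [encode_int_negSucc, if_neg (by omega)]
    rfl

theorem primrec_neg_toNat : Primrec fun a : ℤ => (-a).toNat := by
  have h : Primrec fun a : ℤ => if Encodable.encode a % 2 = 0 then 0 else
      Encodable.encode a / 2 + 1 :=
    Primrec.ite (Primrec.eq.comp (Primrec.nat_mod.comp Primrec.encode (Primrec.const 2))
      (Primrec.const 0)) (Primrec.const 0)
      (Primrec.succ.comp (Primrec.nat_div.comp Primrec.encode (Primrec.const 2)))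
  refine h.of_eq fun a => ?_
  rcases a with m | m
  · rw [Int.ofNat_eq_natCast, encode_int_natCast]
    simp
  · rw [encode_int_negSucc, if_neg (by omega)]
    simp only [Int.neg_negSucc]
    omega

/-! ### Codes of windows -/

/-- The digit of index `j` in base `n`. -/
def dig (n t j : ℕ) : ℕ := t / n ^ j % n

/-- A bound on the size of the image of a box of radius `2 k` under the change of coordinates. -/
def rad (k : ℕ) : ℕ := (2 * k + 3) * (2 * k)

/-- The side of the coded windows. -/
def side (k : ℕ) : ℕ := 2 * rad k + 1

/-- In the box of side `3 * side k` with code `z`, there is an occurrence of the pattern `p` at the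
position `(c, d)` in the new coordinates. -/
def Hit (n k z : ℕ) (p : List ((ℤ × ℤ) × ℕ)) (c d : ℕ) : Prop :=
  ∀ q ∈ p, ∃ x < 3 * side k, ∃ y < 3 * side k,
    x + ((k + 1) * (-q.1.1).toNat + k * (-q.1.2).toNat) =
      c + ((k + 1) * q.1.1.toNat + k * q.1.2.toNat) ∧
    y + ((k + 2) * (-q.1.1).toNat + (k + 1) * (-q.1.2).toNat) =
      d + ((k + 2) * q.1.1.toNat + (k + 1) * q.1.2.toNat) ∧
    dig n z (x + 3 * side k * y) = q.2

/-- The box with code `z` contains no forbidden pattern. -/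
def Adm (n : ℕ) (F : List (List ((ℤ × ℤ) × ℕ))) (k z : ℕ) : Prop :=
  ∀ p ∈ F, ∀ c < 3 * side k, ∀ d < 3 * side k, ¬ Hit n k z p c d

/-- `t` codes the window at the position `(e, f)` of the box with code `z`. -/
def Sub (n k z t e f : ℕ) : Prop :=
  t < n ^ (side k * side k) ∧ ∀ a < side k, ∀ b < side k,
    dig n t (a + side k * b) = dig n z ((a + e) + 3 * side k * (b + f))

/-- `w`, `s` and `t` code the windows at three neighbouring positions of an admissible box. -/
def Rel (n : ℕ) (F : List (List ((ℤ × ℤ) × ℕ))) (k w s t : ℕ) : Prop :=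
  ∃ z < n ^ (3 * side k * (3 * side k)), Adm n F k z ∧ Sub n k z w (2 * rad k) (side k) ∧
    Sub n k z s (side k) (2 * rad k) ∧ Sub n k z t (side k) (side k)

/-- The parameter `k` is large enough. -/
def Good (δ : Bool) (n : ℕ) (F : List (List ((ℤ × ℤ) × ℕ))) (k : ℕ) : Prop :=
  (∀ p ∈ F, ∀ q ∈ p, q.1.1.toNat + (-q.1.1).toNat ≤ k ∧ q.1.2.toNat + (-q.1.2).toNat ≤ k) ∧
  (δ = true → ∀ w < n ^ (side k * side k), ∀ s < n ^ (side k * side k),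
    ∀ t < n ^ (side k * side k), ∀ t' < n ^ (side k * side k),
      ¬ (Rel n F k w s t ∧ Rel n F k w s t' ∧ t ≠ t'))

section Primrec

open Primrec

variable {α : Type*} [Primcodable α] {n k z t w s e e' c d : α → ℕ}
  {p : α → List ((ℤ × ℤ) × ℕ)} {F : α → List (List ((ℤ × ℤ) × ℕ))}

theorem primrec_dig (hn : Primrec n) (ht : Primrec t) (hd : Primrec d) :
    Primrec fun a => dig (n a) (t a) (d a) :=
  nat_mod.comp (nat_div.comp ht (primrec_pow hn hd)) hn

theorem primrec_rad (hk : Primrec k) : Primrec fun a => rad (k a) :=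
  primrec_mul (primrec_add (primrec_mul (const 2) hk) (const 3)) (primrec_mul (const 2) hk)

theorem primrec_side (hk : Primrec k) : Primrec fun a => side (k a) :=
  primrec_add (primrec_mul (const 2) (primrec_rad hk)) (const 1)

theorem primrec_three_side (hk : Primrec k) : Primrec fun a => 3 * side (k a) :=
  primrec_mul (const 3) (primrec_side hk)

theorem primrecPred_hit (hn : Primrec n) (hk : Primrec k) (hz : Primrec z) (hp : Primrec p)
    (hc : Primrec c) (hd : Primrec d) :
    PrimrecPred fun a => Hit (n a) (k a) (z a) (p a) (c a) (d a) := by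
  refine primrecPred_forall_mem hp (primrecPred_exists_lt (primrec_three_side (hk.comp fst))
    (primrecPred_exists_lt (primrec_three_side (hk.comp (fst.comp fst))) ?_))
  have k3 := hk.comp (fst.comp (fst.comp (fst (α := (α × ((ℤ × ℤ) × ℕ)) × ℕ) (β := ℕ))))
  have n3 := hn.comp (fst.comp (fst.comp (fst (α := (α × ((ℤ × ℤ) × ℕ)) × ℕ) (β := ℕ))))
  have z3 := hz.comp (fst.comp (fst.comp (fst (α := (α × ((ℤ × ℤ) × ℕ)) × ℕ) (β := ℕ))))
  have c3 := hc.comp (fst.comp (fst.comp (fst (α := (α × ((ℤ × ℤ) × ℕ)) × ℕ) (β := ℕ))))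
  have d3 := hd.comp (fst.comp (fst.comp (fst (α := (α × ((ℤ × ℤ) × ℕ)) × ℕ) (β := ℕ))))
  have q3 := snd.comp (fst.comp (fst (α := (α × ((ℤ × ℤ) × ℕ)) × ℕ) (β := ℕ)))
  have a3 := fst.comp (fst.comp q3)
  have b3 := snd.comp (fst.comp q3)
  have x3 := snd.comp (fst (α := (α × ((ℤ × ℤ) × ℕ)) × ℕ) (β := ℕ))
  have y3 := snd (α := (α × ((ℤ × ℤ) × ℕ)) × ℕ) (β := ℕ)
  have k1 := primrec_add k3 (const 1)
  have k2 := primrec_add k3 (const 2)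
  refine PrimrecPred.and (Primrec.eq.comp (primrec_add x3 ?_) (primrec_add c3 ?_)) (PrimrecPred.and
    (Primrec.eq.comp (primrec_add y3 ?_) (primrec_add d3 ?_)) (Primrec.eq.comp (primrec_dig n3 z3
      (primrec_add x3 (primrec_mul (primrec_three_side k3) y3))) (snd.comp q3)))
  · exact primrec_add (primrec_mul k1 (primrec_neg_toNat.comp a3))
      (primrec_mul k3 (primrec_neg_toNat.comp b3))
  · exact primrec_add (primrec_mul k1 (primrec_toNat.comp a3))
      (primrec_mul k3 (primrec_toNat.comp b3))
  · exact primrec_add (primrec_mul k2 (primrec_neg_toNat.comp a3))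
      (primrec_mul k1 (primrec_neg_toNat.comp b3))
  · exact primrec_add (primrec_mul k2 (primrec_toNat.comp a3))
      (primrec_mul k1 (primrec_toNat.comp b3))

theorem primrecPred_adm (hn : Primrec n) (hF : Primrec F) (hk : Primrec k) (hz : Primrec z) :
    PrimrecPred fun a => Adm (n a) (F a) (k a) (z a) := by
  refine primrecPred_forall_mem hF (primrecPred_forall_lt (primrec_three_side (hk.comp fst))
    (primrecPred_forall_lt (primrec_three_side (hk.comp (fst.comp fst))) (PrimrecPred.not
      (primrecPred_hit ?_ ?_ ?_ ?_ ?_ ?_))))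
  · exact hn.comp (fst.comp (fst.comp fst))
  · exact hk.comp (fst.comp (fst.comp fst))
  · exact hz.comp (fst.comp (fst.comp fst))
  · exact snd.comp (fst.comp fst)
  · exact snd.comp fst
  · exact snd

theorem primrecPred_sub (hn : Primrec n) (hk : Primrec k) (hz : Primrec z) (ht : Primrec t)
    (he : Primrec e) (he' : Primrec e') :
    PrimrecPred fun a => Sub (n a) (k a) (z a) (t a) (e a) (e' a) := by
  refine PrimrecPred.and (nat_lt.comp ht (primrec_pow hn (primrec_mul (primrec_side hk)
    (primrec_side hk)))) (primrecPred_forall_lt (primrec_side hk) (primrecPred_forall_lt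
      (primrec_side (hk.comp fst)) ?_))
  have k2 := hk.comp (fst.comp (fst (α := α × ℕ) (β := ℕ)))
  have n2 := hn.comp (fst.comp (fst (α := α × ℕ) (β := ℕ)))
  have x2 := snd.comp (fst (α := α × ℕ) (β := ℕ))
  have y2 := snd (α := α × ℕ) (β := ℕ)
  exact Primrec.eq.comp (primrec_dig n2 (ht.comp (fst.comp fst)) (primrec_add x2
    (primrec_mul (primrec_side k2) y2))) (primrec_dig n2 (hz.comp (fst.comp fst)) (primrec_add
      (primrec_add x2 (he.comp (fst.comp fst))) (primrec_mul (primrec_three_side k2)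
        (primrec_add y2 (he'.comp (fst.comp fst))))))

theorem primrecPred_rel (hn : Primrec n) (hF : Primrec F) (hk : Primrec k) (hw : Primrec w)
    (hs : Primrec s) (ht : Primrec t) :
    PrimrecPred fun a => Rel (n a) (F a) (k a) (w a) (s a) (t a) := by
  have r1 := primrec_mul (const 2) (primrec_rad (hk.comp (fst (α := α) (β := ℕ))))
  have s1 := primrec_side (hk.comp (fst (α := α) (β := ℕ)))
  have n1 := hn.comp (fst (α := α) (β := ℕ))
  have k1 := hk.comp (fst (α := α) (β := ℕ))
  refine primrecPred_exists_lt (primrec_pow hn (primrec_mul (primrec_three_side hk)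
    (primrec_three_side hk))) (PrimrecPred.and (primrecPred_adm n1 (hF.comp fst) k1 snd)
      (PrimrecPred.and (primrecPred_sub n1 k1 snd (hw.comp fst) r1 s1) (PrimrecPred.and
        (primrecPred_sub n1 k1 snd (hs.comp fst) s1 r1)
        (primrecPred_sub n1 k1 snd (ht.comp fst) s1 s1))))

theorem primrecPred_good (δ : Bool) (hn : Primrec n) (hF : Primrec F) (hk : Primrec k) :
    PrimrecPred fun a => Good δ (n a) (F a) (k a) := by
  refine PrimrecPred.and (primrecPred_forall_mem hF (primrecPred_forall_mem snd ?_)) ?_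
  · have a2 := fst.comp (fst.comp (snd (α := α × List ((ℤ × ℤ) × ℕ)) (β := (ℤ × ℤ) × ℕ)))
    have b2 := snd.comp (fst.comp (snd (α := α × List ((ℤ × ℤ) × ℕ)) (β := (ℤ × ℤ) × ℕ)))
    have k2 := hk.comp (fst.comp (fst (α := α × List ((ℤ × ℤ) × ℕ)) (β := (ℤ × ℤ) × ℕ)))
    exact PrimrecPred.and
      (nat_le.comp (primrec_add (primrec_toNat.comp a2) (primrec_neg_toNat.comp a2)) k2)
      (nat_le.comp (primrec_add (primrec_toNat.comp b2) (primrec_neg_toNat.comp b2)) k2)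
  · cases δ with
    | false => exact (Primrec.eq.comp (const 0) (const 0)).of_eq fun a => by simp
    | true =>
      have hb := primrec_pow hn (primrec_mul (primrec_side hk) (primrec_side hk))
      refine PrimrecPred.of_eq (p := fun a => ∀ w < n a ^ (side (k a) * side (k a)),
        ∀ s < n a ^ (side (k a) * side (k a)), ∀ t < n a ^ (side (k a) * side (k a)),
        ∀ t' < n a ^ (side (k a) * side (k a)), ¬ (Rel (n a) (F a) (k a) w s t ∧
          Rel (n a) (F a) (k a) w s t' ∧ t ≠ t')) ?_ fun a => by simp
      refine primrecPred_forall_lt hb (primrecPred_forall_lt (hb.comp fst) (primrecPred_forall_lt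
        (hb.comp (fst.comp fst)) (primrecPred_forall_lt (hb.comp (fst.comp (fst.comp fst)))
          (PrimrecPred.not (PrimrecPred.and ?_ (PrimrecPred.and ?_ ?_))))))
      · exact primrecPred_rel (hn.comp (fst.comp (fst.comp (fst.comp fst))))
          (hF.comp (fst.comp (fst.comp (fst.comp fst))))
          (hk.comp (fst.comp (fst.comp (fst.comp fst)))) (snd.comp (fst.comp (fst.comp fst)))
          (snd.comp (fst.comp fst)) (snd.comp fst)
      · exact primrecPred_rel (hn.comp (fst.comp (fst.comp (fst.comp fst))))
          (hF.comp (fst.comp (fst.comp (fst.comp fst))))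
          (hk.comp (fst.comp (fst.comp (fst.comp fst)))) (snd.comp (fst.comp (fst.comp fst)))
          (snd.comp (fst.comp fst)) snd
      · exact PrimrecPred.not (Primrec.eq.comp (snd.comp fst) snd)

end Primrec

/-! ### Digits -/

theorem dig_lt {n : ℕ} (hn : 0 < n) (t j : ℕ) : dig n t j < n := Nat.mod_lt _ hn

theorem dig_succ (n t j : ℕ) : dig n t (j + 1) = dig n (t / n) j := by
  rw [dig, dig, pow_succ', Nat.div_div_eq_div_mul]

theorem dig_zero (n t : ℕ) : dig n t 0 = t % n := by simp [dig]

theorem eq_of_dig {n : ℕ} : ∀ {N t t' : ℕ}, t < n ^ N → t' < n ^ N →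
    (∀ j < N, dig n t j = dig n t' j) → t = t' := by
  intro N
  induction N with
  | zero => intro t t' h h' _; rw [pow_zero] at h h'; omega
  | succ N ih =>
    intro t t' h h' hj
    rw [pow_succ'] at h h'
    have e := hj 0 (by omega)
    rw [dig_zero, dig_zero] at e
    have e' : t / n = t' / n := ih (Nat.div_lt_of_lt_mul h) (Nat.div_lt_of_lt_mul h')
      fun j hjN => by simpa only [dig_succ] using hj (j + 1) (by omega)
    rw [← Nat.div_add_mod t n, ← Nat.div_add_mod t' n, e, e']

theorem exists_dig {n : ℕ} : ∀ (N : ℕ) (y : ℕ → ℕ), (∀ j < N, y j < n) →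
    ∃ t < n ^ N, ∀ j < N, dig n t j = y j := by
  intro N
  induction N with
  | zero => intro y _; exact ⟨0, by simp, by simp⟩
  | succ N ih =>
    intro y hy
    obtain ⟨t, ht, hd⟩ := ih (fun j => y (j + 1)) fun j hj => hy _ (by omega)
    have h0 := hy 0 (by omega)
    have hn : 0 < n := by omega
    refine ⟨y 0 + n * t, ?_, fun j hj => ?_⟩
    · rw [pow_succ']
      nlinarith
    · cases j with
      | zero => rw [dig_zero, Nat.add_mul_mod_self_left, Nat.mod_eq_of_lt h0]
      | succ j =>
        rw [dig_succ, Nat.add_mul_div_left _ _ hn, Nat.div_eq_of_lt h0, zero_add]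
        exact hd j (by omega)

theorem square_index_lt {s a b : ℕ} (ha : a < s) (hb : b < s) : a + s * b < s * s := by
  nlinarith

theorem eq_of_dig_square {n s t t' : ℕ} (ht : t < n ^ (s * s)) (ht' : t' < n ^ (s * s))
    (h : ∀ a < s, ∀ b < s, dig n t (a + s * b) = dig n t' (a + s * b)) : t = t' := by
  refine eq_of_dig ht ht' fun j hj => ?_
  have hs : 0 < s := Nat.pos_of_ne_zero fun h => by simp [h] at hj
  have := h (j % s) (Nat.mod_lt _ hs) (j / s) (Nat.div_lt_of_lt_mul hj)
  rwa [Nat.mod_add_div] at this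

theorem exists_dig_square {n s : ℕ} (y : ℕ → ℕ → ℕ) (hy : ∀ a < s, ∀ b < s, y a b < n) :
    ∃ t < n ^ (s * s), ∀ a < s, ∀ b < s, dig n t (a + s * b) = y a b := by
  obtain ⟨t, ht, hd⟩ := exists_dig (s * s) (fun j => y (j % s) (j / s)) fun j hj =>
    hy _ (Nat.mod_lt _ (Nat.pos_of_ne_zero fun h => by simp [h] at hj)) _
      (Nat.div_lt_of_lt_mul hj)
  refine ⟨t, ht, fun a ha b hb => ?_⟩
  rw [hd _ (square_index_lt ha hb), Nat.add_mul_mod_self_left, Nat.mod_eq_of_lt ha,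
    Nat.add_mul_div_left _ _ (by omega), Nat.div_eq_of_lt ha, zero_add]

/-! ### The change of coordinates -/

/-- The change of coordinates. -/
def crd (k : ℕ) : (ℤ × ℤ) ≃+ (ℤ × ℤ) where
  toFun v := ((k + 1) * v.1 + k * v.2, (k + 2) * v.1 + (k + 1) * v.2)
  invFun u := ((k + 1) * u.1 - k * u.2, -((k + 2) * u.1) + (k + 1) * u.2)
  left_inv v := by ext <;> simp <;> ring
  right_inv v := by ext <;> simp <;> ring
  map_add' v w := by ext <;> simp <;> ring

theorem crd_fst (k : ℕ) (v : ℤ × ℤ) : (crd k v).1 = (k + 1) * v.1 + k * v.2 := rfl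

theorem crd_snd (k : ℕ) (v : ℤ × ℤ) : (crd k v).2 = (k + 2) * v.1 + (k + 1) * v.2 := rfl

theorem crd_bound {k : ℕ} {v : ℤ × ℤ} (h : v ∈ boxR (2 * k)) : crd k v ∈ boxR (rad k) := by
  rw [mem_boxR] at h ⊢
  rw [crd_fst, crd_snd, rad]
  push_cast at h ⊢
  obtain ⟨⟨h1, h2⟩, h3, h4⟩ := h
  have hk : (0 : ℤ) ≤ k := by positivity
  refine ⟨⟨?_, ?_⟩, ?_, ?_⟩ <;> nlinarith

/-- The symbol at a position of the box with code `z`. -/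
def cell (n k z : ℕ) (u : ℤ × ℤ) : ℕ := dig n z (u.1.toNat + 3 * side k * u.2.toNat)

/-- The positions of the boxes of side `3 * side k`. -/
def InBox (k : ℕ) (u : ℤ × ℤ) : Prop :=
  (0 ≤ u.1 ∧ u.1 < 3 * side k) ∧ (0 ≤ u.2 ∧ u.2 < 3 * side k)

theorem hit_iff {n k z c d : ℕ} {p : List ((ℤ × ℤ) × ℕ)} :
    Hit n k z p c d ↔ ∀ q ∈ p, InBox k (((c : ℤ), (d : ℤ)) + crd k q.1) ∧
      cell n k z (((c : ℤ), (d : ℤ)) + crd k q.1) = q.2 := by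
  have aux : ∀ α : ℤ, (α.toNat : ℤ) - ((-α).toNat : ℤ) = α := fun α => by omega
  refine forall₂_congr fun q _ => ?_
  have ha := aux q.1.1
  have hb := aux q.1.2
  have e1 : (((c : ℤ), (d : ℤ)) + crd k q.1).1 = c + ((k + 1) * q.1.1 + k * q.1.2) := rfl
  have e2 : (((c : ℤ), (d : ℤ)) + crd k q.1).2 = d + ((k + 2) * q.1.1 + (k + 1) * q.1.2) := rfl
  have k1 : ∀ x : ℕ, x + ((k + 1) * (-q.1.1).toNat + k * (-q.1.2).toNat) =
      c + ((k + 1) * q.1.1.toNat + k * q.1.2.toNat) ↔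
      (x : ℤ) = (((c : ℤ), (d : ℤ)) + crd k q.1).1 := by
    intro x
    rw [e1]
    zify
    constructor <;> intro h
    · linear_combination h + (k + 1 : ℤ) * ha + (k : ℤ) * hb
    · linear_combination h - (k + 1 : ℤ) * ha - (k : ℤ) * hb
  have k2 : ∀ y : ℕ, y + ((k + 2) * (-q.1.1).toNat + (k + 1) * (-q.1.2).toNat) =
      d + ((k + 2) * q.1.1.toNat + (k + 1) * q.1.2.toNat) ↔
      (y : ℤ) = (((c : ℤ), (d : ℤ)) + crd k q.1).2 := by
    intro x
    rw [e2]
    zify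
    constructor <;> intro h
    · linear_combination h + (k + 2 : ℤ) * ha + (k + 1 : ℤ) * hb
    · linear_combination h - (k + 2 : ℤ) * ha - (k + 1 : ℤ) * hb
  simp only [k1, k2]
  generalize ((c : ℤ), (d : ℤ)) + crd k q.1 = u
  constructor
  · rintro ⟨x, hx, y, hy, h1, h2, h⟩
    refine ⟨⟨⟨by omega, by omega⟩, by omega, by omega⟩, ?_⟩
    rw [cell, ← h1, ← h2, Int.toNat_natCast, Int.toNat_natCast, h]
  · rintro ⟨⟨⟨h1, h2⟩, h3, h4⟩, h⟩
    exact ⟨u.1.toNat, by omega, u.2.toNat, by omega, by omega, by omega, h⟩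

/-! ### Existence of a suitable parameter -/

/-- In a neighbourhood of the origin, `z` satisfies the constraints given by `n` and `F`. -/
def Locally (n : ℕ) (F : List (List ((ℤ × ℤ) × ℕ))) (ρ : ℕ) (z : ℤ × ℤ → ℕ) : Prop :=
  (∀ m ∈ boxR ρ, z m < n) ∧ ∀ p ∈ F, ∀ v ∈ boxR ρ, ¬ ∀ q ∈ p, z (v + q.1) = q.2

theorem Locally.mono {n : ℕ} {F : List (List ((ℤ × ℤ) × ℕ))} {ρ ρ' : ℕ} {z : ℤ × ℤ → ℕ}
    (h : Locally n F ρ' z) (hρ : ρ ≤ ρ') : Locally n F ρ z :=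
  ⟨fun m hm => h.1 m (boxR_mono hρ hm), fun p hp v hv => h.2 p hp v (boxR_mono hρ hv)⟩

theorem exists_limit {n : ℕ} {F : List (List ((ℤ × ℤ) × ℕ))} {U : Ultrafilter ℕ}
    (hU : (U : Filter ℕ) ≤ Filter.atTop) {z : ℕ → ℤ × ℤ → ℕ} (hz : ∀ ρ, Locally n F ρ (z ρ)) :
    ∃ x : ℤ × ℤ → ℕ, ((∀ m, x m < n) ∧ ∀ p ∈ F, ¬ occursL p x) ∧
      ∀ m, ∀ᶠ ρ in (U : Filter ℕ), z ρ m = x m := by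
  have hbox : ∀ m : ℤ × ℤ, ∀ᶠ ρ in (U : Filter ℕ), m ∈ boxR ρ := by
    intro m
    obtain ⟨r, hr⟩ := exists_boxR {m}
    filter_upwards [hU (Filter.eventually_ge_atTop r)] with ρ hρ
    exact boxR_mono hρ (hr (Finset.mem_singleton_self m))
  have h : ∀ m, ∃ a < n, ∀ᶠ ρ in (U : Filter ℕ), z ρ m = a := by
    intro m
    have h1 : (⋃ a ∈ Set.Iio n, {ρ | z ρ m = a}) ∈ U := by
      filter_upwards [hbox m] with ρ hρ
      simpa using (hz ρ).1 m hρ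
    obtain ⟨a, ha, h2⟩ := (Ultrafilter.finite_biUnion_mem_iff (Set.finite_Iio n)).1 h1
    exact ⟨a, ha, h2⟩
  choose x hxn hx using h
  refine ⟨x, ⟨hxn, ?_⟩, hx⟩
  rintro p hp ⟨v, hv⟩
  have h1 : ∀ᶠ ρ in (U : Filter ℕ), ∀ q ∈ p.toFinset, z ρ (v + q.1) = x (v + q.1) :=
    (Filter.eventually_all_finset _).2 fun q _ => hx _
  obtain ⟨ρ, h2, h3⟩ := (h1.and (hbox v)).exists
  exact (hz ρ).2 p hp v h3 fun q hq => (h2 q (List.mem_toFinset.2 hq)).trans (hv q hq)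

theorem exists_det_radius {n : ℕ} {F : List (List ((ℤ × ℤ) × ℕ))} {X : Set (ℤ × ℤ → ℕ)}
    (hX : X = {x | (∀ m : ℤ × ℤ, x m < n) ∧ ∀ p ∈ F, ¬ occursL p x}) (h : DetInDir (1, 1) X) :
    ∃ ρ, ∀ z z', Locally n F ρ z → Locally n F ρ z' →
      (∀ m ∈ boxR ρ, m.1 + m.2 ≤ -1 → z m = z' m) → z 0 = z' 0 := by
  by_contra! hc
  choose z z' hz hz' hzz h0 using hc
  let U := Filter.hyperfilter ℕ
  have hU : (U : Filter ℕ) ≤ Filter.atTop := by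
    rw [← Nat.cofinite_eq_atTop]
    exact Filter.hyperfilter_le_cofinite
  obtain ⟨x, hx, hxz⟩ := exists_limit hU hz
  obtain ⟨x', hx', hxz'⟩ := exists_limit hU hz'
  have e : x = x' := by
    refine low_eq_of_detInDir h (by rw [hX]; exact hx) (by rw [hX]; exact hx') fun m hm => ?_
    obtain ⟨r, hr⟩ := exists_boxR {m}
    obtain ⟨ρ, ⟨h1, h2⟩, h3⟩ := (((hxz m).and (hxz' m)).and
      (hU (Filter.eventually_ge_atTop r))).exists
    rw [← h1, ← h2]
    exact hzz ρ m (boxR_mono h3 (hr (Finset.mem_singleton_self m))) hm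
  obtain ⟨ρ, h1, h2⟩ := ((hxz 0).and (hxz' 0)).exists
  exact h0 ρ (by rw [h1, h2, e])

theorem exists_coord_bound (F : List (List ((ℤ × ℤ) × ℕ))) : ∃ r : ℕ, ∀ k ≥ r, ∀ p ∈ F, ∀ q ∈ p,
    q.1.1.toNat + (-q.1.1).toNat ≤ k ∧ q.1.2.toNat + (-q.1.2).toNat ≤ k := by
  obtain ⟨r, hr⟩ := exists_boxR ((F.flatten.map Prod.fst).toFinset)
  refine ⟨r, fun k hk p hp q hq => ?_⟩
  have h : q.1 ∈ boxR r := hr (by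
    simp only [List.mem_toFinset, List.mem_map, List.mem_flatten]
    exact ⟨q, ⟨p, hp, hq⟩, rfl⟩)
  rw [mem_boxR] at h
  omega

theorem Sub.cell_eq {n k z t e e' : ℕ} (h : Sub n k z t e e') {u : ℤ × ℤ}
    (h1 : (e : ℤ) ≤ u.1) (h2 : u.1 < e + side k) (h3 : (e' : ℤ) ≤ u.2) (h4 : u.2 < e' + side k) :
    cell n k z u = dig n t ((u.1 - e).toNat + side k * (u.2 - e').toNat) := by
  rw [h.2 _ (by omega) _ (by omega), cell]
  congr 3 <;> omega

theorem Locally.of_adm {n k z ρ : ℕ} {F : List (List ((ℤ × ℤ) × ℕ))} (hn : 0 < n)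
    (hF : ∀ p ∈ F, ∀ q ∈ p,
      q.1.1.toNat + (-q.1.1).toNat ≤ k ∧ q.1.2.toNat + (-q.1.2).toNat ≤ k)
    (h : Adm n F k z) (hρ : ρ ≤ k) :
    Locally n F ρ fun v => cell n k z ((2 * (side k : ℤ) - 1, 2 * (side k : ℤ) - 1) + crd k v) := by
  refine Locally.mono ⟨fun m _ => dig_lt hn _ _, fun p hp v hv hq => ?_⟩ hρ
  have hs : side k = 2 * rad k + 1 := rfl
  have hb := mem_boxR.1 (crd_bound (k := k) (boxR_mono (by omega) hv))
  refine h p hp (2 * side k - 1 + (crd k v).1).toNat (by omega)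
    (2 * side k - 1 + (crd k v).2).toNat (by omega) (hit_iff.2 fun q hqp => ?_)
  have e : ((((2 * side k - 1 + (crd k v).1).toNat : ℤ), ((2 * side k - 1 + (crd k v).2).toNat : ℤ)) :
      ℤ × ℤ) + crd k q.1 = (2 * (side k : ℤ) - 1, 2 * (side k : ℤ) - 1) + crd k (v + q.1) := by
    rw [map_add, ← add_assoc]
    congr 1
    ext <;> simp only [Prod.fst_add, Prod.snd_add] <;> omega
  rw [e]
  refine ⟨?_, hq q hqp⟩
  have hv' : v + q.1 ∈ boxR (2 * k) := by
    have := hF p hp q hqp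
    rw [mem_boxR] at hv ⊢
    simp only [Prod.fst_add, Prod.snd_add]
    omega
  have hb' := mem_boxR.1 (crd_bound hv')
  simp only [InBox, Prod.fst_add, Prod.snd_add]
  omega

theorem exists_good_false (n : ℕ) (F : List (List ((ℤ × ℤ) × ℕ))) : ∃ k, Good false n F k := by
  obtain ⟨r, hr⟩ := exists_coord_bound F
  exact ⟨r, hr r le_rfl, by simp⟩

theorem exists_good_true {n : ℕ} {F : List (List ((ℤ × ℤ) × ℕ))} {X : Set (ℤ × ℤ → ℕ)}
    (hX : X = {x | (∀ m : ℤ × ℤ, x m < n) ∧ ∀ p ∈ F, ¬ occursL p x}) (h : DetInDir (1, 1) X) :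
    ∃ k, Good true n F k := by
  obtain ⟨r, hr⟩ := exists_coord_bound F
  obtain ⟨ρ, hρ⟩ := exists_det_radius hX h
  obtain ⟨k, hrk, hρk⟩ : ∃ k, r ≤ k ∧ ρ ≤ k := ⟨max r ρ, by simp, by simp⟩
  refine ⟨k, hr k hrk, fun _ w _ s _ t ht t' ht' => ?_⟩
  rintro ⟨⟨z, _, hz, hw, hs, htz⟩, ⟨z', _, hz', hw', hs', htz'⟩, hne⟩
  apply hne
  have hn : 0 < n := Nat.pos_of_ne_zero fun h => by
    subst h
    rw [Nat.zero_pow (by simp [side])] at ht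
    omega
  have hsd : side k = 2 * rad k + 1 := rfl
  have key := hρ _ _ (Locally.of_adm hn (hr k hrk) hz hρk) (Locally.of_adm hn (hr k hrk) hz' hρk) ?_
  · refine eq_of_dig_square ht ht' fun a ha b hb => ?_
    rw [htz.2 a ha b hb, htz'.2 a ha b hb]
    by_cases hb' : b < side k - 1
    · have h1 := hs.2 a ha (b + 1) (by omega)
      have h2 := hs'.2 a ha (b + 1) (by omega)
      rw [show b + 1 + 2 * rad k = b + side k by omega] at h1 h2
      rw [← h1, ← h2]
    by_cases ha' : a < side k - 1
    · have h1 := hw.2 (a + 1) (by omega) b hb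
      have h2 := hw'.2 (a + 1) (by omega) b hb
      rw [show a + 1 + 2 * rad k = a + side k by omega] at h1 h2
      rw [← h1, ← h2]
    · rw [map_zero, add_zero] at key
      have e : (2 * (side k : ℤ) - 1).toNat = 2 * side k - 1 := by omega
      simp only [cell, e] at key
      rw [show a = side k - 1 by omega, show b = side k - 1 by omega,
        show side k - 1 + side k = 2 * side k - 1 by omega]
      exact key
  · intro m hm hm'
    have hb := mem_boxR.1 (crd_bound (k := k) (boxR_mono (by omega) hm))
    rw [mem_boxR] at hm
    have hk : (0 : ℤ) ≤ k := by positivity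
    have h1 : (crd k m).1 ≤ 0 := by rw [crd_fst]; nlinarith
    have h2 : (crd k m).2 ≤ -1 := by rw [crd_snd]; nlinarith
    rw [hs.cell_eq, hs'.cell_eq] <;> simp only [Prod.fst_add, Prod.snd_add] <;> omega

/-! ### Configurations of window codes -/

/-- The configurations over `{0, …, n - 1}` avoiding the patterns of `F`. -/
def avoid (n : ℕ) (F : List (List ((ℤ × ℤ) × ℕ))) : Set (ℤ × ℤ → ℕ) :=
  {x | (∀ m : ℤ × ℤ, x m < n) ∧ ∀ p ∈ F, ¬ occursL p x}

/-- The relation between positive codes of neighbouring windows. -/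
def RelPos (n : ℕ) (F : List (List ((ℤ × ℤ) × ℕ))) (k p q y : ℕ) : Prop :=
  1 ≤ p ∧ 1 ≤ q ∧ 1 ≤ y ∧ Rel n F k (p - 1) (q - 1) (y - 1)

/-- The placement of the window codes. -/
def plc : (ℤ × ℤ) ≃+ (ℤ × ℤ) where
  toFun m := (m.2 - 2 * m.1, m.1)
  invFun u := (u.2, u.1 + 2 * u.2)
  left_inv m := by ext <;> simp
  right_inv m := by ext <;> simp
  map_add' v w := by
    ext
    · simp; ring
    · simp

theorem exists_wind (n k : ℕ) (x : ℤ × ℤ → ℕ) (u : ℤ × ℤ) : ∃ t : ℕ, (∀ m, x m < n) →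
    t < n ^ (side k * side k) ∧ ∀ a < side k, ∀ b < side k,
      dig n t (a + side k * b) = x ((crd k).symm (u + ((a : ℤ), (b : ℤ)))) := by
  by_cases h : ∀ m, x m < n
  · obtain ⟨t, ht, hd⟩ := exists_dig_square (s := side k)
      (fun a b => x ((crd k).symm (u + ((a : ℤ), (b : ℤ))))) fun a _ b _ => h _
    exact ⟨t, fun _ => ⟨ht, hd⟩⟩
  · exact ⟨0, fun h' => absurd h' h⟩

/-- The code of the window of `x` at the position `u` in the new coordinates. -/
noncomputable def wind (n k : ℕ) (x : ℤ × ℤ → ℕ) (u : ℤ × ℤ) : ℕ :=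
  Classical.choose (exists_wind n k x u)

/-- The configuration of the positive codes of the windows of `x`. -/
noncomputable def enc (n k : ℕ) (x : ℤ × ℤ → ℕ) (m : ℤ × ℤ) : ℕ := wind n k x (plc m) + 1

section

variable {n k : ℕ} {F : List (List ((ℤ × ℤ) × ℕ))} {x y : ℤ × ℤ → ℕ}

theorem wind_lt (hx : ∀ m, x m < n) (u : ℤ × ℤ) : wind n k x u < n ^ (side k * side k) :=
  (Classical.choose_spec (exists_wind n k x u) hx).1

theorem dig_wind (hx : ∀ m, x m < n) (u : ℤ × ℤ) {a b : ℕ} (ha : a < side k) (hb : b < side k) :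
    dig n (wind n k x u) (a + side k * b) = x ((crd k).symm (u + ((a : ℤ), (b : ℤ)))) :=
  (Classical.choose_spec (exists_wind n k x u) hx).2 a ha b hb

theorem sub_wind {z e e' : ℕ} {u v : ℤ × ℤ} (hx : ∀ m, x m < n) (hv : v = u + ((e : ℤ), (e' : ℤ)))
    (he : e ≤ 2 * side k) (he' : e' ≤ 2 * side k)
    (hz : ∀ a < 3 * side k, ∀ b < 3 * side k,
      dig n z (a + 3 * side k * b) = x ((crd k).symm (u + ((a : ℤ), (b : ℤ))))) :
    Sub n k z (wind n k x v) e e' := by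
  refine ⟨wind_lt hx v, fun a ha b hb => ?_⟩
  rw [dig_wind hx v ha hb, hz _ (by omega) _ (by omega), hv]
  congr 2
  ext <;> simp <;> ring

theorem rel_wind (hx : x ∈ avoid n F) (u : ℤ × ℤ) :
    Rel n F k (wind n k x (u - (1, 0))) (wind n k x (u - (0, 1))) (wind n k x u) := by
  set u₀ : ℤ × ℤ := u - ((side k : ℤ), (side k : ℤ)) with hu₀
  obtain ⟨z, hz, hd⟩ := exists_dig_square (n := n) (s := 3 * side k)
    (fun a b => x ((crd k).symm (u₀ + ((a : ℤ), (b : ℤ))))) fun a _ b _ => hx.1 _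
  have hs : side k = 2 * rad k + 1 := rfl
  refine ⟨z, hz, ?_, sub_wind hx.1 ?_ (by omega) (by omega) hd,
    sub_wind hx.1 ?_ (by omega) (by omega) hd, sub_wind hx.1 ?_ (by omega) (by omega) hd⟩
  · intro p hp c _ d _ hhit
    rw [hit_iff] at hhit
    refine hx.2 p hp ⟨(crd k).symm (u₀ + ((c : ℤ), (d : ℤ))), fun q hq => ?_⟩
    obtain ⟨⟨⟨h1, h2⟩, h3, h4⟩, h⟩ := hhit q hq
    rw [cell, hd _ (by omega) _ (by omega)] at h
    rw [← h]
    congr 1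
    apply (crd k).injective
    rw [map_add, AddEquiv.apply_symm_apply, AddEquiv.apply_symm_apply, add_assoc]
    congr 1
    ext
    · exact (Int.toNat_of_nonneg h1).symm
    · exact (Int.toNat_of_nonneg h3).symm
  all_goals
    rw [hu₀]
    ext <;> simp <;> omega

theorem enc_rel (hx : x ∈ avoid n F) (A B : ℤ) :
    RelPos n F k (enc n k x (A, B)) (enc n k x (A - 1, B - 1)) (enc n k x (A, B + 1)) := by
  refine ⟨by simp [enc], by simp [enc], by simp [enc], ?_⟩
  simp only [enc, Nat.add_sub_cancel]
  convert rel_wind hx (plc (A, B + 1)) using 2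
  · ext <;> simp [plc]; ring
  · ext <;> simp [plc]; ring

theorem patLE2_of_enc (hx : ∀ m, x m < n) (hy : ∀ m, y m < n)
    (h : patLE2 (enc n k x) (enc n k y)) : patLE2 x y := by
  refine ple_map_of_local (fun r => ?_) h
  obtain ⟨R, hR⟩ := exists_boxR ((boxR r).image fun m => plc.symm (crd k m))
  refine ⟨R, fun v hv => ⟨(crd k).symm (plc v), fun m hm => ?_⟩⟩
  have h1 := hv _ (hR (Finset.mem_image_of_mem _ hm))
  simp only [enc, Nat.add_right_cancel_iff, map_add, AddEquiv.apply_symm_apply] at h1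
  have hs : 0 < side k := by simp [side]
  have h2 := dig_wind hy (plc v + crd k m) hs hs
  have h3 := dig_wind hx (crd k m) hs hs
  have e : (((0 : ℕ) : ℤ), ((0 : ℕ) : ℤ)) = (0 : ℤ × ℤ) := rfl
  rw [e, add_zero] at h2 h3
  rw [map_add, AddEquiv.symm_apply_apply] at h2
  rw [AddEquiv.symm_apply_apply] at h3
  rw [← h2, ← h3, h1]

theorem patLE2_enc (hx : ∀ m, x m < n) (hy : ∀ m, y m < n) (h : patLE2 x y) :
    patLE2 (enc n k x) (enc n k y) := by
  refine ple_map_of_local (fun r => ?_) h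
  obtain ⟨R, hR⟩ := exists_boxR ((boxR r ×ˢ (Finset.range (side k) ×ˢ Finset.range (side k))).image
    fun j => (crd k).symm (plc j.1 + ((j.2.1 : ℤ), (j.2.2 : ℤ))))
  refine ⟨R, fun v hv => ⟨plc.symm (crd k v), fun m hm => ?_⟩⟩
  simp only [enc, Nat.add_right_cancel_iff]
  refine eq_of_dig_square (wind_lt hy _) (wind_lt hx _) fun a ha b hb => ?_
  rw [dig_wind hy _ ha hb, dig_wind hx _ ha hb]
  have h1 := hv _ (hR (Finset.mem_image_of_mem _ (a := (m, a, b)) (by simp [hm, ha, hb])))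
  rw [← h1]
  congr 1
  rw [map_add plc, AddEquiv.apply_symm_apply, add_assoc, map_add (crd k).symm,
    AddEquiv.symm_apply_apply]

theorem enc_patLE2_iff (hx : ∀ m, x m < n) (hy : ∀ m, y m < n) :
    patLE2 (enc n k x) (enc n k y) ↔ patLE2 x y :=
  ⟨patLE2_of_enc hx hy, patLE2_enc hx hy⟩

theorem dig_shift {t : ℤ × ℤ → ℕ}
    (ht : ∀ u, Rel n F k (t (u - (1, 0))) (t (u - (0, 1))) (t u)) : ∀ {a b : ℕ} {u : ℤ × ℤ},
    a < side k → b < side k →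
      dig n (t u) (a + side k * b) = dig n (t (u + ((a : ℤ), (b : ℤ)))) 0 := by
  have hs : side k = 2 * rad k + 1 := rfl
  intro a
  induction a with
  | zero =>
    intro b
    induction b with
    | zero =>
      intro u _ _
      have e : (((0 : ℕ) : ℤ), ((0 : ℕ) : ℤ)) = (0 : ℤ × ℤ) := rfl
      rw [e, add_zero, Nat.mul_zero]
    | succ b ih =>
      intro u ha hb
      obtain ⟨z, _, _, _, h2, h3⟩ := ht (u + (0, 1))
      have e := h2.2 0 ha (b + 1) hb
      have e' := h3.2 0 ha b (by omega)
      rw [add_sub_cancel_right] at e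
      rw [show b + 1 + 2 * rad k = b + side k by omega] at e
      rw [e, ← e', ih ha (by omega), add_assoc]
      congr 3
      ext <;> simp; ring
  | succ a ih =>
    intro b u ha hb
    obtain ⟨z, _, _, h2, _, h3⟩ := ht (u + (1, 0))
    have e := h2.2 (a + 1) ha b hb
    have e' := h3.2 a (by omega) b hb
    rw [add_sub_cancel_right] at e
    rw [show a + 1 + 2 * rad k = a + side k by omega] at e
    rw [e, ← e', ih (by omega) hb, add_assoc]
    congr 3
    ext <;> simp; ring

theorem exists_eq_enc (hF : ∀ p ∈ F, ∀ q ∈ p,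
      q.1.1.toNat + (-q.1.1).toNat ≤ k ∧ q.1.2.toNat + (-q.1.2).toNat ≤ k)
    {θ : ℤ × ℤ → ℕ}
    (hθ : ∀ A B : ℤ, RelPos n F k (θ (A, B)) (θ (A - 1, B - 1)) (θ (A, B + 1))) :
    ∃ x ∈ avoid n F, θ = enc n k x := by
  have hs : side k = 2 * rad k + 1 := rfl
  set t : ℤ × ℤ → ℕ := fun u => θ (plc.symm u) - 1 with htdef
  have ht : ∀ u, Rel n F k (t (u - (1, 0))) (t (u - (0, 1))) (t u) := by
    intro u
    have h := (hθ u.2 (u.1 + 2 * u.2 - 1)).2.2.2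
    convert h using 1
    · simp [t, plc]; ring_nf
    · simp [t, plc]; ring_nf
    · simp [t, plc]
  have hn : 0 < n := Nat.pos_of_ne_zero fun h => by
    obtain ⟨z, _, _, h2, _⟩ := ht 0
    have := h2.1
    rw [h, Nat.zero_pow (by simp [side])] at this
    omega
  set x : ℤ × ℤ → ℕ := fun m => dig n (t (crd k m)) 0 with hxdef
  have hxn : ∀ m, x m < n := fun m => dig_lt hn _ _
  refine ⟨x, ⟨hxn, ?_⟩, ?_⟩
  · rintro p hp ⟨v, hv⟩
    obtain ⟨z, _, hz, _, _, h3⟩ := ht (crd k v - ((rad k : ℤ), (rad k : ℤ)))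
    refine hz p hp (side k + rad k) (by omega) (side k + rad k) (by omega) (hit_iff.2 fun q hq => ?_)
    have hb := mem_boxR.1 (crd_bound (k := k) (v := q.1) (by
      have := hF p hp q hq
      rw [mem_boxR]
      omega))
    refine ⟨by simp only [InBox, Prod.fst_add, Prod.snd_add]; omega, ?_⟩
    rw [h3.cell_eq (by simp only [Prod.fst_add]; omega) (by simp only [Prod.fst_add]; omega)
      (by simp only [Prod.snd_add]; omega) (by simp only [Prod.snd_add]; omega),
      dig_shift ht (by simp only [Prod.fst_add]; omega) (by simp only [Prod.snd_add]; omega),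
      ← hv q hq]
    simp only [x, map_add]
    congr 2
    ext <;> simp only [Prod.fst_add, Prod.snd_add, Prod.fst_sub, Prod.snd_sub] <;> omega
  · funext m
    have h1 : 1 ≤ θ m := by
      have := (hθ m.1 m.2).1
      exact this
    have h2 : t (plc m) = wind n k x (plc m) := by
      obtain ⟨z, _, _, _, _, h3⟩ := ht (plc m)
      refine eq_of_dig_square h3.1 (wind_lt hxn _) fun a ha b hb => ?_
      rw [dig_wind hxn _ ha hb, dig_shift ht ha hb]
      simp only [x, AddEquiv.apply_symm_apply]
    rw [enc, ← h2]
    simp only [t, AddEquiv.symm_apply_apply]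
    omega

end

/-! ### The computable rule -/

open Classical in
/-- The positive code determined by those of the neighbouring windows and the guess `α`,
or `0` if there is none. -/
noncomputable def nextCode (δ : Bool) (n : ℕ) (F : List (List ((ℤ × ℤ) × ℕ))) (k p q α : ℕ) : ℕ :=
  Nat.findGreatest (fun y => RelPos n F k p q y ∧ α = if δ then 0 else y) (n ^ (side k * side k))

section

variable {δ : Bool} {n k p q α y : ℕ} {F : List (List ((ℤ × ℤ) × ℕ))}

theorem RelPos.le (h : RelPos n F k p q y) : p ≤ n ^ (side k * side k) ∧
    q ≤ n ^ (side k * side k) ∧ y ≤ n ^ (side k * side k) := by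
  obtain ⟨hp, hq, hy, z, _, _, h1, h2, h3⟩ := h
  have := h1.1
  have := h2.1
  have := h3.1
  omega

theorem nextCode_spec (h : nextCode δ n F k p q α ≠ 0) :
    RelPos n F k p q (nextCode δ n F k p q α) ∧ α = if δ then 0 else nextCode δ n F k p q α := by
  classical
  exact Nat.findGreatest_of_ne_zero rfl h

theorem nextCode_le (h : nextCode δ n F k p q α ≠ 0) : p ≤ n ^ (side k * side k) ∧
    q ≤ n ^ (side k * side k) ∧ α ≤ n ^ (side k * side k) := by
  obtain ⟨h1, h2⟩ := nextCode_spec h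
  refine ⟨h1.le.1, h1.le.2.1, ?_⟩
  rw [h2]
  split_ifs
  · exact Nat.zero_le _
  · exact h1.le.2.2

theorem nextCode_iff (hG : Good δ n F k) :
    nextCode δ n F k p q (if δ then 0 else y) = y ∧ y ≠ 0 ↔ RelPos n F k p q y := by
  classical
  constructor
  · rintro ⟨h, hy⟩
    have := (nextCode_spec (h.trans_ne hy)).1
    rwa [h] at this
  · intro h
    refine ⟨?_, by have := h.2.2.1; omega⟩
    have hs := Nat.findGreatest_spec (P := fun y' => RelPos n F k p q y' ∧
      (if δ then 0 else y) = if δ then 0 else y') h.le.2.2 ⟨h, rfl⟩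
    change RelPos n F k p q (nextCode δ n F k p q (if δ then 0 else y)) ∧
      (if δ then 0 else y) = if δ then 0 else (nextCode δ n F k p q (if δ then 0 else y)) at hs
    generalize nextCode δ n F k p q (if δ then 0 else y) = y' at hs ⊢
    cases δ with
    | false => simpa using hs.2.symm
    | true =>
      by_contra hne
      have hl := h.le
      have hl' := hs.1.le
      have h1 := h.1
      have h2 := h.2.1
      have h3 := h.2.2.1
      have h4 := hs.1.2.2.1
      exact hG.2 rfl (p - 1) (by omega) (q - 1) (by omega) (y - 1) (by omega) (y' - 1) (by omega)
        ⟨h.2.2.2, hs.1.2.2.2, by omega⟩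

end

section

open Primrec

theorem primrec_nextCode (δ : Bool) {α : Type*} [Primcodable α] {n k p q c : α → ℕ}
    {F : α → List (List ((ℤ × ℤ) × ℕ))} (hn : Primrec n) (hF : Primrec F) (hk : Primrec k)
    (hp : Primrec p) (hq : Primrec q) (hc : Primrec c) :
    Primrec fun a => nextCode δ (n a) (F a) (k a) (p a) (q a) (c a) := by
  classical
  have one_le : ∀ {β : Type _} [Primcodable β] {g : β → ℕ}, Primrec g →
      PrimrecPred fun b => 1 ≤ g b := fun hg => nat_le.comp (const 1) hg
  have hpos : PrimrecPred fun b : α × ℕ => RelPos (n b.1) (F b.1) (k b.1) (p b.1) (q b.1) b.2 :=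
    (one_le (hp.comp fst)).and <| (one_le (hq.comp fst)).and <| (one_le snd).and <|
      primrecPred_rel (hn.comp fst) (hF.comp fst) (hk.comp fst)
        (primrec_sub (hp.comp fst) (const 1)) (primrec_sub (hq.comp fst) (const 1))
        (primrec_sub snd (const 1))
  have hg : Primrec fun b : α × ℕ => if δ then 0 else b.2 := by
    cases δ with
    | false => exact snd
    | true => exact const 0
  have h : PrimrecRel fun (a : α) (y : ℕ) => RelPos (n a) (F a) (k a) (p a) (q a) y ∧
      c a = if δ then 0 else y := hpos.and (Primrec.eq.comp (hc.comp fst) hg)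
  exact nat_findGreatest (primrec_pow hn (primrec_mul (primrec_side hk) (primrec_side hk))) h

theorem exists_computable_good {δ : Bool} {n : ℕ → ℕ} (hn : Computable n)
    {f : ℕ → List (List ((ℤ × ℤ) × ℕ))} (hf : Computable f)
    (h : ∀ i, ∃ k, Good δ (n i) (f i) k) :
    ∃ K : ℕ → ℕ, Computable K ∧ ∀ i, Good δ (n i) (f i) (K i) := by
  classical
  refine ⟨fun i => Nat.find (h i), ?_, fun i => Nat.find_spec (h i)⟩
  have h0 : PrimrecPred fun a : (ℕ × List (List ((ℤ × ℤ) × ℕ))) × ℕ => Good δ a.1.1 a.1.2 a.2 :=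
    primrecPred_good δ (fst.comp fst) (snd.comp fst) snd
  have h1 : Computable₂ fun (i k : ℕ) => decide (Good δ (n i) (f i) k) :=
    h0.decide.to_comp.comp
      (((hn.comp Computable.fst).pair (hf.comp Computable.fst)).pair Computable.snd)
  have h2 : Partrec fun i => Nat.rfind fun k => Part.some (decide (Good δ (n i) (f i) k)) :=
    Partrec.rfind h1
  refine h2.of_eq fun i => Part.eq_some_iff.2 (Nat.mem_rfind.2 ⟨?_, fun {m} hm => ?_⟩)
  · rw [Part.mem_some_iff, eq_comm, decide_eq_true_eq]
    exact Nat.find_spec (h i)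
  · rw [Part.mem_some_iff, eq_comm, decide_eq_false_iff_not]
    exact Nat.find_min (h i) hm

theorem computable_nextCode (δ : Bool) {n K : ℕ → ℕ} (hn : Computable n)
    {f : ℕ → List (List ((ℤ × ℤ) × ℕ))} (hf : Computable f) (hK : Computable K) :
    Computable fun v : List.Vector ℕ 4 =>
      nextCode δ (n (v.get 0)) (f (v.get 0)) (K (v.get 0)) (v.get 1) (v.get 2) (v.get 3) := by
  have h : Primrec fun a : (ℕ × List (List ((ℤ × ℤ) × ℕ)) × ℕ) × List.Vector ℕ 4 =>
      nextCode δ a.1.1 a.1.2.1 a.1.2.2 (a.2.get 1) (a.2.get 2) (a.2.get 3) :=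
    primrec_nextCode δ (fst.comp fst) (fst.comp (snd.comp fst)) (snd.comp (snd.comp fst))
      (vector_get.comp snd (const 1)) (vector_get.comp snd (const 2))
      (vector_get.comp snd (const 3))
  have h0 : Computable fun v : List.Vector ℕ 4 => v.get 0 :=
    (vector_get.comp Primrec.id (const 0)).to_comp
  exact h.to_comp.comp (((hn.comp h0).pair ((hf.comp h0).pair (hK.comp h0))).pair Computable.id)

end

/-- The union theorem for a suitable family of parameters. -/
theorem exists_union_of_good (δ : Bool) {n : ℕ → ℕ} (hn : Computable n)
    {f : ℕ → List (List ((ℤ × ℤ) × ℕ))} (hf : Computable f)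
    (hG : ∀ i, ∃ k, Good δ (n i) (f i) k) (hcnt : ∀ i, (avoid (n i) (f i)).Countable) :
    ∃ (S : Type) (_ : Fintype S) (X : Set (ℤ × ℤ → S)),
      IsSFT2 X ∧ X.Countable ∧
      (∃ (P' : Type) (instP : PartialOrder P'),
        letI := instP
        (∀ c : Fin 5 → P', ¬ StrictMono c) ∧
        Nonempty (SP X ≃o (P' ⊕ (Σ i : ℕ, SP (avoid (n i) (f i)))))) ∧
      (δ = true → DetInDir (1, 1) X) := by
  obtain ⟨K, hK, hKG⟩ := exists_computable_good hn hf hG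
  have hβ : Computable fun i => n i ^ (side (K i) * side (K i)) := by
    have h : Primrec fun a : ℕ × ℕ => a.1 ^ (side a.2 * side a.2) :=
      primrec_pow Primrec.fst (primrec_mul (primrec_side Primrec.snd) (primrec_side Primrec.snd))
    exact h.to_comp.comp (hn.pair hK)
  obtain ⟨St, κ, _, _, M, Nf, hM, hNf⟩ := exists_mach
    (φ := fun i p q α => nextCode δ (n i) (f i) (K i) p q α) (computable_nextCode δ hn hf hK) hβ
    fun i p q α h => nextCode_le h
  have hT : ∀ i θ, θ ∈ Theta (fun i p q α => nextCode δ (n i) (f i) (K i) p q α) δ i ↔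
      ∀ A B : ℤ, RelPos (n i) (f i) (K i) (θ (A, B)) (θ (A - 1, B - 1)) (θ (A, B + 1)) :=
    fun i θ => forall₂_congr fun A B => nextCode_iff (hKG i)
  refine exists_union_of_machine M δ hM ?_ hNf (fun i => avoid (n i) (f i)) hcnt
    (fun i x => enc (n i) (K i) x.1) (fun i x => (hT i _).2 (enc_rel x.2))
    (fun i x y => enc_patLE2_iff x.2.1 y.2.1) fun i θ hθ => ?_
  · rintro rfl i p q α h
    simpa using (nextCode_spec h).2.symm
  · obtain ⟨x, hx, h⟩ := exists_eq_enc (hKG i).1 ((hT i θ).1 hθ)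
    exact ⟨⟨x, hx⟩, 0, by rw [shift2_zero, h]⟩

end UnionSFT

/-- Given an effective sequence of countable two-dimensional SFTs `Xs i`
(each over the finite alphabet `{0, …, n i − 1}`, cut out by the computable list `f i` of
forbidden patterns), there is a countable two-dimensional SFT `X` whose subpattern poset is
the incomparable disjoint union of a poset `P'` with no chain of 5 elements and the posets
`SP (Xs i)`; moreover if every `Xs i` is deterministic in the direction `(1,1)`, then `X` can
be chosen deterministic in the direction `(1,1)` as well. -/
theorem union_of_subpattern_posets (n : ℕ → ℕ) (hn : Computable n)
    (f : ℕ → List (List ((ℤ × ℤ) × ℕ))) (hf : Computable f)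
    (Xs : ℕ → Set (ℤ × ℤ → ℕ))
    (hXs : ∀ i, Xs i = {x | (∀ m : ℤ × ℤ, x m < n i) ∧ ∀ p ∈ f i, ¬ occursL p x})
    (hcnt : ∀ i, (Xs i).Countable) :
    ∃ (S : Type) (_ : Fintype S) (X : Set (ℤ × ℤ → S)),
      IsSFT2 X ∧ X.Countable ∧
      (∃ (P' : Type) (instP : PartialOrder P'),
        letI := instP
        (∀ c : Fin 5 → P', ¬ StrictMono c) ∧
        Nonempty (SP X ≃o (P' ⊕ (Σ i : ℕ, SP (Xs i))))) ∧
      ((∀ i, DetInDir (1, 1) (Xs i)) → DetInDir (1, 1) X) := by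
  obtain rfl : Xs = fun i => UnionSFT.avoid (n i) (f i) := funext hXs
  by_cases hdet : ∀ i, DetInDir (1, 1) (UnionSFT.avoid (n i) (f i))
  · obtain ⟨S, hS, X, h1, h2, h3, h4⟩ := UnionSFT.exists_union_of_good true hn hf
      (fun i => UnionSFT.exists_good_true rfl (hdet i)) hcnt
    exact ⟨S, hS, X, h1, h2, h3, fun _ => h4 rfl⟩
  · obtain ⟨S, hS, X, h1, h2, h3, _⟩ := UnionSFT.exists_union_of_good false hn hf
      (fun i => UnionSFT.exists_good_false (n i) (f i)) hcnt
    exact ⟨S, hS, X, h1, h2, h3, fun h => absurd h hdet⟩
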